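/- arXiv:2603.16234 — 2 statements merged into one kernel-verified Lean document; each statement's English description precedes it below -/
import Mathlib

section
/- Let X = x₁⋯x_n and U be irreducible words such that the word X⁻¹UX is freely reduced and contains no (4g−1)-LLFR. If the word nf(X⁻¹U)·X is not freely reduced, then rs(X⁻¹,U) = (X′,U) where X′ is a suffix of X⁻¹, and nf(X⁻¹U) = W x₁⁻¹ for some irreducible word W. Furthermore, one of the following holds: (a) X⁻¹ ends with the letter b₁ and U = (b₂⋯b_{2g})^t for some b₁⋯b_{4g} ∈ 𝓡 and some t ≥ 1; (b) the word W x₂⋯x_n is irreducible (hence equals the normal form of the element represented by X⁻¹UX) and (2n + |U|) − |W x₂⋯x_n| ≤ 4g + 2. -/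
namespace SG

/-- A letter of the alphabet `S± = {cᵢ^{±1}}`: `(i, true)` is `c_{i+1}`,
`(i, false)` is `c_{i+1}⁻¹`. -/
abbrev Letter (g : ℕ) := Fin (2*g) × Bool

/-- A word in the alphabet `S±`. -/
abbrev Word (g : ℕ) := List (Letter g)

/-- The surface relator `c₁c₂⋯c_{2g}c₁⁻¹c₂⁻¹⋯c_{2g}⁻¹` in the free group. -/
def relator (g : ℕ) : FreeGroup (Fin (2*g)) :=
  (List.ofFn fun i : Fin (2*g) => FreeGroup.of i).prod *
  (List.ofFn fun i : Fin (2*g) => (FreeGroup.of i)⁻¹).prod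

/-- The surface group with the symmetric presentation. -/
abbrev SurfaceGroup (g : ℕ) :=
  PresentedGroup ({relator g} : Set (FreeGroup (Fin (2*g))))

/-- The generator `c_{i+1}` of the surface group. -/
def gen (g : ℕ) (i : Fin (2*g)) : SurfaceGroup g := PresentedGroup.of i

/-- The inverse of a letter. -/
def invLetter (g : ℕ) (a : Letter g) : Letter g := (a.1, !a.2)

/-- The group element represented by a letter. -/
def evalLetter (g : ℕ) (a : Letter g) : SurfaceGroup g :=
  if a.2 then gen g a.1 else (gen g a.1)⁻¹

/-- The group element represented by a word. -/
def eval (g : ℕ) (W : Word g) : SurfaceGroup g := (W.map (evalLetter g)).prod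

/-- The formal inverse `x_n⁻¹ ⋯ x₁⁻¹` of a word `x₁ ⋯ x_n`. -/
def wordInv (g : ℕ) (W : Word g) : Word g := (W.map (invLetter g)).reverse

/-- Word length of a group element: the least `n` such that the element is a
product of `n` elements of `S ∪ S⁻¹`. -/
noncomputable def len (g : ℕ) (u : SurfaceGroup g) : ℕ :=
  sInf {n | ∃ W : Word g, W.length = n ∧ eval g W = u}

/-- `conjLen g u v` is the minimum of `|x|` over conjugators `x` with `x⁻¹ux = v`. -/
noncomputable def conjLen (g : ℕ) (u v : SurfaceGroup g) : ℕ :=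
  sInf {k | ∃ x : SurfaceGroup g, x⁻¹ * u * x = v ∧ len g x = k}

/-- The conjugator length function: `CL g n` is the least `N` such that any
conjugate `u, v` with `|u| + |v| ≤ n` admit a conjugator of length `≤ N`. -/
noncomputable def CL (g : ℕ) (n : ℕ) : ℕ :=
  sInf {N | ∀ u v : SurfaceGroup g,
    (∃ x : SurfaceGroup g, x⁻¹ * u * x = v) → len g u + len g v ≤ n →
      conjLen g u v ≤ N}

/-- Rank of a letter in the ascending order
`c_{2g} ≺ ⋯ ≺ c₂ ≺ c₁ ≺ c₁⁻¹ ≺ c₂⁻¹ ≺ ⋯ ≺ c_{2g}⁻¹`. -/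
def rank (g : ℕ) (a : Letter g) : ℕ :=
  if a.2 then (2*g - 1) - (a.1 : ℕ) else 2*g + (a.1 : ℕ)

/-- The strict order `≺` on letters. -/
def letterLt (g : ℕ) (a b : Letter g) : Prop := rank g a < rank g b

/-- The length-lexicographical order `≺` on words. -/
def wordLt (g : ℕ) (X Y : Word g) : Prop :=
  X.length < Y.length ∨ (X.length = Y.length ∧ List.Lex (letterLt g) X Y)

/-- A word is irreducible if it is the `≺`-least word representing its element. -/
def IrreducibleWord (g : ℕ) (W : Word g) : Prop :=
  ∀ W' : Word g, eval g W' = eval g W → W' = W ∨ wordLt g W W'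

/-- A word is cyclically irreducible if all its cyclic permutations are irreducible. -/
def CyclicallyIrreducibleWord (g : ℕ) (W : Word g) : Prop :=
  ∀ W' : Word g, List.IsRotated W W' → IrreducibleWord g W'

/-- A word is freely reduced if no letter is followed by its inverse. -/
def FreelyReduced (g : ℕ) (W : Word g) : Prop :=
  List.Chain' (fun a c => c ≠ invLetter g a) W

/-- The normal form of a group element: the `≺`-least word representing it. -/
noncomputable def nf (g : ℕ) (x : SurfaceGroup g) : Word g := by
  classical
  exact if h : ∃ W : Word g, eval g W = x ∧ IrreducibleWord g W then h.choose else []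

/-- The word `R = c₁c₂⋯c_{2g}c₁⁻¹c₂⁻¹⋯c_{2g}⁻¹`. -/
def Rword (g : ℕ) : Word g :=
  (List.ofFn fun i : Fin (2*g) => ((i, true) : Letter g)) ++
  (List.ofFn fun i : Fin (2*g) => ((i, false) : Letter g))

/-- `𝓡`: all cyclic permutations of `R` and of `R⁻¹`. -/
def RSet (g : ℕ) : Set (Word g) :=
  {W | List.IsRotated (Rword g) W ∨ List.IsRotated (wordInv g (Rword g)) W}

/-- `seg g b i k` is the word `b_i b_{i+1} ⋯ b_{i+k-1}`. -/
def seg (g : ℕ) (b : ℕ → Letter g) (i k : ℕ) : Word g :=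
  (List.range k).map fun j => b (i + j)

/-- `dseg g b i k` is the descending word `b_i b_{i-1} ⋯ b_{i-k+1}`
(indices taken modulo `4g`, using periodicity of `b`). -/
def dseg (g : ℕ) (b : ℕ → Letter g) (i k : ℕ) : Word g :=
  (List.range k).map fun j => b (i + 4*g - j)

/-- `b : ℕ → Letter g` is a `4g`-periodic (1-based) enumeration of the letters
`b₁, …, b_{4g}` of some word `b₁⋯b_{4g} ∈ 𝓡`. -/
def RelSeq (g : ℕ) (b : ℕ → Letter g) : Prop :=
  (∀ i, b (i + 4*g) = b i) ∧ seg g b 1 (4*g) ∈ RSet g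

/-- The `t`-th power `W^t` of a word. -/
def wpow (g : ℕ) (W : Word g) (t : ℕ) : Word g := (List.replicate t W).flatten

/-- A `k`-fractional relator: an initial segment of length `k` (with `2 ≤ k ≤ 4g`)
of some word in `𝓡`. -/
def IsFR (g : ℕ) (k : ℕ) (W : Word g) : Prop :=
  2 ≤ k ∧ k ≤ 4*g ∧ ∃ B ∈ RSet g, W = B.take k

/-- `IsLLFROcc g k W P F Q` : the factorization `W = P ++ F ++ Q` exhibits `F`
as a `k`-locally longest fractional relator of `W`. -/
def IsLLFROcc (g : ℕ) (k : ℕ) (W P F Q : Word g) : Prop :=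
  W = P ++ F ++ Q ∧ IsFR g k F ∧
  (∀ a, P.getLast? = some a → ¬ IsFR g (k+1) (a :: F)) ∧
  (∀ a, Q.head? = some a → ¬ IsFR g (k+1) (F ++ [a]))

/-- `W` contains a `k`-LLFR. -/
def HasLLFR (g : ℕ) (k : ℕ) (W : Word g) : Prop :=
  ∃ P F Q, IsLLFROcc g k W P F Q

/-- Length-lexicographical order on pairs of words. -/
def pairLt (g : ℕ) (p q : Word g × Word g) : Prop :=
  wordLt g p.1 q.1 ∨ (p.1 = q.1 ∧ wordLt g p.2 q.2)

/-- A candidate for the reducing-subword pair of `(W₁, W₂)`. -/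
def IsRSCand (g : ℕ) (W₁ W₂ C₁ C₂ : Word g) : Prop :=
  ∃ A B C' : Word g, W₁ = A ++ C₁ ∧ W₂ = C₂ ++ B ∧
    nf g (eval g (W₁ ++ W₂)) = A ++ C' ++ B

/-- `(C₁, C₂)` is the reducing-subword pair `rs(W₁, W₂)`: the `≺`-least candidate. -/
def IsRS (g : ℕ) (W₁ W₂ C₁ C₂ : Word g) : Prop :=
  IsRSCand g W₁ W₂ C₁ C₂ ∧
  ∀ D₁ D₂ : Word g, IsRSCand g W₁ W₂ D₁ D₂ →
    (C₁ = D₁ ∧ C₂ = D₂) ∨ pairLt g (C₁, C₂) (D₁, D₂)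

end SG


namespace SGP

/-- Sign predicate on `ZMod (4g)`. -/
def Sg {g : ℕ} (ε : ZMod (4*g)) : Prop := ε = 1 ∨ ε = -1

/-- Rank of a residue. -/
def rk {g : ℕ} (z : ZMod (4*g)) : ℕ := if z.val < 2*g then 2*g-1-z.val else z.val

/-- The run of length `2g` with direction `ε` and last letter `a` is admissible. -/
def good {g : ℕ} (ε a : ZMod (4*g)) : Prop := rk (a - (2*(g : ZMod (4*g))-1)*ε) < rk a

noncomputable def H {g : ℕ} (ε : ZMod (4*g)) : List (ZMod (4*g)) → ℕ
  | [] => 0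
  | [_] => 1
  | b :: a :: S => if b = a + ε then H ε (a :: S) + 1
      else if b = a - (2*g-2)*ε ∧ H ε (a :: S) = 2*g then 2 else 1

noncomputable def K {g : ℕ} (ε : ZMod (4*g)) : List (ZMod (4*g)) → ℕ
  | [] => 0
  | [_] => 1
  | b :: a :: S => if b = a + ε then K ε (a :: S) + 1 else 1

/-- Admissible stacks (reversed words). -/
def N {g : ℕ} : List (ZMod (4*g)) → Prop
  | [] => True
  | b :: S => (∀ a ∈ S.head?, b ≠ a + 2*g) ∧
      (∀ ε, Sg ε → H ε (b :: S) ≤ 2*g ∧ (K ε (b :: S) = 2*g → good ε b)) ∧ N S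

def dn {g : ℕ} (ε : ZMod (4*g)) : ℕ → ZMod (4*g) → List (ZMod (4*g))
  | 0, _ => []
  | k+1, a => (a - ε) :: dn ε k (a - ε)

variable {g : ℕ}

lemma Sg.neg {ε : ZMod (4*g)} (h : Sg ε) : Sg (-ε) := by
  rcases h with h | h <;> simp [Sg, h]

lemma four : (4 * (g : ZMod (4*g))) = 0 := by
  have := ZMod.natCast_self (4*g)
  push_cast at this; exact this

lemma zne {ε : ZMod (4*g)} (hε : Sg ε) (c : ℤ) (h0 : 0 < c) (h1 : c < 4*g) :
    (c : ZMod (4*g)) * ε ≠ 0 := by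
  have h : (c : ZMod (4*g)) ≠ 0 := by
    intro h
    rw [ZMod.intCast_zmod_eq_zero_iff_dvd] at h
    have := Int.le_of_dvd h0 h
    push_cast at this; omega
  rcases hε with rfl | rfl <;> simpa using h

lemma tg {ε : ZMod (4*g)} (hε : Sg ε) : (2 * g : ZMod (4*g)) * ε = 2*g := by
  rcases hε with rfl | rfl
  · ring
  · linear_combination -four (g := g)

lemma H_cons (ε b a : ZMod (4*g)) (S) : H ε (b :: a :: S) = if b = a + ε then H ε (a :: S) + 1
      else if b = a - (2*g-2)*ε ∧ H ε (a :: S) = 2*g then 2 else 1 := by rw [H]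
lemma K_cons (ε b a : ZMod (4*g)) (S) : K ε (b :: a :: S) = if b = a + ε then K ε (a :: S) + 1
      else 1 := by rw [K]
lemma H_one (ε b : ZMod (4*g)) : H ε [b] = 1 := by rw [H]
lemma K_one (ε b : ZMod (4*g)) : K ε [b] = 1 := by rw [K]

lemma H_pos (ε b : ZMod (4*g)) (S) : 1 ≤ H ε (b :: S) := by
  cases S with
  | nil => simp [H_one]
  | cons a S => rw [H_cons]; split_ifs <;> omega
lemma K_pos (ε b : ZMod (4*g)) (S) : 1 ≤ K ε (b :: S) := by
  cases S with
  | nil => simp [K_one]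
  | cons a S => rw [K_cons]; split_ifs <;> omega

lemma K_le_H (ε : ZMod (4*g)) (S) : K ε S ≤ H ε S := by
  induction S with
  | nil => simp [K, H]
  | cons b S ih =>
    cases S with
    | nil => simp [K_one, H_one]
    | cons a S => rw [K_cons, H_cons]; split_ifs <;> omega

lemma H_le_K (ε : ZMod (4*g)) (S) : H ε S ≤ K ε S + 1 := by
  induction S with
  | nil => simp [K, H]
  | cons b S ih =>
    cases S with
    | nil => simp [K_one, H_one]
    | cons a S => rw [K_cons, H_cons]; split_ifs <;> omega

lemma H_step (ε a : ZMod (4*g)) (S) : H ε ((a + ε) :: a :: S) = H ε (a :: S) + 1 := by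
  simp [H_cons]
lemma K_step (ε a : ZMod (4*g)) (S) : K ε ((a + ε) :: a :: S) = K ε (a :: S) + 1 := by
  simp [K_cons]

/-- if `H ≥ 2` in direction `ε` then it is `1` in the other direction -/
lemma H_opp (hg : 2 ≤ g) {ε : ZMod (4*g)} (hε : Sg ε) (S) (h : 2 ≤ H ε S) : H (-ε) S = 1 := by
  match S with
  | [] => simp [H] at h
  | [b] => simp [H_one]
  | b :: a :: S =>
    rw [H_cons] at h
    rw [H_cons]
    have e1 : ¬ (b = a + ε ∧ b = a + -ε) := by
      rintro ⟨h1, h2⟩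
      exact zne hε 2 (by omega) (by omega) (by push_cast; linear_combination h2 - h1)
    have e2 : ¬ (b = a + ε ∧ b = a - (2*g-2)*(-ε)) := by
      rintro ⟨h1, h2⟩
      exact zne hε (2*g-3) (by omega) (by omega) (by push_cast; linear_combination h1 - h2)
    have e3 : ¬ (b = a - (2*g-2)*ε ∧ b = a + -ε) := by
      rintro ⟨h1, h2⟩
      exact zne hε (2*g-3) (by omega) (by omega) (by push_cast; linear_combination h1 - h2)
    have e4 : ¬ (b = a - (2*g-2)*ε ∧ b = a - (2*g-2)*(-ε)) := by
      rintro ⟨h1, h2⟩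
      exact zne hε (4*g-4) (by omega) (by omega) (by push_cast; linear_combination h1 - h2)
    split_ifs at h with c1 c2
    · rw [if_neg (fun h => e1 ⟨c1, h⟩), if_neg (fun h => e2 ⟨c1, h.1⟩)]
    · rw [if_neg (fun h => e3 ⟨c2.1, h⟩), if_neg (fun h => e4 ⟨c2.1, h.1⟩)]
    · omega

lemma K_opp (hg : 2 ≤ g) {ε : ZMod (4*g)} (hε : Sg ε) (b S) (h : 2 ≤ H ε (b :: S)) :
    K (-ε) (b :: S) = 1 := by
  have := H_opp hg hε _ h
  have h2 := K_le_H (-ε) (b :: S)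
  have h3 := K_pos (-ε) b S
  omega

lemma dn_succ (ε : ZMod (4*g)) (k a) : dn ε (k+1) a = (a - ε) :: dn ε k (a - ε) := rfl

lemma dn_len (ε : ZMod (4*g)) (k a) : (dn ε k a).length = k := by
  induction k generalizing a with
  | zero => rfl
  | succ k ih => simp [dn_succ, ih]

lemma dn_add (ε : ZMod (4*g)) (k l a) : dn ε (k+l) a = dn ε k a ++ dn ε l (a - k*ε) := by
  induction k generalizing a with
  | zero => simp [dn]
  | succ k ih =>
    rw [Nat.succ_add_eq_add_succ, Nat.add_succ, dn_succ, dn_succ, ih]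
    simp; congr 1; ring

/-- last letter of a `dn` split off -/
lemma dn_last (ε : ZMod (4*g)) (k a) : dn ε (k+1) a = dn ε k a ++ [a - (k+1)*ε] := by
  rw [dn_add]; simp [dn]; ring

lemma H_dn (ε : ZMod (4*g)) (k a P) :
    H ε (dn ε (k+1) a ++ P) = H ε ((a - (k+1)*ε) :: P) + k := by
  induction k generalizing a with
  | zero => simp [dn]
  | succ k ih =>
    have h := ih (a - ε)
    rw [dn_succ, dn_succ] at *
    have e : a - ε - (k+1)*ε = a - ((k+1:ℕ)+1)*ε := by push_cast; ring
    rw [e] at h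
    have : H ε ((a - ε) :: ((a - ε - ε) :: dn ε k (a-ε-ε)) ++ P)
      = H ε (((a - ε - ε) :: dn ε k (a-ε-ε)) ++ P) + 1 := by
      have := H_step ε (a-ε-ε) (dn ε k (a-ε-ε) ++ P)
      simpa using this
    rw [this, h]; ring

lemma K_dn (ε : ZMod (4*g)) (k a P) :
    K ε (dn ε (k+1) a ++ P) = K ε ((a - (k+1)*ε) :: P) + k := by
  induction k generalizing a with
  | zero => simp [dn]
  | succ k ih =>
    have h := ih (a - ε)
    rw [dn_succ, dn_succ] at *
    have e : a - ε - (k+1)*ε = a - ((k+1:ℕ)+1)*ε := by push_cast; ring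
    rw [e] at h
    have : K ε ((a - ε) :: ((a - ε - ε) :: dn ε k (a-ε-ε)) ++ P)
      = K ε (((a - ε - ε) :: dn ε k (a-ε-ε)) ++ P) + 1 := by
      have := K_step ε (a-ε-ε) (dn ε k (a-ε-ε) ++ P)
      simpa using this
    rw [this, h]; ring

lemma N_tail {b : ZMod (4*g)} {S} (h : N (b :: S)) : N S := h.2.2
lemma N_H {S : List (ZMod (4*g))} (h : N S) {ε} (hε : Sg ε) : H ε S ≤ 2*g := by
  cases S with
  | nil => simp [H]
  | cons b S => exact (h.2.1 ε hε).1
lemma N_K {S : List (ZMod (4*g))} (h : N S) {ε} (hε : Sg ε) : K ε S ≤ 2*g :=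
  (K_le_H ε S).trans (N_H h hε)
lemma N_good {b : ZMod (4*g)} {S : List (ZMod (4*g))} (h : N (b :: S)) {ε} (hε : Sg ε)
    (hk : K ε (b :: S) = 2*g) : good ε b := (h.2.1 ε hε).2 hk
lemma N_red {b a : ZMod (4*g)} {S : List (ZMod (4*g))} (h : N (b :: a :: S)) : b ≠ a + 2*g :=
  h.1 a (by simp)

lemma N_drop {S T : List (ZMod (4*g))} (h : N (S ++ T)) : N T := by
  induction S with
  | nil => exact h
  | cons a S ih => exact ih (N_tail h)

lemma sg_cases {ε η : ZMod (4*g)} (hε : Sg ε) (hη : Sg η) : η = ε ∨ η = -ε := by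
  rcases hε with rfl | rfl <;> rcases hη with rfl | rfl <;> simp

/-- criterion for `N (b::a::S)` with a fixed sign -/
lemma N_mk {ε : ZMod (4*g)} (hε : Sg ε) {b a : ZMod (4*g)} {S}
    (h0 : N (a :: S)) (h1 : b ≠ a + 2*g)
    (h2 : H ε (b :: a :: S) ≤ 2*g) (h3 : K ε (b :: a :: S) = 2*g → good ε b)
    (h4 : H (-ε) (b :: a :: S) ≤ 2*g) (h5 : K (-ε) (b :: a :: S) = 2*g → good (-ε) b) :
    N (b :: a :: S) := by
  refine ⟨by simpa using h1, ?_, h0⟩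
  intro η hη
  rcases sg_cases hε hη with rfl | rfl
  · exact ⟨h2, h3⟩
  · exact ⟨h4, h5⟩

lemma N_single (hg : 2 ≤ g) (a : ZMod (4*g)) : N [a] := by
  refine ⟨by simp, ?_, trivial⟩
  intro ε _
  rw [H_one, K_one]
  exact ⟨by omega, by omega⟩

lemma N_push (hg : 2 ≤ g) {ε : ZMod (4*g)} (hε : Sg ε) {a : ZMod (4*g)} {S} (h0 : N (a :: S))
    (h2 : H ε (a :: S) < 2*g) (h3 : K ε (a :: S) + 1 = 2*g → good ε (a + ε)) :
    N ((a + ε) :: a :: S) := by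
  have h6 : H (-ε) ((a+ε) :: a :: S) = 1 := by
    apply H_opp hg hε
    rw [H_step]; have := H_pos ε a S; omega
  have h7 := K_le_H (-ε) ((a+ε) :: a :: S)
  apply N_mk hε h0
  · intro h
    exact zne hε (2*g-1) (by omega) (by omega) (by push_cast; linear_combination -h + tg hε)
  · rw [H_step]; omega
  · rw [K_step]; exact h3
  · omega
  · omega

lemma N_dn (hg : 2 ≤ g) {ε : ZMod (4*g)} (hε : Sg ε) (k : ℕ) (a : ZMod (4*g)) (P)
    (h0 : N ((a - ((k : ZMod (4*g))+1)*ε) :: P)) (h2 : H ε ((a - (k+1)*ε) :: P) + k ≤ 2*g)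
    (h3 : K ε ((a - (k+1)*ε) :: P) + k < 2*g ∨ good ε (a - ε)) : N (dn ε (k+1) a ++ P) := by
  induction k generalizing a with
  | zero => simpa [dn] using h0
  | succ k ih =>
    have e : a - ((k+1:ℕ)+1)*ε = a - ε - (k+1)*ε := by push_cast; ring
    rw [e] at h0 h2 h3
    have hk := K_le_H ε ((a - ε - (k+1)*ε) :: P)
    have h := ih (a - ε) h0 (by omega) (Or.inl (by omega))
    have hH := H_dn ε k (a - ε) P
    have hK := K_dn ε k (a - ε) P
    rw [dn_succ] at h hH hK ⊢
    rw [dn_succ]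
    have e2 : a - ε = (a - ε - ε) + ε := by ring
    conv => arg 1; simp
    conv => arg 1; arg 1; rw [e2]
    refine N_push hg hε h ?_ ?_
    · simp only [List.cons_append] at hH; omega
    · intro h4
      simp only [List.cons_append] at hK
      rcases h3 with h3 | h3
      · omega
      · rwa [← e2]

end SGP


namespace SGP
variable {g : ℕ}

lemma val_add_nat (hg : 2 ≤ g) (a : ZMod (4*g)) (n : ℕ) (hn : n < 4*g) :
    (a + (n : ZMod (4*g))).val = if a.val + n < 4*g then a.val + n else a.val + n - 4*g := by
  haveI : NeZero (4*g) := ⟨by omega⟩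
  have h := ZMod.val_lt a
  rw [ZMod.val_add, ZMod.val_natCast, Nat.mod_eq_of_lt hn]
  split_ifs with h1
  · exact Nat.mod_eq_of_lt h1
  · rw [Nat.mod_eq_sub_mod (by omega)]; exact Nat.mod_eq_of_lt (by omega)

lemma val_lt' (hg : 2 ≤ g) (a : ZMod (4*g)) : a.val < 4*g := by
  haveI : NeZero (4*g) := ⟨by omega⟩
  exact ZMod.val_lt a

lemma rk_inj (hg : 2 ≤ g) {a b : ZMod (4*g)} (h : rk a = rk b) : a = b := by
  haveI : NeZero (4*g) := ⟨by omega⟩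
  apply ZMod.val_injective
  have := val_lt' hg a
  have := val_lt' hg b
  unfold rk at h
  split_ifs at h <;> omega

lemma good_opp (hg : 2 ≤ g) {ε : ZMod (4*g)} (hε : Sg ε) (a b : ZMod (4*g))
    (hb : b = a - (2*g-1)*ε) : good ε a ↔ ¬ good (-ε) b := by
  unfold good
  have e : b - (2*(g : ZMod (4*g))-1) * (-ε) = a := by rw [hb]; ring
  rw [e, ← hb]
  have hne : rk a ≠ rk b := by
    intro h
    have h := rk_inj hg h
    exact zne hε (2*g-1) (by omega) (by omega) (by push_cast; linear_combination hb + h)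
  omega

lemma good_inv (hg : 2 ≤ g) {ε : ZMod (4*g)} (hε : Sg ε) (a : ZMod (4*g)) :
    good ε a ↔ ¬ good ε (a + 2*(g : ZMod (4*g))) := by
  unfold good
  have hv := val_lt' hg a
  have e1 : (a + 2*(g : ZMod (4*g)) : ZMod (4*g)) = a + ((2*g : ℕ) : ZMod (4*g)) := by push_cast; ring
  have c1 : ((2*g+1 : ℕ) : ZMod (4*g)) = 2*g+1 := by push_cast; ring
  have c2 : ((2*g-1 : ℕ) : ZMod (4*g)) = 2*g-1 := by rw [Nat.cast_sub (by omega)]; push_cast; ring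
  have c3 : ((4*g-1 : ℕ) : ZMod (4*g)) = 4*g-1 := by rw [Nat.cast_sub (by omega)]; push_cast; ring
  rcases hε with rfl | rfl
  · have e2 : a - (2*(g : ZMod (4*g))-1)*1 = a + ((2*g+1 : ℕ) : ZMod (4*g)) := by
      rw [c1]; linear_combination -four (g := g)
    have e3 : a + 2*(g : ZMod (4*g)) - (2*(g : ZMod (4*g))-1)*1 = a + ((1 : ℕ) : ZMod (4*g)) := by
      push_cast; ring
    rw [e3, e2, e1]
    unfold rk
    rw [val_add_nat hg a _ (by omega), val_add_nat hg a _ (by omega), val_add_nat hg a _ (by omega)]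
    split_ifs <;> omega
  · have e2 : a - (2*(g : ZMod (4*g))-1)*(-1) = a + ((2*g-1 : ℕ) : ZMod (4*g)) := by
      rw [c2]; ring
    have e3 : a + 2*(g : ZMod (4*g)) - (2*(g : ZMod (4*g))-1)*(-1) = a + ((4*g-1 : ℕ) : ZMod (4*g)) := by
      rw [c3]; ring
    rw [e3, e2, e1]
    unfold rk
    rw [val_add_nat hg a _ (by omega), val_add_nat hg a _ (by omega), val_add_nat hg a _ (by omega)]
    split_ifs <;> omega

/-- `D ε a`: stack of the word `(a-(2g-1)ε) … (a-ε)`. -/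
def D {g : ℕ} (ε a : ZMod (4*g)) : List (ZMod (4*g)) := dn ε (2*g-1) a

lemma D_len (ε a : ZMod (4*g)) : (D ε a).length = 2*g-1 := dn_len _ _ _

lemma D_cons (hg : 2 ≤ g) (ε a : ZMod (4*g)) : D ε a = (a - ε) :: dn ε (2*g-2) (a-ε) := by
  unfold D
  rw [show 2*g-1 = (2*g-2)+1 by omega, dn_succ]

lemma c22 (hg : 2 ≤ g) : ((2*g-2 : ℕ) : ZMod (4*g)) = 2*g-2 := by
  rw [Nat.cast_sub (by omega)]; push_cast; ring

lemma D_last (hg : 2 ≤ g) (ε a : ZMod (4*g)) :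
    D ε a = dn ε (2*g-2) a ++ [a - (2*g-1)*ε] := by
  unfold D
  rw [show 2*g-1 = (2*g-2)+1 by omega, dn_last, c22 hg]
  congr 3; ring

lemma H_D (hg : 2 ≤ g) (ε a : ZMod (4*g)) (P) :
    H ε (D ε a ++ P) = H ε ((a - (2*(g : ZMod (4*g))-1)*ε) :: P) + (2*g-2) := by
  unfold D
  rw [show 2*g-1 = (2*g-2)+1 by omega, H_dn, c22 hg]
  congr 4; ring

lemma K_D (hg : 2 ≤ g) (ε a : ZMod (4*g)) (P) :
    K ε (D ε a ++ P) = K ε ((a - (2*(g : ZMod (4*g))-1)*ε) :: P) + (2*g-2) := by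
  unfold D
  rw [show 2*g-1 = (2*g-2)+1 by omega, K_dn, c22 hg]
  congr 4; ring

lemma N_bot (hg : 2 ≤ g) {ε a : ZMod (4*g)} {P} (h : N (D ε a ++ P)) :
    N ((a - (2*(g : ZMod (4*g))-1)*ε) :: P) := by
  rw [D_last hg, List.append_assoc] at h
  exact N_drop h

lemma N_D (hg : 2 ≤ g) {ε : ZMod (4*g)} (hε : Sg ε) (a b : ZMod (4*g)) (P)
    (hb : b = a - (2*g-1)*ε)
    (h0 : N (b :: P)) (h2 : H ε (b :: P) ≤ 2)
    (h3 : K ε (b :: P) < 2 ∨ good ε (a - ε)) : N (D ε a ++ P) := by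
  unfold D
  have e : a - (((2*g-2 : ℕ) : ZMod (4*g))+1)*ε = b := by rw [c22 hg, hb]; ring
  rw [show 2*g-1 = (2*g-2)+1 by omega]
  apply N_dn hg hε
  · rwa [e]
  · rw [e]; omega
  · rw [e]; rcases h3 with h3 | h3
    · left; omega
    · right; exact h3

/-- peel a run off a stack -/
lemma peel (ε : ZMod (4*g)) (k : ℕ) (z : ZMod (4*g)) (S) (h : k + 1 ≤ K ε (z :: S)) :
    ∃ P, z :: S = dn ε (k+1) (z + ε) ++ P := by
  induction k generalizing z S with
  | zero => exact ⟨S, by simp [dn]⟩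
  | succ k ih =>
    cases S with
    | nil => rw [K_one] at h; omega
    | cons a S =>
      rw [K_cons] at h
      split_ifs at h with h1
      · obtain ⟨P, hP⟩ := ih a S (by omega)
        refine ⟨P, ?_⟩
        rw [dn_succ, add_sub_cancel_right, List.cons_append, h1, ← hP]
      · omega

lemma peelD (hg : 2 ≤ g) (ε : ZMod (4*g)) (z : ZMod (4*g)) (S) (h : 2*g-1 ≤ K ε (z :: S)) :
    ∃ P, z :: S = D ε (z + ε) ++ P := by
  obtain ⟨P, hP⟩ := peel ε (2*g-2) z S (by omega)
  refine ⟨P, ?_⟩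
  rw [hP]; unfold D
  rw [show 2*g-1 = (2*g-2)+1 by omega]

lemma H2g (hg : 2 ≤ g) {ε : ZMod (4*g)} (hε : Sg ε) {a : ZMod (4*g)} {P}
    (hN : N (D ε a ++ P)) (h : H ε (D ε a ++ P) = 2*g) :
    (∃ P', P = (a + 2*(g : ZMod (4*g))) :: P') ∨ (∃ P', P = (a - ε) :: P' ∧ H ε P = 2*g) := by
  rw [H_D hg] at h
  have hh : H ε ((a - (2*(g : ZMod (4*g))-1)*ε) :: P) = 2 := by omega
  cases P with
  | nil => rw [H_one] at hh; omega
  | cons p P =>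
    rw [H_cons] at hh
    split_ifs at hh with h1 h2
    · left
      refine ⟨P, ?_⟩
      congr 1
      linear_combination -h1 - tg hε - four (g := g)
    · right
      refine ⟨P, ?_, h2.2⟩
      congr 1
      linear_combination -h2.1
    · omega

open Classical in
/-- right multiplication of an admissible stack by a letter -/
noncomputable def op {g : ℕ} (S : List (ZMod (4*g))) (a : ZMod (4*g)) : List (ZMod (4*g)) :=
  if S.head? = some (a + 2*(g : ZMod (4*g))) then S.tail
  else if h1 : 2 ≤ g ∧ D 1 a <+: S then
    (if (op (S.drop (2*g-1)) a).length < (S.drop (2*g-1)).length ∨ ¬ good 1 a then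
      D (-1) (a + 2*(g : ZMod (4*g))) ++ op (S.drop (2*g-1)) a else a :: S)
  else if h2 : 2 ≤ g ∧ D (-1) a <+: S then
    (if (op (S.drop (2*g-1)) a).length < (S.drop (2*g-1)).length ∨ ¬ good (-1) a then
      D 1 (a + 2*(g : ZMod (4*g))) ++ op (S.drop (2*g-1)) a else a :: S)
  else a :: S
termination_by S.length
decreasing_by
  all_goals
    first
    | (obtain ⟨hh, hp⟩ := h1
       have := hp.length_le
       rw [D_len] at this
       simp only [List.length_drop]; omega)
    | (obtain ⟨hh, hp⟩ := h2
       have := hp.length_le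
       rw [D_len] at this
       simp only [List.length_drop]; omega)

lemma two_g_add (a : ZMod (4*g)) : a + 2*(g : ZMod (4*g)) + 2*g = a := by
  linear_combination four (g := g)

lemma op_cancel (a : ZMod (4*g)) (P) : op ((a + 2*(g : ZMod (4*g))) :: P) a = P := by
  rw [op]; simp

lemma op_cancel' {a b : ZMod (4*g)} (h : b = a + 2*(g : ZMod (4*g))) (P) : op (b :: P) a = P := by
  rw [h, op_cancel]

lemma D_head_ne (hg : 2 ≤ g) {ε : ZMod (4*g)} (hε : Sg ε) (a : ZMod (4*g)) (P) :
    (D ε a ++ P).head? ≠ some (a + 2*(g : ZMod (4*g))) := by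
  rw [D_cons hg]
  simp only [List.cons_append, List.head?_cons, ne_eq, Option.some.injEq]
  intro h
  exact zne hε (2*g-1) (by omega) (by omega) (by
    push_cast; linear_combination h + tg hε + four (g := g))

open Classical in
lemma op_D (hg : 2 ≤ g) {ε : ZMod (4*g)} (hε : Sg ε) (a : ZMod (4*g)) (P) :
    op (D ε a ++ P) a = if (op P a).length < P.length ∨ ¬ good ε a then
      D (-ε) (a + 2*(g : ZMod (4*g))) ++ op P a else a :: (D ε a ++ P) := by
  have hd : (D ε a ++ P).drop (2*g-1) = P := by
    rw [List.drop_append_of_le_length (by rw [D_len]), List.drop_of_length_le (by rw [D_len])]; simp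
  rw [op, if_neg (D_head_ne hg hε a P)]
  rcases hε with rfl | rfl
  · rw [dif_pos ⟨hg, List.prefix_append _ _⟩, hd]
  · rw [dif_neg, dif_pos ⟨hg, List.prefix_append _ _⟩, hd, neg_neg]
    rintro ⟨_, h⟩
    rw [D_cons hg, D_cons hg, List.cons_append, List.cons_prefix_cons] at h
    have h := h.1
    exact zne (ε := (1 : ZMod (4*g))) (Or.inl rfl) 2 (by omega) (by omega) (by
      push_cast; linear_combination -h)

lemma op_cases (hg : 2 ≤ g) (S : List (ZMod (4*g))) (a : ZMod (4*g)) :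
    (∃ P, S = (a + 2*(g : ZMod (4*g))) :: P) ∨ (∃ ε P, Sg ε ∧ S = D ε a ++ P) ∨ op S a = a :: S := by
  rw [op]
  split_ifs with h1 h2 h3 h4 h5
  · left
    cases S with
    | nil => simp at h1
    | cons b S => simp at h1; exact ⟨S, by rw [h1]⟩
  · right; left; obtain ⟨_, P, hP⟩ := h2; exact ⟨1, P, Or.inl rfl, hP.symm⟩
  · right; right; rfl
  · right; left; obtain ⟨_, P, hP⟩ := h4; exact ⟨-1, P, Or.inr rfl, hP.symm⟩
  · right; right; rfl
  · right; right; rfl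

lemma chain_cases (hg : 2 ≤ g) {ε : ZMod (4*g)} (hε : Sg ε) {a : ZMod (4*g)} {P}
    (hN : N (D ε a ++ P)) :
    (∃ P', P = (a + 2*(g : ZMod (4*g))) :: P') ∨ (∃ P', P = D ε a ++ P') ∨ op P a = a :: P := by
  rcases op_cases hg P a with h | ⟨η, P', hη, h⟩ | h
  · exact Or.inl h
  · rcases sg_cases hε hη with rfl | rfl
    · exact Or.inr (Or.inl ⟨P', h⟩)
    · exfalso
      have hb := N_bot hg hN
      rw [h, D_cons hg, List.cons_append] at hb
      apply N_red hb
      linear_combination -tg hε - four (g := g)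
  · exact Or.inr (Or.inr h)

lemma H_D_D (hg : 2 ≤ g) {ε : ZMod (4*g)} (hε : Sg ε) (a : ZMod (4*g)) (P) :
    H ε (D ε a ++ (D ε a ++ P)) = 2*g ↔ H ε (D ε a ++ P) = 2*g := by
  rw [H_D hg ε a (D ε a ++ P)]
  have h1 : H ε ((a - (2*(g : ZMod (4*g))-1)*ε) :: (D ε a ++ P)) = if H ε (D ε a ++ P) = 2*g then 2 else 1 := by
    rw [D_cons hg, List.cons_append, H_cons, if_neg]
    · congr 1
      simp only [eq_iff_iff, and_iff_right_iff_imp]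
      intro _; ring
    · intro h
      exact zne hε (2*g-1) (by omega) (by omega) (by push_cast; linear_combination -h)
  rw [h1]
  split_ifs with h <;> simp [h] <;> omega

lemma shorter_iff (hg : 2 ≤ g) {ε : ZMod (4*g)} (hε : Sg ε) (a : ZMod (4*g)) (n : ℕ) : ∀ P,
    P.length ≤ n → N (D ε a ++ P) →
    ((op P a).length < P.length ↔ H ε (D ε a ++ P) = 2*g) := by
  induction n with
  | zero =>
    intro P hl hN
    have : P = [] := List.length_eq_zero_iff.1 (by omega)
    subst this
    simp only [List.length_nil, not_lt_zero, false_iff]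
    rw [H_D hg, H_one]; omega
  | succ n ih =>
    intro P hl hN
    by_cases h1 : ∃ P', P = (a + 2*(g : ZMod (4*g))) :: P'
    · obtain ⟨P', rfl⟩ := h1
      rw [op_cancel]
      simp only [List.length_cons, Nat.lt_succ_self, true_iff]
      have h2 := N_H hN hε
      rw [H_D hg] at h2 ⊢
      have e : a - (2*g-1)*ε = (a + 2*(g : ZMod (4*g))) + ε := by linear_combination -tg hε - four (g := g)
      rw [e, H_step] at h2 ⊢
      have := H_pos ε (a+2*(g : ZMod (4*g))) P'
      omega
    by_cases h2 : ∃ P', P = D ε a ++ P'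
    · obtain ⟨P', rfl⟩ := h2
      rw [H_D_D hg hε]
      have hN' : N (D ε a ++ P') := N_drop hN
      have hl' : P'.length ≤ n := by
        rw [List.length_append, D_len] at hl; omega
      rw [← ih P' hl' hN', op_D hg hε]
      split_ifs with h3
      · rw [List.length_append, List.length_append, D_len, D_len]; omega
      · push Not at h3
        simp; omega
    · rcases chain_cases hg hε hN with h | h | h
      · exact absurd h h1
      · exact absurd h h2
      · rw [h]
        constructor
        · intro h; simp at h
        · intro h4
          rcases H2g hg hε hN h4 with h5 | ⟨P', h5, h6⟩
          · exact absurd h5 h1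
          · exfalso; apply h2
            have h7 := H_le_K ε P
            rw [h5] at h7 h6 ⊢
            obtain ⟨P2, hP2⟩ := peelD hg ε (a-ε) P' (by omega)
            exact ⟨P2, by rw [hP2]; simp⟩

lemma good_of_H (hg : 2 ≤ g) {ε : ZMod (4*g)} (hε : Sg ε) (n : ℕ) : ∀ (z : ZMod (4*g)) S,
    S.length ≤ n → N (z :: S) → H ε (z :: S) = 2*g → good ε z := by
  induction n with
  | zero =>
    intro z S hl hN hH
    have : S = [] := List.length_eq_zero_iff.1 (by omega)
    subst this
    rw [H_one] at hH; omega
  | succ n ih =>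
    intro z S hl hN hH
    have h1 := H_le_K ε (z :: S)
    by_cases h2 : K ε (z :: S) = 2*g
    · exact N_good hN hε h2
    have h2' := K_le_H ε (z :: S)
    obtain ⟨P, hP⟩ := peelD hg ε z S (by omega)
    have hlen := congrArg List.length hP
    rw [List.length_append, D_len, List.length_cons] at hlen
    rw [hP] at hN hH
    rcases H2g hg hε hN hH with ⟨P', h5⟩ | ⟨P', h5, h6⟩
    · exfalso; apply h2
      rw [hP] at h2' ⊢
      rw [h5] at h2' hH ⊢
      have e : z + ε - (2*g-1)*ε = (z + ε + 2*(g : ZMod (4*g))) + ε := by linear_combination -tg hε - four (g := g)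
      rw [K_D hg, e, K_step] at h2' ⊢
      have := K_pos ε (z + ε+2*(g : ZMod (4*g))) P'
      omega
    · have e : z + ε - ε = z := by ring
      rw [e] at h5
      subst h5
      refine ih z P' ?_ (N_drop hN) h6
      simp at hlen; omega

lemma op_append (hg : 2 ≤ g) {a : ZMod (4*g)} {S} (hN : N (a :: S)) : op S a = a :: S := by
  rcases op_cases hg S a with ⟨P, rfl⟩ | ⟨ε, P, hε, rfl⟩ | h
  · exfalso; apply N_red hN; rw [two_g_add]
  · rw [op_D hg hε, if_neg]
    push Not
    have hN' := N_tail hN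
    have e : a = (a - ε) + ε := by ring
    have hH : H ε (a :: (D ε a ++ P)) = H ε (D ε a ++ P) + 1 := by
      rw [D_cons hg, List.cons_append, H_cons, if_pos (by ring)]
    have hK : K ε (a :: (D ε a ++ P)) = K ε (D ε a ++ P) + 1 := by
      rw [D_cons hg, List.cons_append, K_cons, if_pos (by ring)]
    have h1 := N_H hN hε
    constructor
    · by_contra h2
      rw [not_le, shorter_iff hg hε a P.length P le_rfl hN'] at h2
      omega
    · apply N_good hN hε
      have := N_K hN hε
      rw [hK, K_D hg] at *
      have := K_pos ε (a - (2*(g : ZMod (4*g))-1)*ε) P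
      omega
  · exact h

end SGP


namespace SGP
variable {g : ℕ}

/-- contradiction helper : `c * ε = 0` with `0 < c < 4g`. -/
lemma zno {ε : ZMod (4*g)} (hε : Sg ε) (c : ℤ) (h0 : 0 < c) (h1 : c < 4*g)
    (h : (c : ZMod (4*g)) * ε = 0) : False := zne hε c h0 h1 h

lemma H_eq_one (ε b a : ZMod (4*g)) (S) (h1 : b ≠ a + ε)
    (h2 : b = a - (2*(g : ZMod (4*g))-2)*ε → H ε (a :: S) ≠ 2*g) : H ε (b :: a :: S) = 1 := by
  rw [H_cons, if_neg h1, if_neg]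
  rintro ⟨h3, h4⟩; exact h2 h3 h4

lemma K_eq_one (ε b a : ZMod (4*g)) (S) (h1 : b ≠ a + ε) : K ε (b :: a :: S) = 1 := by
  rw [K_cons, if_neg h1]

lemma H_le_two (ε b a : ZMod (4*g)) (S) (h1 : b ≠ a + ε) : H ε (b :: a :: S) ≤ 2 := by
  rw [H_cons, if_neg h1]; split_ifs <;> omega

lemma flip_sub1 (hg : 2 ≤ g) {ε : ZMod (4*g)} (hε : Sg ε) {a : ZMod (4*g)} {P}
    (hN : N (D ε a ++ (a + 2*(g : ZMod (4*g))) :: P)) :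
    N ((a - ε) :: P) ∧ H (-ε) ((a - ε) :: P) ≤ 1 := by
  have hg1 : good ε (a - ε) ∧ H ε ((a + 2*(g : ZMod (4*g))) :: P) = 1 := by
    have h1 := N_H hN hε
    have e : a - (2*(g : ZMod (4*g))-1)*ε = (a + 2*(g : ZMod (4*g))) + ε := by
      linear_combination -tg hε - four (g := g)
    have hH := H_D hg ε a ((a + 2*(g : ZMod (4*g))) :: P)
    have hK := K_D hg ε a ((a + 2*(g : ZMod (4*g))) :: P)
    rw [e, H_step] at hH
    rw [e, K_step] at hK
    have p1 := H_pos ε (a + 2*(g : ZMod (4*g))) P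
    have p2 := K_pos ε (a + 2*(g : ZMod (4*g))) P
    have p3 := K_le_H ε ((a + 2*(g : ZMod (4*g))) :: P)
    refine ⟨?_, by omega⟩
    rw [D_cons hg, List.cons_append] at hN hK
    exact N_good hN hε (by omega)
  obtain ⟨hgd, hH1⟩ := hg1
  have hN1 : N ((a + 2*(g : ZMod (4*g))) :: P) := N_drop hN
  cases P with
  | nil => exact ⟨N_single hg _, by rw [H_one]⟩
  | cons q P =>
    have hNq := N_tail hN1
    have nqa : q ≠ a := by
      rintro rfl; exact N_red hN1 rfl
    have n1 : (a + 2*(g : ZMod (4*g))) ≠ q + ε := by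
      intro h; rw [h, H_step] at hH1; have := H_pos ε q P; omega
    have n2 : (a + 2*(g : ZMod (4*g))) = q - (2*(g : ZMod (4*g))-2)*ε → H ε (q :: P) ≠ 2*g := by
      intro h h'; rw [H_cons, if_neg n1, if_pos ⟨h, h'⟩] at hH1; omega
    have hm : H (-ε) ((a - ε) :: q :: P) = 1 := by
      apply H_eq_one
      · intro h; apply nqa; linear_combination -h
      · intro h h'
        have := N_H hN1 hε.neg
        have e : (a + 2*(g : ZMod (4*g))) = q + -ε := by grind [four (g := g), tg hε]
        rw [e, H_step] at this; omega
    refine ⟨N_mk hε hNq ?_ ?_ (fun _ => hgd) (by omega) ?_, by omega⟩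
    · intro h; apply n1; linear_combination h + four (g := g)
    · by_cases h : a - ε = q + ε
      · have h1 := N_H hNq hε
        rw [h, H_step]
        have := n2 (by grind [four (g := g), tg hε])
        omega
      · have := H_le_two ε _ _ P h; omega
    · have := K_le_H (-ε) ((a - ε) :: q :: P); omega

lemma flip_sub2 (hg : 2 ≤ g) {ε : ZMod (4*g)} (hε : Sg ε) {a : ZMod (4*g)} {P}
    (hN : N (D ε a ++ P)) (hQ : N (a :: P)) :
    N ((a - ε) :: a :: P) ∧ H (-ε) ((a - ε) :: a :: P) ≤ 2 := by
  have hb := N_bot hg hN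
  have h1 : H (-ε) (a :: P) = 1 := by
    cases P with
    | nil => rw [H_one]
    | cons p P =>
      apply H_eq_one
      · intro h; apply N_red hb; grind [four (g := g), tg hε]
      · intro h h'
        have := N_H hb hε.neg
        have e : a - (2*(g : ZMod (4*g))-1)*ε = p + -ε := by linear_combination h
        rw [e, H_step] at this; omega
  have e : a - ε = a + -ε := by ring
  rw [e]
  refine ⟨N_push hg hε.neg hQ (by omega) ?_, by rw [H_step]; omega⟩
  intro h
  have := K_le_H (-ε) (a :: P); omega

lemma flip_sub3 (hg : 2 ≤ g) {ε : ZMod (4*g)} (hε : Sg ε) {a : ZMod (4*g)} {Q}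
    (hQ : N ((a + 2*(g : ZMod (4*g)) + ε) :: Q)) :
    N ((a - ε) :: (a + 2*(g : ZMod (4*g)) + ε) :: Q) ∧
    H (-ε) ((a - ε) :: (a + 2*(g : ZMod (4*g)) + ε) :: Q) ≤ 2 ∧
    K (-ε) ((a - ε) :: (a + 2*(g : ZMod (4*g)) + ε) :: Q) = 1 := by
  have n1 : a - ε ≠ (a + 2*(g : ZMod (4*g)) + ε) + -ε := by
    intro h
    exact zno hε (2*g+1) (by omega) (by omega) (by push_cast; linear_combination -h + tg hε)
  have n2 : a - ε ≠ (a + 2*(g : ZMod (4*g)) + ε) + ε := by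
    intro h
    exact zno hε (2*g+3) (by omega) (by omega) (by push_cast; linear_combination -h + tg hε)
  have n3 : a - ε ≠ (a + 2*(g : ZMod (4*g)) + ε) - (2*(g : ZMod (4*g))-2)*ε := by
    intro h
    exact zno hε 4 (by omega) (by omega) (by push_cast; linear_combination -h + tg hε)
  have h1 := H_le_two (-ε) _ _ Q n1
  have h2 := K_eq_one (-ε) _ _ Q n1
  have h3 := H_eq_one ε _ _ Q n2 (fun h => absurd h n3)
  have h4 := K_eq_one ε _ _ Q n2
  refine ⟨N_mk hε hQ ?_ (by omega) (by omega) (by omega) (by omega), h1, h2⟩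
  intro h
  exact zno hε 2 (by omega) (by omega) (by push_cast; linear_combination -h - four (g := g))

/-- structure of `op` on a nested block, in the flipping case -/
lemma op_D_flip (hg : 2 ≤ g) {ε : ZMod (4*g)} (hε : Sg ε) {a : ZMod (4*g)} {P}
    (h : (op P a).length < P.length ∨ ¬ good ε a) :
    op (D ε a ++ P) a = D (-ε) (a + 2*(g : ZMod (4*g))) ++ op P a := by
  rw [op_D hg hε, if_pos h]

lemma D_neg_cons (hg : 2 ≤ g) (ε a : ZMod (4*g)) : D (-ε) (a + 2*(g : ZMod (4*g))) =
    (a + 2*(g : ZMod (4*g)) + ε) :: dn (-ε) (2*g-2) (a + 2*(g : ZMod (4*g)) + ε) := by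
  rw [D_cons hg, sub_neg_eq_add]

lemma op_D_cond (hg : 2 ≤ g) {ε : ZMod (4*g)} (hε : Sg ε) {a : ZMod (4*g)} {P}
    (h : (op (D ε a ++ P) a).length < (D ε a ++ P).length ∨ ¬ good ε a) :
    (op P a).length < P.length ∨ ¬ good ε a := by
  rcases h with h | h
  · by_contra hc
    rw [op_D hg hε, if_neg hc] at h
    simp at h
  · exact Or.inr h

lemma flip_N (hg : 2 ≤ g) {ε : ZMod (4*g)} (hε : Sg ε) {a : ZMod (4*g)} {P}
    (hN : N (D ε a ++ P)) (hc : (op P a).length < P.length ∨ ¬ good ε a) (hQ : N (op P a)) :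
    N (D (-ε) (a + 2*(g : ZMod (4*g))) ++ op P a) := by
  have e : a - ε = a + 2*(g : ZMod (4*g)) - (2*(g : ZMod (4*g))-1)*(-ε) := by
    linear_combination -tg hε - four (g := g)
  rcases chain_cases hg hε hN with ⟨P', rfl⟩ | ⟨P', rfl⟩ | h
  · rw [op_cancel] at *
    obtain ⟨h1, h2⟩ := flip_sub1 hg hε hN
    have := K_le_H (-ε) ((a - ε) :: P')
    exact N_D hg hε.neg _ _ _ e h1 (by omega) (Or.inl (by omega))
  · rw [op_D_flip hg hε (op_D_cond hg hε hc), D_neg_cons hg, List.cons_append] at hQ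
    obtain ⟨h1, h2, h3⟩ := flip_sub3 hg hε hQ
    rw [op_D_flip hg hε (op_D_cond hg hε hc)]
    refine N_D hg hε.neg _ _ _ e ?_ ?_ (Or.inl ?_)
    · rw [D_neg_cons hg, List.cons_append]; exact h1
    · rw [D_neg_cons hg, List.cons_append]; exact h2
    · rw [D_neg_cons hg, List.cons_append]; omega
  · rw [h] at hQ hc ⊢
    have hc' : ¬ good ε a := by
      rcases hc with hc | hc
      · simp at hc
      · exact hc
    obtain ⟨h1, h2⟩ := flip_sub2 hg hε hN hQ
    refine N_D hg hε.neg _ _ _ e h1 h2 (Or.inr ?_)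
    rw [good_opp hg hε a _ rfl, not_not] at hc'
    convert hc' using 1
    grind [four (g := g), tg hε]

lemma op_N (hg : 2 ≤ g) (n : ℕ) : ∀ (S : List (ZMod (4*g))) (a : ZMod (4*g)), S.length ≤ n → N S →
    N (op S a) ∧ ((op S a).length = S.length + 1 ∨ (op S a).length + 1 = S.length) := by
  induction n with
  | zero =>
    intro S a hl hN
    have : S = [] := List.length_eq_zero_iff.1 (by omega)
    subst this
    have := op_append hg (N_single hg a)
    rw [this]; exact ⟨N_single hg a, by simp⟩
  | succ n ih =>
    intro S a hl hN
    by_cases h1 : ∃ P, S = (a + 2*(g : ZMod (4*g))) :: P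
    · obtain ⟨P, rfl⟩ := h1
      rw [op_cancel]; exact ⟨N_tail hN, by simp⟩
    by_cases h2 : ∃ ε P, Sg ε ∧ S = D ε a ++ P
    · obtain ⟨ε, P, hε, rfl⟩ := h2
      by_cases hc : (op P a).length < P.length ∨ ¬ good ε a
      · rw [op_D_flip hg hε hc]
        rw [List.length_append, D_len] at hl
        have h := ih P a (by omega) (N_drop hN)
        refine ⟨flip_N hg hε hN hc h.1, ?_⟩
        simp only [List.length_append, D_len]
        omega
      · rw [op_D hg hε, if_neg hc]
        refine ⟨?_, by simp⟩
        push Not at hc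
        have h3 : H ε (D ε a ++ P) ≠ 2*g := by
          rw [ne_eq, ← shorter_iff hg hε a P.length P le_rfl hN]; omega
        have h4 := N_H hN hε
        have e : a = (a - ε) + ε := by ring
        rw [D_cons hg, List.cons_append] at *
        have := N_push hg hε hN (by omega) (by intro _; rw [← e]; exact hc.2)
        rwa [← e] at this
    · rcases op_cases hg S a with h | h | h
      · exact absurd h h1
      · exact absurd h h2
      · rw [h]
        refine ⟨?_, by simp⟩
        cases S with
        | nil => exact N_single hg a
        | cons s S =>
          have key : ∀ ε, Sg ε → H ε (a :: s :: S) ≤ 2*g ∧ K ε (a :: s :: S) ≠ 2*g := by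
            intro ε hε
            by_cases h3 : a = s + ε
            · have h4 : K ε (s :: S) < 2*g-1 := by
                by_contra h4
                obtain ⟨P, hP⟩ := peelD hg ε s S (by omega)
                exact h2 ⟨ε, P, hε, by rw [h3]; exact hP⟩
              have h5 := H_le_K ε (s :: S)
              rw [h3, H_step, K_step]; omega
            · have := H_le_two ε _ _ S h3
              have := K_eq_one ε _ _ S h3
              omega
          refine ⟨?_, fun ε hε => ⟨(key ε hε).1, fun h => absurd h (key ε hε).2⟩, hN⟩
          intro b hb hab
          simp only [List.head?_cons, Option.mem_some_iff] at hb
          subst hb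
          apply h1
          exact ⟨S, by rw [hab, two_g_add]⟩

lemma op_N' (hg : 2 ≤ g) {S : List (ZMod (4*g))} (a : ZMod (4*g)) (hN : N S) : N (op S a) :=
  (op_N hg _ S a le_rfl hN).1
lemma op_len (hg : 2 ≤ g) {S : List (ZMod (4*g))} (a : ZMod (4*g)) (hN : N S) :
    (op S a).length = S.length + 1 ∨ (op S a).length + 1 = S.length :=
  (op_N hg _ S a le_rfl hN).2

lemma op_inv (hg : 2 ≤ g) (n : ℕ) : ∀ (S : List (ZMod (4*g))) (a : ZMod (4*g)), S.length ≤ n → N S →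
    op (op S a) (a + 2*(g : ZMod (4*g))) = S := by
  induction n with
  | zero =>
    intro S a hl hN
    have : S = [] := List.length_eq_zero_iff.1 (by omega)
    subst this
    rw [op_append hg (N_single hg a), op_cancel' (two_g_add a).symm]
  | succ n ih =>
    intro S a hl hN
    rcases op_cases hg S a with ⟨P, rfl⟩ | ⟨ε, P, hε, rfl⟩ | h
    · rw [op_cancel, op_append hg hN]
    · by_cases hc : (op P a).length < P.length ∨ ¬ good ε a
      · rw [op_D_flip hg hε hc]
        rw [List.length_append, D_len] at hl
        have h := ih P a (by omega) (N_drop hN)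
        rw [op_D hg hε.neg, if_pos, h, neg_neg, two_g_add]
        rw [h]
        by_cases hs : (op P a).length < P.length
        · right
          rw [shorter_iff hg hε a P.length P le_rfl hN, D_cons hg, List.cons_append] at hs
          rw [D_cons hg, List.cons_append] at hN
          have := good_of_H hg hε _ _ _ le_rfl hN hs
          rwa [good_opp hg hε _ (a + 2*(g : ZMod (4*g))) (by linear_combination tg hε + four (g := g))]
            at this
        · left
          have := op_len hg a (N_drop hN)
          omega
      · rw [op_D hg hε, if_neg hc, op_cancel' (two_g_add a).symm]
    · rw [h, op_cancel' (two_g_add a).symm]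

lemma op_inv' (hg : 2 ≤ g) {S : List (ZMod (4*g))} (a : ZMod (4*g)) (hN : N S) :
    op (op S a) (a + 2*(g : ZMod (4*g))) = S := op_inv hg _ S a le_rfl hN

lemma op_inv'' (hg : 2 ≤ g) {S : List (ZMod (4*g))} {a b : ZMod (4*g)}
    (h : b = a + 2*(g : ZMod (4*g))) (hN : N S) :
    op (op S a) b = S := by rw [h, op_inv' hg a hN]

end SGP


namespace SGP
variable {g : ℕ}

/-- ascending run `a, a+ε, …, a+(k-1)ε`. -/
def up {g : ℕ} (ε : ZMod (4*g)) : ℕ → ZMod (4*g) → List (ZMod (4*g))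
  | 0, _ => []
  | k+1, a => a :: up ε k (a + ε)

lemma up_succ (ε : ZMod (4*g)) (k a) : up ε (k+1) a = a :: up ε k (a + ε) := rfl

lemma up_len (ε : ZMod (4*g)) (k a) : (up ε k a).length = k := by
  induction k generalizing a with
  | zero => rfl
  | succ k ih => simp [up_succ, ih]

lemma up_add (ε : ZMod (4*g)) (k l a) : up ε (k+l) a = up ε k a ++ up ε l (a + k*ε) := by
  induction k generalizing a with
  | zero => simp [up]
  | succ k ih =>
    rw [Nat.succ_add_eq_add_succ, Nat.add_succ, up_succ, up_succ, ih]
    simp; congr 1; ring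

lemma up_last (ε : ZMod (4*g)) (k a) : up ε (k+1) a = up ε k a ++ [a + k*ε] := by
  rw [up_add]; simp [up]

lemma up_succ' (ε : ZMod (4*g)) (m k a) (h : m = k+1) : up ε m a = a :: up ε k (a + ε) := by
  subst h; rfl
lemma up_last' (ε : ZMod (4*g)) (m k a) (h : m = k+1) : up ε m a = up ε k a ++ [a + k*ε] := by
  subst h; rw [up_last]
lemma up_add' (ε : ZMod (4*g)) (m k l a) (h : m = k+l) :
    up ε m a = up ε k a ++ up ε l (a + k*ε) := by
  subst h; rw [up_add]

lemma up_rev (ε : ZMod (4*g)) (k a) : (up ε k a).reverse = dn ε k (a + k*ε) := by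
  induction k generalizing a with
  | zero => simp [up, dn]
  | succ k ih =>
    rw [up_last, List.reverse_append, ih, dn_succ]
    simp only [List.reverse_singleton, List.singleton_append, Nat.cast_add, Nat.cast_one]
    congr 2 <;> ring_nf

/-- apply a word to a stack -/
noncomputable def opf {g : ℕ} (S : List (ZMod (4*g))) (w : List (ZMod (4*g))) : List (ZMod (4*g)) :=
  w.foldl op S

lemma opf_nil (S : List (ZMod (4*g))) : opf S [] = S := rfl
lemma opf_cons (S : List (ZMod (4*g))) (a w) : opf S (a :: w) = opf (op S a) w := rfl
lemma opf_append (S : List (ZMod (4*g))) (v w) : opf S (v ++ w) = opf (opf S v) w := by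
  simp [opf]
lemma opf_snoc (S : List (ZMod (4*g))) (v a) : opf S (v ++ [a]) = op (opf S v) a := by
  simp [opf]
lemma opf_N (hg : 2 ≤ g) {S : List (ZMod (4*g))} (hS : N S) (w) : N (opf S w) := by
  induction w generalizing S with
  | nil => exact hS
  | cons a w ih => exact ih (op_N' hg a hS)

lemma opf_push (hg : 2 ≤ g) (w S : List (ZMod (4*g))) (h : N (w.reverse ++ S)) :
    opf S w = w.reverse ++ S := by
  induction w generalizing S with
  | nil => rfl
  | cons a w ih =>
    rw [List.reverse_cons, List.append_assoc] at h ⊢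
    have h1 := N_drop h
    rw [opf_cons, op_append hg (a := a) (S := S) h1]
    exact ih _ h

lemma c21 (hg : 2 ≤ g) : ((2*g-1 : ℕ) : ZMod (4*g)) = 2*g-1 := by
  rw [Nat.cast_sub (by omega)]; push_cast; ring

lemma upD_rev (hg : 2 ≤ g) (ε e i : ZMod (4*g)) (hi : i = e - (2*(g : ZMod (4*g))-1)*ε) :
    (up ε (2*g-1) i).reverse = D ε e := by
  rw [up_rev, c21 hg, hi]; unfold D; congr 1; ring

lemma up2g (hg : 2 ≤ g) (ε e i : ZMod (4*g)) (hi : i = e - (2*(g : ZMod (4*g))-1)*ε) :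
    up ε (2*g) i = up ε (2*g-1) i ++ [e] := by
  conv_lhs => rw [show 2*g = (2*g-1)+1 by omega]
  rw [up_last, c21 hg, hi]; congr 2; ring

lemma N_DS (hg : 2 ≤ g) {ε : ZMod (4*g)} (hε : Sg ε) {S : List (ZMod (4*g))} {i e : ZMod (4*g)}
    (hi : i = e - (2*(g : ZMod (4*g))-1)*ε) (h1 : N (i :: S))
    (h2 : (op S e).length = S.length + 1) : N (D ε e ++ S) := by
  have key : H ε (i :: S) ≤ 2 ∧ K ε (i :: S) < 2 := by
    cases S with
    | nil => rw [H_one, K_one]; omega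
    | cons s S =>
      have n : i ≠ s + ε := by
        intro h
        rw [op_cancel' (by grind [four (g := g), tg hε])] at h2
        simp at h2; omega
      have := K_eq_one ε _ _ S n
      exact ⟨H_le_two ε _ _ S n, by omega⟩
  exact N_D hg hε e i S hi h1 key.1 (Or.inl key.2)

lemma half (hg : 2 ≤ g) {ε : ZMod (4*g)} (hε : Sg ε) {S : List (ZMod (4*g))} {i e : ZMod (4*g)}
    (hi : i = e - (2*(g : ZMod (4*g))-1)*ε) (hN : N S) (h1 : op S i = i :: S)
    (h2 : (op S e).length = S.length + 1) :
    opf S (up ε (2*g) i) = opf S (up (-ε) (2*g) e) := by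
  have hNi : N (i :: S) := h1 ▸ op_N' hg i hN
  have hND := N_DS hg hε hi hNi h2
  have he : e = i - (2*(g : ZMod (4*g))-1)*(-ε) := by rw [hi]; ring
  rw [up2g hg ε e i hi, opf_snoc, opf_push hg _ _ (by rw [upD_rev hg ε e i hi]; exact hND),
    upD_rev hg ε e i hi]
  by_cases hgd : good ε e
  · have hSe : op S e = e :: S := by
      rcases chain_cases hg hε hND with ⟨P, rfl⟩ | ⟨P, rfl⟩ | h
      · rw [op_cancel] at h2; simp at h2; omega
      · rw [op_D hg hε]
        by_cases hc : (op P e).length < P.length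
        · exfalso
          rw [op_D_flip hg hε (Or.inl hc)] at h2
          simp only [List.length_append, D_len] at h2; omega
        · rw [if_neg]; push Not; exact ⟨by omega, hgd⟩
      · exact h
    have hNe : N (e :: S) := hSe ▸ op_N' hg e hN
    have hND' := N_DS hg hε.neg he hNe (by rw [h1]; simp)
    rw [up2g hg (-ε) i e he, opf_snoc, opf_push hg _ _ (by rw [upD_rev hg (-ε) i e he]; exact hND'),
      upD_rev hg (-ε) i e he]
    have hb : ¬ good (-ε) i := by rwa [good_opp hg hε e i hi] at hgd
    rw [op_D_flip hg hε.neg (Or.inr hb), h1, neg_neg, op_D hg hε, if_neg]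
    · have : e :: D ε e = D ε (i + 2*(g : ZMod (4*g))) ++ [i] := by
        rw [D_last hg ε e, D_cons hg]
        have e1 : i + 2*(g : ZMod (4*g)) - ε = e := by grind [four (g := g), tg hε]
        rw [e1, ← hi]; rfl
      have h3 := congrArg (· ++ S) this
      simpa using h3
    · push Not; exact ⟨by omega, hgd⟩
  · have hND2 := flip_N hg hε hND (Or.inr hgd) (op_N' hg e hN)
    rw [op_D_flip hg hε (Or.inr hgd)]
    have h5 : up (-ε) (2*g) e = e :: up (-ε) (2*g-1) (e - ε) := by
      conv_lhs => rw [show 2*g = (2*g-1)+1 by omega]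
      rw [up_succ, sub_eq_add_neg]
    have h6 : (up (-ε) (2*g-1) (e - ε)).reverse = D (-ε) (e + 2*(g : ZMod (4*g))) :=
      upD_rev hg _ _ _ (by grind [four (g := g), tg hε])
    rw [h5, opf_cons, opf_push hg _ _ (by rw [h6]; exact hND2), h6]

lemma opf_undo (hg : 2 ≤ g) (w : List (ZMod (4*g))) {S : List (ZMod (4*g))} (hS : N S) :
    opf (opf S w) ((w.map (· + 2*(g : ZMod (4*g)))).reverse) = S := by
  induction w generalizing S with
  | nil => rfl
  | cons a w ih =>
    rw [List.map_cons, List.reverse_cons, opf_snoc, opf_cons, ih (op_N' hg a hS), op_inv' hg a hS]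

lemma up_inv (ε : ZMod (4*g)) (k a) :
    ((up ε k a).map (· + 2*(g : ZMod (4*g)))).reverse =
      up (-ε) k (a + (k - 1)*ε + 2*(g : ZMod (4*g))) := by
  induction k generalizing a with
  | zero => rfl
  | succ k ih =>
    rw [up_last, List.map_append, List.reverse_append, ih, up_succ]
    simp only [List.map_cons, List.map_nil, List.reverse_singleton, List.singleton_append]
    congr 2 <;> (push_cast; ring)

lemma op_injective (hg : 2 ≤ g) {S T : List (ZMod (4*g))} (a : ZMod (4*g)) (hS : N S) (hT : N T)
    (h : op S a = op T a) : S = T := by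
  rw [← op_inv' hg a hS, h, op_inv' hg a hT]

lemma loop (hg : 2 ≤ g) (n : ℕ) : ∀ (S : List (ZMod (4*g))) (i : ZMod (4*g)), S.length ≤ n → N S →
    opf S (up 1 (4*g) i) = S := by
  induction n using Nat.strong_induction_on with
  | _ n ih =>
  intro S i hl hN
  have s1 : ∀ j : ZMod (4*g), up 1 (4*g) j = j :: up 1 (4*g-1) (j+1) := by
    intro j; exact up_succ' _ _ _ _ (by omega)
  have c41 : ((4*g-1 : ℕ) : ZMod (4*g)) = -1 := by
    rw [Nat.cast_sub (by omega)]; push_cast; rw [four]; ring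
  have s2 : ∀ j : ZMod (4*g), up 1 (4*g) j = up 1 (4*g-1) j ++ [j - 1] := by
    intro j; rw [up_last' _ _ (4*g-1) _ (by omega), c41]; congr 2; ring
  by_cases h1 : (op S i).length < S.length
  · have h := ih (op S i).length (by omega) (op S i) (i+1) le_rfl (op_N' hg i hN)
    rw [s2, opf_snoc] at h
    rw [s1, opf_cons]
    apply op_injective hg (i+1-1) (opf_N hg (op_N' hg i hN) _) hN
    rw [h]; congr 1; ring
  set e := i + (2*(g : ZMod (4*g)) - 1) with he
  by_cases h2 : (op S e).length < S.length
  · have h := ih (op S e).length (by omega) (op S e) (i-1) le_rfl (op_N' hg e hN)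
    rw [s1, opf_cons] at h
    have e2 : op (op S e) (i - 1) = S := op_inv'' hg (by grind [four (g := g)]) hN
    rw [e2, sub_add_cancel] at h
    rw [s2, opf_snoc, h, e2]
  have l1 := op_len hg i hN
  have l2 := op_len hg e hN
  have l1' : (op S i).length = S.length + 1 := by omega
  have l2' : (op S e).length = S.length + 1 := by omega
  have o1 : Sg (1 : ZMod (4*g)) := Or.inl rfl
  have hi : i = e - (2*(g : ZMod (4*g))-1)*1 := by rw [he]; ring
  have hi' : e = i - (2*(g : ZMod (4*g))-1)*(-1) := by rw [he]; ring
  have key : opf S (up 1 (2*g) i) = opf S (up (-1) (2*g) e) := by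
    rcases op_cases hg S i with ⟨P, rfl⟩ | ⟨ε, P, hε, hS⟩ | h
    · rw [op_cancel] at l1'; simp at l1'; omega
    · rcases op_cases hg S e with ⟨P', rfl⟩ | ⟨η, P', hη, hS'⟩ | h'
      · rw [op_cancel] at l2'; simp at l2'; omega
      · exfalso
        rw [hS, D_cons hg, D_cons hg] at hS'
        simp only [List.cons_append, List.cons.injEq] at hS'
        have hh := hS'.1
        rw [he] at hh
        rcases hε with rfl | rfl <;> rcases hη with rfl | rfl
        · exact zno o1 (2*g-1) (by omega) (by omega) (by push_cast; linear_combination -hh)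
        · exact zno o1 (2*g+1) (by omega) (by omega) (by push_cast; linear_combination -hh)
        · exact zno o1 (2*g-3) (by omega) (by omega) (by push_cast; linear_combination -hh)
        · exact zno o1 (2*g-1) (by omega) (by omega) (by push_cast; linear_combination -hh)
      · have := half hg o1.neg hi' hN h' l1'
        rw [neg_neg] at this
        exact this.symm
    · exact half hg o1 hi hN h l2'
  have hu : up 1 (4*g) i = up 1 (2*g) i ++
      ((up (-1) (2*g) e).map (· + 2*(g : ZMod (4*g)))).reverse := by
    rw [up_add' _ _ (2*g) (2*g) _ (by omega), up_inv, neg_neg]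
    congr 2
    push_cast; rw [he]; grind [four (g := g)]
  rw [hu, opf_append, key, opf_undo hg _ hN]

end SGP


namespace SGP
variable {g : ℕ}

/-- residue of a letter -/
def phi {g : ℕ} (l : SG.Letter g) : ZMod (4*g) :=
  ((l.1 : ℕ) : ZMod (4*g)) + if l.2 then 0 else 2*(g : ZMod (4*g))

lemma phi_inv (l : SG.Letter g) : phi (SG.invLetter g l) = phi l + 2*(g : ZMod (4*g)) := by
  obtain ⟨i, b⟩ := l
  cases b
  · simp only [phi, SG.invLetter]; simp; linear_combination -four (g := g)
  · simp [phi, SG.invLetter]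

lemma phi_val (hg : 2 ≤ g) (l : SG.Letter g) :
    (phi l).val = if l.2 then (l.1 : ℕ) else 2*g + (l.1 : ℕ) := by
  obtain ⟨i, b⟩ := l
  have hi := i.2
  cases b
  · have : phi ((i, false) : SG.Letter g) = ((2*g + (i : ℕ) : ℕ) : ZMod (4*g)) := by
      simp [phi]; ring
    rw [this, ZMod.val_natCast_of_lt (by omega)]; simp
  · have : phi ((i, true) : SG.Letter g) = (((i : ℕ) : ℕ) : ZMod (4*g)) := by
      simp [phi]
    rw [this, ZMod.val_natCast_of_lt (by omega)]; simp

lemma rank_phi (hg : 2 ≤ g) (l : SG.Letter g) : SG.rank g l = rk (phi l) := by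
  have := phi_val hg l
  have hi := l.1.2
  unfold SG.rank rk
  rw [this]
  split_ifs <;> omega

lemma phi_inj (hg : 2 ≤ g) : Function.Injective (phi (g := g)) := by
  rintro ⟨i, b⟩ ⟨j, c⟩ h
  have h1 := phi_val hg (i, b)
  have h2 := phi_val hg (j, c)
  rw [h, h2] at h1
  have hi := i.2
  have hj := j.2
  cases b <;> cases c <;> simp at h1 <;> first | (exfalso; omega) | skip
  · simp; omega
  · simp; omega

lemma phi_surj (hg : 2 ≤ g) : Function.Surjective (phi (g := g)) := by
  intro z
  haveI : NeZero (4*g) := ⟨by omega⟩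
  have hz := val_lt' hg z
  by_cases h : z.val < 2*g
  · refine ⟨(⟨z.val, h⟩, true), ?_⟩
    simp [phi]
  · refine ⟨(⟨z.val - 2*g, by omega⟩, false), ?_⟩
    simp only [phi]
    rw [Nat.cast_sub (by omega)]
    simp

noncomputable def psi (hg : 2 ≤ g) (z : ZMod (4*g)) : SG.Letter g := (phi_surj hg z).choose

lemma phi_psi (hg : 2 ≤ g) (z : ZMod (4*g)) : phi (psi hg z) = z := (phi_surj hg z).choose_spec
lemma psi_phi (hg : 2 ≤ g) (l : SG.Letter g) : psi hg (phi l) = l := phi_inj hg (phi_psi hg _)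

noncomputable def gl (hg : 2 ≤ g) (z : ZMod (4*g)) : SG.SurfaceGroup g := SG.evalLetter g (psi hg z)

lemma evalLetter_inv (l : SG.Letter g) : SG.evalLetter g (SG.invLetter g l) = (SG.evalLetter g l)⁻¹ := by
  obtain ⟨i, b⟩ := l
  cases b <;> simp [SG.evalLetter, SG.invLetter]

lemma gl_inv (hg : 2 ≤ g) (z : ZMod (4*g)) : gl hg (z + 2*(g : ZMod (4*g))) = (gl hg z)⁻¹ := by
  unfold gl
  rw [← evalLetter_inv]
  congr 1
  apply phi_inj hg
  rw [phi_psi, phi_inv, phi_psi]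

noncomputable def ev (hg : 2 ≤ g) (w : List (ZMod (4*g))) : SG.SurfaceGroup g := (w.map (gl hg)).prod

lemma ev_append (hg : 2 ≤ g) (v w : List (ZMod (4*g))) : ev hg (v ++ w) = ev hg v * ev hg w := by
  simp [ev]
lemma ev_cons (hg : 2 ≤ g) (a) (w : List (ZMod (4*g))) : ev hg (a :: w) = gl hg a * ev hg w := by
  simp [ev]
lemma ev_nil (hg : 2 ≤ g) : ev hg ([] : List (ZMod (4*g))) = 1 := by simp [ev]

lemma eval_ev (hg : 2 ≤ g) (W : SG.Word g) : SG.eval g W = ev hg (W.map phi) := by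
  unfold SG.eval ev
  rw [List.map_map]
  congr 1
  apply List.map_congr_left
  intro l _
  simp [gl, psi_phi]

lemma ev_inv (hg : 2 ≤ g) (w : List (ZMod (4*g))) :
    ev hg ((w.map (· + 2*(g : ZMod (4*g)))).reverse) = (ev hg w)⁻¹ := by
  induction w with
  | nil => simp [ev]
  | cons a w ih =>
    rw [List.map_cons, List.reverse_cons, ev_append, ih, ev_cons, ev_cons, ev_nil, gl_inv]
    simp

lemma ofFn_up (k : ℕ) (ε a : ZMod (4*g)) :
    List.ofFn (fun i : Fin k => a + ((i : ℕ) : ZMod (4*g)) * ε) = up ε k a := by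
  induction k generalizing a with
  | zero => rfl
  | succ k ih =>
    rw [List.ofFn_succ, up_succ, ← ih]
    simp
    funext i; ring

lemma Rword_phi : (SG.Rword g).map phi = up 1 (4*g) 0 := by
  rw [up_add' _ _ (2*g) (2*g) _ (by omega)]
  unfold SG.Rword
  rw [List.map_append, List.map_ofFn, List.map_ofFn, ← ofFn_up, ← ofFn_up]
  congr 2
  · funext i; simp [phi]
  · funext i; simp [phi]; ring

lemma eval_Rword : SG.eval g (SG.Rword g) = 1 := by
  have h : (PresentedGroup.mk ({SG.relator g} : Set (FreeGroup (Fin (2*g))))) (SG.relator g) = 1 :=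
    PresentedGroup.one_of_mem (by simp)
  have h2 : SG.eval g (SG.Rword g) = (List.map (SG.evalLetter g)
      (List.ofFn fun i : Fin (2*g) => ((i, true) : SG.Letter g))).prod *
      (List.map (SG.evalLetter g)
      (List.ofFn fun i : Fin (2*g) => ((i, false) : SG.Letter g))).prod := by
    simp [SG.eval, SG.Rword]
  rw [← h, h2]
  unfold SG.relator
  rw [map_mul, map_list_prod, map_list_prod, List.map_ofFn,
    List.map_ofFn, List.map_ofFn, List.map_ofFn]
  congr 2

lemma ev_loop (hg : 2 ≤ g) (i : ZMod (4*g)) : ev hg (up 1 (4*g) i) = 1 := by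
  have key : ∀ n : ℕ, ev hg (up 1 (4*g) (n : ZMod (4*g))) = 1 := by
    intro n
    induction n with
    | zero => rw [Nat.cast_zero, ← Rword_phi, ← eval_ev, eval_Rword]
    | succ n ih =>
      have c41 : ((4*g-1 : ℕ) : ZMod (4*g)) = -1 := by
        rw [Nat.cast_sub (by omega)]; push_cast; rw [four]; ring
      rw [up_succ' _ _ (4*g-1) _ (by omega), ev_cons] at ih
      rw [up_last' _ _ (4*g-1) _ (by omega), ev_append, c41, ev_cons, ev_nil, mul_one]
      push_cast
      rw [show (n : ZMod (4*g)) + 1 + -1 * 1 = n by ring]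
      exact mul_eq_one_comm.1 ih
  haveI : NeZero (4*g) := ⟨by omega⟩
  have := key i.val
  rwa [ZMod.natCast_zmod_val] at this

lemma ev_swap (hg : 2 ≤ g) {ε : ZMod (4*g)} (hε : Sg ε) (i e : ZMod (4*g))
    (hi : i = e - (2*(g : ZMod (4*g))-1)*ε) : ev hg (up ε (2*g) i) = ev hg (up (-ε) (2*g) e) := by
  have key : ∀ i e : ZMod (4*g), i = e - (2*(g : ZMod (4*g))-1)*1 →
      ev hg (up 1 (2*g) i) = ev hg (up (-1) (2*g) e) := by
    intro i e h
    have hu : up 1 (4*g) i = up 1 (2*g) i ++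
        ((up (-1) (2*g) e).map (· + 2*(g : ZMod (4*g)))).reverse := by
      rw [up_add' _ _ (2*g) (2*g) _ (by omega), up_inv, neg_neg]
      congr 2
      push_cast; rw [h]; grind [four (g := g)]
    have h1 := ev_loop hg i
    rw [hu, ev_append, ev_inv] at h1
    exact mul_inv_eq_one.1 h1
  rcases hε with rfl | rfl
  · exact key i e hi
  · rw [neg_neg]
    exact (key e i (by rw [hi]; ring)).symm

lemma ev_op (hg : 2 ≤ g) (n : ℕ) : ∀ (S : List (ZMod (4*g))) (a : ZMod (4*g)), S.length ≤ n →
    ev hg (op S a).reverse = ev hg S.reverse * gl hg a := by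
  induction n with
  | zero =>
    intro S a hl
    have : S = [] := List.length_eq_zero_iff.1 (by omega)
    subst this
    rw [op_append hg (N_single hg a)]; simp [ev]
  | succ n ih =>
    intro S a hl
    rcases op_cases hg S a with ⟨P, rfl⟩ | ⟨ε, P, hε, rfl⟩ | h
    · rw [op_cancel, List.reverse_cons, ev_append, ev_cons, ev_nil, gl_inv]; simp
    · by_cases hc : (op P a).length < P.length ∨ ¬ good ε a
      · rw [op_D_flip hg hε hc]
        rw [List.length_append, D_len] at hl
        rw [List.reverse_append, List.reverse_append, ev_append, ev_append, ih P a (by omega)]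
        have r1 : (D ε a).reverse = up ε (2*g-1) (a - (2*(g : ZMod (4*g))-1)*ε) := by
          rw [← upD_rev hg ε a _ rfl, List.reverse_reverse]
        have r2 : (D (-ε) (a + 2*(g : ZMod (4*g)))).reverse = up (-ε) (2*g-1) (a + -ε) := by
          rw [← upD_rev hg (-ε) _ (a + -ε) (by grind [four (g := g), tg hε]), List.reverse_reverse]
        have h := ev_swap hg hε (a - (2*(g : ZMod (4*g))-1)*ε) a rfl
        rw [up2g hg ε a _ rfl, ev_append, up_succ' (-ε) (2*g) (2*g-1) a (by omega), ev_cons, ev_cons,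
          ev_nil, mul_one] at h
        rw [r1, r2, mul_assoc, mul_assoc, h]
      · rw [op_D hg hε, if_neg hc, List.reverse_cons, ev_append, ev_cons, ev_nil, mul_one]
    · rw [h, List.reverse_cons, ev_append, ev_cons, ev_nil, mul_one]

lemma ev_op' (hg : 2 ≤ g) (S : List (ZMod (4*g))) (a : ZMod (4*g)) :
    ev hg (op S a).reverse = ev hg S.reverse * gl hg a := ev_op hg _ S a le_rfl

lemma ev_opf (hg : 2 ≤ g) (S w : List (ZMod (4*g))) :
    ev hg (opf S w).reverse = ev hg S.reverse * ev hg w := by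
  induction w generalizing S with
  | nil => simp [opf, ev]
  | cons a w ih => rw [opf_cons, ih, ev_op', ev_cons, mul_assoc]

/-- permutation of admissible stacks by right multiplication -/
noncomputable def pm (hg : 2 ≤ g) (a : ZMod (4*g)) : Equiv.Perm {S : List (ZMod (4*g)) // N S} where
  toFun S := ⟨op S.1 a, op_N' hg a S.2⟩
  invFun S := ⟨op S.1 (a + 2*(g : ZMod (4*g))), op_N' hg _ S.2⟩
  left_inv S := by apply Subtype.ext; exact op_inv' hg a S.2
  right_inv S := by apply Subtype.ext; exact op_inv'' hg (two_g_add a).symm S.2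

lemma pm_inv (hg : 2 ≤ g) (a : ZMod (4*g)) : (pm hg a)⁻¹ = pm hg (a + 2*(g : ZMod (4*g))) := by
  ext S; rfl

lemma pm_list (hg : 2 ≤ g) (w : List (ZMod (4*g))) (S : {S : List (ZMod (4*g)) // N S}) :
    ((MulOpposite.unop (w.map (fun a => MulOpposite.op (pm hg a))).prod) S).1 = opf S.1 w := by
  induction w generalizing S with
  | nil => simp [opf]
  | cons a w ih =>
    rw [List.map_cons, List.prod_cons, MulOpposite.unop_mul, Equiv.Perm.mul_apply, ih]
    rfl

lemma lift_rel (hg : 2 ≤ g) : ∀ r ∈ ({SG.relator g} : Set (FreeGroup (Fin (2*g)))),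
    FreeGroup.lift (fun i : Fin (2*g) => MulOpposite.op (pm hg ((i : ℕ) : ZMod (4*g)))) r = 1 := by
  intro r hr
  rw [Set.mem_singleton_iff] at hr
  subst hr
  have h : FreeGroup.lift (fun i : Fin (2*g) => MulOpposite.op (pm hg ((i : ℕ) : ZMod (4*g))))
      (SG.relator g) = ((up 1 (4*g) 0).map (fun a => MulOpposite.op (pm hg a))).prod := by
    unfold SG.relator
    rw [up_add' _ _ (2*g) (2*g) _ (by omega), List.map_append, List.prod_append, map_mul,
      map_list_prod, map_list_prod, List.map_ofFn, List.map_ofFn, ← ofFn_up, ← ofFn_up,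
      List.map_ofFn, List.map_ofFn]
    congr 3
    · funext i; simp
    · funext i
      simp only [Function.comp, map_inv, FreeGroup.lift_apply_of]
      rw [← MulOpposite.op_inv, pm_inv]
      congr 2; push_cast; ring
  rw [h]
  apply MulOpposite.unop_injective
  ext S : 2
  rw [pm_list, loop hg _ _ _ le_rfl S.2]
  rfl

noncomputable def Phi (hg : 2 ≤ g) : SG.SurfaceGroup g →* (Equiv.Perm {S : List (ZMod (4*g)) // N S})ᵐᵒᵖ :=
  PresentedGroup.toGroup (lift_rel hg)

lemma Phi_letter (hg : 2 ≤ g) (l : SG.Letter g) :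
    Phi hg (SG.evalLetter g l) = MulOpposite.op (pm hg (phi l)) := by
  obtain ⟨i, b⟩ := l
  have h1 : Phi hg (SG.gen g i) = MulOpposite.op (pm hg ((i : ℕ) : ZMod (4*g))) :=
    PresentedGroup.toGroup.of (lift_rel hg)
  cases b
  · simp only [SG.evalLetter, phi, Bool.false_eq_true, if_false, map_inv, h1]
    rw [← MulOpposite.op_inv, pm_inv]
  · simp only [SG.evalLetter, phi, if_true, h1, add_zero]

lemma Phi_ev (hg : 2 ≤ g) (w : List (ZMod (4*g))) (S : {S : List (ZMod (4*g)) // N S}) :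
    ((MulOpposite.unop (Phi hg (ev hg w))) S).1 = opf S.1 w := by
  rw [← pm_list hg]
  congr 3
  unfold ev
  rw [map_list_prod, List.map_map]
  congr 1
  apply List.map_congr_left
  intro a _
  simp [gl, Phi_letter, phi_psi]

/-- admissible stacks with the same value coincide -/
lemma N_unique (hg : 2 ≤ g) {S T : List (ZMod (4*g))} (hS : N S) (hT : N T)
    (h : ev hg S.reverse = ev hg T.reverse) : S = T := by
  have h1 := Phi_ev hg S.reverse ⟨[], trivial⟩
  have h2 := Phi_ev hg T.reverse ⟨[], trivial⟩
  rw [h] at h1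
  have h3 : opf [] S.reverse = S := by
    rw [opf_push hg S.reverse [] (by simpa using hS)]; simp
  have h4 : opf [] T.reverse = T := by
    rw [opf_push hg T.reverse [] (by simpa using hT)]; simp
  simp only at h1 h2
  rw [← h3, ← h4, ← h1, ← h2]

end SGP


namespace SGP
variable {g : ℕ}

def rlt {g : ℕ} (a b : ZMod (4*g)) : Prop := rk a < rk b

def wlt {g : ℕ} (u v : List (ZMod (4*g))) : Prop :=
  u.length < v.length ∨ (u.length = v.length ∧ List.Lex rlt u v)

lemma lex_phi (hg : 2 ≤ g) (X Y : SG.Word g) :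
    List.Lex (SG.letterLt g) X Y ↔ List.Lex rlt (X.map phi) (Y.map phi) := by
  induction X generalizing Y with
  | nil => cases Y <;> simp
  | cons x X ih =>
    cases Y with
    | nil => simp
    | cons y Y =>
      rw [List.map_cons, List.map_cons, List.cons_lex_cons_iff, List.cons_lex_cons_iff, ih,
        (phi_inj hg).eq_iff]
      simp only [SG.letterLt, rlt, rank_phi hg]

lemma wlt_phi (hg : 2 ≤ g) (X Y : SG.Word g) :
    SG.wordLt g X Y ↔ wlt (X.map phi) (Y.map phi) := by
  simp only [SG.wordLt, wlt, List.length_map, lex_phi hg]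

lemma wlt_trans {u v w : List (ZMod (4*g))} (h1 : wlt u v) (h2 : wlt v w) : wlt u w := by
  rcases h1 with h1 | ⟨h1, h1'⟩ <;> rcases h2 with h2 | ⟨h2, h2'⟩
  · left; omega
  · left; omega
  · left; omega
  · right
    refine ⟨by omega, List.lex_trans ?_ h1' h2'⟩
    intro x y z hx hy
    exact lt_trans (show rk x < rk y from hx) hy

lemma wlt_asymm {u v : List (ZMod (4*g))} (h1 : wlt u v) (h2 : wlt v u) : False := by
  rcases h1 with h1 | ⟨h1, h1'⟩ <;> rcases h2 with h2 | ⟨h2, h2'⟩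
  · omega
  · omega
  · omega
  · refine List.lex_asymm ?_ h1' h2'
    intro x y h h'
    exact absurd (show rk x < rk y from h) (not_lt.2 (le_of_lt (show rk y < rk x from h')))

lemma lex_app {u v : List (ZMod (4*g))} (hl : u.length = v.length) (h : List.Lex rlt u v) (s t) :
    List.Lex rlt (u ++ s) (v ++ t) := by
  induction u generalizing v with
  | nil =>
    cases v with
    | nil => simp at h
    | cons b v => simp at hl
  | cons a u ih =>
    cases v with
    | nil => simp at hl
    | cons b v =>
      rw [List.cons_lex_cons_iff] at h
      rw [List.cons_append, List.cons_append, List.cons_lex_cons_iff]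
      rcases h with h | ⟨h, h'⟩
      · exact Or.inl h
      · exact Or.inr ⟨h, ih (by simpa using hl) h'⟩

lemma wlt_app {u v : List (ZMod (4*g))} (h : wlt u v) (s) : wlt (u ++ s) (v ++ s) := by
  rcases h with h | ⟨h, h'⟩
  · left; simp; exact h
  · right; exact ⟨by simp [h], lex_app h h' s s⟩

lemma D_rev_cons (hg : 2 ≤ g) (ε a : ZMod (4*g)) :
    ∃ t, (D ε a).reverse = (a - (2*(g : ZMod (4*g))-1)*ε) :: t := by
  rw [D_last hg]; simp

lemma rk_of_not_good (hg : 2 ≤ g) {ε : ZMod (4*g)} (hε : Sg ε) {a : ZMod (4*g)} (h : ¬ good ε a) :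
    rlt a (a - (2*(g : ZMod (4*g))-1)*ε) := by
  rw [good_opp hg hε a _ rfl, not_not] at h
  unfold good at h
  unfold rlt
  convert h using 2; ring

/-- in the longer case: append or flip at a bad block -/
lemma op_longer (hg : 2 ≤ g) {P : List (ZMod (4*g))} {e : ZMod (4*g)}
    (hN : N P) (hl : (op P e).length = P.length + 1) :
    op P e = e :: P ∨ ∃ ε P2, Sg ε ∧ P = D ε e ++ P2 ∧ ¬ good ε e ∧
      (op P2 e).length = P2.length + 1 ∧ op P e = D (-ε) (e + 2*(g : ZMod (4*g))) ++ op P2 e := by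
  rcases op_cases hg P e with ⟨P', rfl⟩ | ⟨ε, P2, hε, rfl⟩ | h
  · rw [op_cancel] at hl; simp at hl; omega
  · by_cases hc : (op P2 e).length < P2.length ∨ ¬ good ε e
    · have h1 := op_D_flip hg hε hc
      rw [h1] at hl
      simp only [List.length_append, D_len] at hl
      right
      refine ⟨ε, P2, hε, rfl, ?_, by omega, h1⟩
      rcases hc with hc | hc
      · omega
      · exact hc
    · left; rw [op_D hg hε, if_neg hc]
  · exact Or.inl h

lemma lex_op (hg : 2 ≤ g) (n : ℕ) : ∀ (P : List (ZMod (4*g))) (e d : ZMod (4*g)), P.length ≤ n →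
    N P → (op P e).length = P.length + 1 → rlt e d →
    List.Lex rlt (op P e).reverse (P.reverse ++ [d]) := by
  have base : ∀ (P : List (ZMod (4*g))) (e d : ZMod (4*g)), rlt e d →
    List.Lex rlt (e :: P).reverse (P.reverse ++ [d]) := by
    intro P e d h
    rw [List.reverse_cons]
    apply List.Lex.append_left
    exact List.Lex.rel h
  induction n with
  | zero =>
    intro P e d hl hN h1 h2
    have : P = [] := List.length_eq_zero_iff.1 (by omega)
    subst this
    rw [op_append hg (N_single hg e)]; exact base _ _ _ h2
  | succ n ih =>
    intro P e d hl hN h1 h2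
    rcases op_longer hg hN h1 with h | ⟨ε, P2, hε, rfl, hgd, hl2, h⟩
    · rw [h]; exact base _ _ _ h2
    · rw [h, List.reverse_append, List.reverse_append]
      obtain ⟨t, ht⟩ := D_rev_cons hg ε e
      rw [ht, List.append_assoc]
      have := ih P2 e _ (by rw [List.length_append, D_len] at hl; omega) (N_drop hN) hl2
        (rk_of_not_good hg hε hgd)
      have h3 := lex_app (by simp [hl2]) this (D (-ε) (e + 2*(g : ZMod (4*g)))).reverse (t ++ [d])
      simpa using h3

lemma wle_op (hg : 2 ≤ g) {T : List (ZMod (4*g))} (hT : N T) (b : ZMod (4*g)) :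
    (op T b).reverse = T.reverse ++ [b] ∨ wlt (op T b).reverse (T.reverse ++ [b]) := by
  rcases op_len hg b hT with h | h
  · rcases op_longer hg hT h with h1 | ⟨ε, P2, hε, rfl, hgd, hl2, h1⟩
    · left; rw [h1]; simp
    · right; right
      refine ⟨by simp [h]; omega, ?_⟩
      rw [h1, List.reverse_append, List.reverse_append]
      obtain ⟨t, ht⟩ := D_rev_cons hg ε b
      rw [ht, List.append_assoc]
      have := lex_op hg _ P2 b _ le_rfl (N_drop hT) hl2 (rk_of_not_good hg hε hgd)
      have h3 := lex_app (by simp [hl2]) this (D (-ε) (b + 2*(g : ZMod (4*g)))).reverse (t ++ [b])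
      simpa using h3
  · right; left; simp; omega

lemma wle_opf (hg : 2 ≤ g) (w : List (ZMod (4*g))) :
    (opf [] w).reverse = w ∨ wlt (opf [] w).reverse w := by
  induction w using List.reverseRecOn with
  | nil => left; rfl
  | append_singleton w b ih =>
    rw [opf_snoc]
    have h := wle_op hg (opf_N hg (S := []) trivial w) b
    rcases ih with ih | ih
    · rw [ih] at h; exact h
    · have h2 := wlt_app ih [b]
      rcases h with h | h
      · rw [h]; exact Or.inr h2
      · exact Or.inr (wlt_trans h h2)

/-- stack of a word -/
def st {g : ℕ} (W : SG.Word g) : List (ZMod (4*g)) := (W.map phi).reverse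

lemma st_len (W : SG.Word g) : (st W).length = W.length := by simp [st]
lemma st_append (W V : SG.Word g) : st (W ++ V) = st V ++ st W := by simp [st]
lemma st_inj (hg : 2 ≤ g) {W V : SG.Word g} (h : st W = st V) : W = V := by
  unfold st at h
  exact List.map_injective_iff.2 (phi_inj hg) (List.reverse_injective h)
lemma eval_st (hg : 2 ≤ g) (W : SG.Word g) : SG.eval g W = ev hg (st W).reverse := by
  rw [eval_ev hg, st, List.reverse_reverse]
lemma st_surj (hg : 2 ≤ g) (S : List (ZMod (4*g))) : ∃ W, st W = S := by
  refine ⟨S.reverse.map (psi hg), ?_⟩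
  unfold st
  rw [List.map_map]
  have : phi ∘ psi hg = id := by funext z; exact phi_psi hg z
  rw [this]; simp

lemma opf_st (hg : 2 ≤ g) {W : SG.Word g} (h : N (st W)) (V : SG.Word g) {T : SG.Word g}
    (hT : N (st T)) (hE : SG.eval g (W ++ V) = SG.eval g T) : opf (st W) (V.map phi) = st T := by
  apply N_unique hg (opf_N hg h _) hT
  rw [ev_opf, ← eval_st, ← eval_st, ← hE, ← eval_ev]
  simp [SG.eval]

lemma irr_iff (hg : 2 ≤ g) (W : SG.Word g) : SG.IrreducibleWord g W ↔ N (st W) := by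
  constructor
  · intro h
    obtain ⟨T, hT⟩ := st_surj hg (opf [] (W.map phi))
    have hN : N (st T) := by rw [hT]; exact opf_N hg (S := []) trivial _
    have hev : SG.eval g T = SG.eval g W := by
      rw [eval_st hg T, hT, ev_opf, eval_ev hg]; simp [ev]
    have hTw : (opf [] (W.map phi)).reverse = T.map phi := by rw [← hT]; simp [st]
    have h1 := wle_opf hg (W.map phi)
    rw [hTw, ← wlt_phi hg] at h1
    rcases h T hev with h2 | h2
    · rwa [h2] at hN
    · rcases h1 with h1 | h1
      · have := List.map_injective_iff.2 (phi_inj hg) h1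
        rwa [this] at hN
      · exfalso
        rw [wlt_phi hg] at h1 h2
        exact wlt_asymm h1 h2
  · intro h W' hW'
    have h1 := wle_opf hg (W'.map phi)
    have h2 : opf [] (W'.map phi) = st W := by
      have := opf_st hg (W := []) (g := g) trivial W' h hW'
      exact this
    have h3 : (st W).reverse = W.map phi := by simp [st]
    rw [h2, h3] at h1
    rcases h1 with h1 | h1
    · left; exact (List.map_injective_iff.2 (phi_inj hg) h1).symm
    · right; rwa [wlt_phi hg]

lemma nf_eq (hg : 2 ≤ g) {W : SG.Word g} (hW : SG.IrreducibleWord g W) {x : SG.SurfaceGroup g}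
    (h : SG.eval g W = x) : SG.nf g x = W := by
  unfold SG.nf
  have hex : ∃ W : SG.Word g, SG.eval g W = x ∧ SG.IrreducibleWord g W := ⟨W, h, hW⟩
  rw [dif_pos hex]
  have hs := hex.choose_spec
  apply st_inj hg
  apply N_unique hg ((irr_iff hg _).1 hs.2) ((irr_iff hg _).1 hW)
  rw [← eval_st, ← eval_st, hs.1, h]

lemma nf_spec (hg : 2 ≤ g) (W : SG.Word g) :
    SG.IrreducibleWord g (SG.nf g (SG.eval g W)) ∧
      SG.eval g (SG.nf g (SG.eval g W)) = SG.eval g W := by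
  obtain ⟨T, hT⟩ := st_surj hg (opf [] (W.map phi))
  have hN : N (st T) := by rw [hT]; exact opf_N hg (S := []) trivial _
  have hev : SG.eval g T = SG.eval g W := by
    rw [eval_st hg T, hT, ev_opf, eval_ev hg]; simp [ev]
  rw [nf_eq hg ((irr_iff hg _).2 hN) hev]
  exact ⟨(irr_iff hg _).2 hN, hev⟩

lemma eval_append (A B : SG.Word g) : SG.eval g (A ++ B) = SG.eval g A * SG.eval g B := by
  simp [SG.eval]

lemma eval_wordInv (A : SG.Word g) : SG.eval g (SG.wordInv g A) = (SG.eval g A)⁻¹ := by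
  induction A with
  | nil => simp [SG.wordInv, SG.eval]
  | cons a A ih =>
    have h1 : SG.wordInv g (a :: A) = SG.wordInv g A ++ [SG.invLetter g a] := by simp [SG.wordInv]
    rw [h1, eval_append, ih]
    simp [SG.eval, evalLetter_inv]

/-- a tail of an irreducible word is irreducible -/
lemma irr_tail {a : SG.Letter g} {W : SG.Word g} (h : SG.IrreducibleWord g (a :: W)) :
    SG.IrreducibleWord g W := by
  intro W' hW'
  have h1 := h (a :: W') (by
    have := hW'
    unfold SG.eval at *
    rw [List.map_cons, List.map_cons, List.prod_cons, List.prod_cons, this])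
  rcases h1 with h1 | h1
  · left; simpa using h1
  · right
    unfold SG.wordLt at *
    rcases h1 with h1 | ⟨h1, h2⟩
    · left; simpa using h1
    · right
      refine ⟨by simpa using h1, ?_⟩
      rw [List.cons_lex_cons_iff] at h2
      rcases h2 with h2 | h2
      · exact absurd h2 (lt_irrefl _)
      · exact h2.2

lemma wordInv_len (A : SG.Word g) : (SG.wordInv g A).length = A.length := by simp [SG.wordInv]

lemma irr_len_le {W V : SG.Word g} (h : SG.IrreducibleWord g W) (he : SG.eval g V = SG.eval g W) :
    W.length ≤ V.length := by
  rcases h V he with h | h | h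
  · rw [h]
  · omega
  · omega

lemma st_wordInv_cons (a : SG.Letter g) (A : SG.Word g) :
    st (SG.wordInv g (a :: A)) = (phi a + 2*(g : ZMod (4*g))) :: st (SG.wordInv g A) := by
  simp [st, SG.wordInv, phi_inv]

lemma st_wordInv_eq (A : SG.Word g) :
    st (SG.wordInv g A) = (A.map phi).map (· + 2*(g : ZMod (4*g))) := by
  induction A with
  | nil => rfl
  | cons a A ih => rw [st_wordInv_cons, ih]; simp

lemma up_shift (ε : ZMod (4*g)) (k : ℕ) (a c) : (up ε k a).map (· + c) = up ε k (a + c) := by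
  induction k generalizing a with
  | zero => rfl
  | succ k ih => rw [up_succ, List.map_cons, ih, up_succ]; congr 2; ring

lemma dn_up (ε : ZMod (4*g)) (k a) : dn ε k a = up (-ε) k (a - ε) := by
  induction k generalizing a with
  | zero => rfl
  | succ k ih => rw [dn_succ, up_succ, ih]; congr 2; ring

lemma irr_inv (hg : 2 ≤ g) (X : SG.Word g) (h : SG.IrreducibleWord g X) :
    N (st (SG.wordInv g X)) := by
  induction X with
  | nil => trivial
  | cons x X ih =>
    have hN := ih (irr_tail h)
    rw [st_wordInv_cons]
    have h1 : (op (st (SG.wordInv g X)) (phi x + 2*(g : ZMod (4*g)))).length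
        = (st (SG.wordInv g X)).length + 1 := by
      rcases op_len hg (phi x + 2*(g : ZMod (4*g))) hN with h1 | h1
      · exact h1
      · exfalso
        obtain ⟨T, hT⟩ := st_surj hg (op (st (SG.wordInv g X)) (phi x + 2*(g : ZMod (4*g))))
        have hev : SG.eval g T = SG.eval g (SG.wordInv g (x :: X)) := by
          rw [eval_st hg T, hT, ev_op', eval_st hg, st_wordInv_cons, List.reverse_cons, ev_append,
            ev_cons, ev_nil, mul_one]
        have := irr_len_le h (V := SG.wordInv g T) (by rw [eval_wordInv, hev, eval_wordInv, inv_inv])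
        rw [wordInv_len, ← st_len T, hT] at this
        rw [st_len, wordInv_len] at h1
        simp at this; omega
    rcases op_longer hg hN h1 with h2 | ⟨ε, P, hε, hP, hgd, _, _⟩
    · rw [← h2]; exact op_N' hg _ hN
    · exfalso
      apply hgd
      rw [good_inv hg hε, two_g_add, good_opp hg hε (phi x) _ rfl, not_not]
      -- the word `x :: X` starts with a run
      have hw : ∃ Q, (x :: X).map phi = up (-ε) (2*g) (phi x) ++ Q := by
        rw [st_wordInv_eq] at hP
        have hP2 := congrArg (List.map (· + 2*(g : ZMod (4*g)))) hP
        rw [List.map_map] at hP2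
        have : ((fun z : ZMod (4*g) => z + 2*(g : ZMod (4*g))) ∘ fun z => z + 2*(g : ZMod (4*g))) = id := by
          funext z; exact two_g_add z
        rw [this, List.map_id, List.map_append] at hP2
        unfold D at hP2
        rw [dn_up, up_shift] at hP2
        refine ⟨P.map (· + 2*(g : ZMod (4*g))), ?_⟩
        rw [List.map_cons, hP2, up_succ' (-ε) (2*g) (2*g-1) _ (by omega), List.cons_append]
        congr 3; linear_combination four (g := g)
      obtain ⟨Q, hQ⟩ := hw
      have hst : st (x :: X) = Q.reverse ++ (up (-ε) (2*g) (phi x)).reverse := by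
        unfold st; rw [hQ, List.reverse_append]
      have hN2 := (irr_iff hg _).1 h
      rw [hst] at hN2
      have hN3 := N_drop hN2
      have hK := K_dn (-ε) (2*g-1) (phi x + ((2*g : ℕ) : ZMod (4*g)) * (-ε)) []
      rw [up_rev] at hN3
      rw [show 2*g-1+1 = 2*g by omega, List.append_nil, K_one] at hK
      have e1 : dn (-ε) (2*g) (phi x + ((2*g : ℕ) : ZMod (4*g)) * (-ε)) =
          (phi x - (2*(g : ZMod (4*g))-1)*ε) ::
            dn (-ε) (2*g-1) (phi x - (2*(g : ZMod (4*g))-1)*ε) := by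
        conv_lhs => arg 2; rw [show 2*g = (2*g-1)+1 by omega]
        rw [dn_succ]
        have : phi x + ((2*g-1+1 : ℕ) : ZMod (4*g)) * (-ε) - -ε = phi x - (2*(g : ZMod (4*g))-1)*ε := by
          rw [show 2*g-1+1 = 2*g by omega]; push_cast; ring
        rw [show 2*g-1+1 = 2*g by omega] at *
        rw [this]
      rw [e1] at hN3 hK
      exact N_good hN3 hε.neg (by omega)

end SGP


namespace SGP
variable {g : ℕ}

/-- After pushing `b`, the stack `S` is dominated by the stack `u` in direction `η`. -/
def Ok {g : ℕ} (η b : ZMod (4*g)) (S u : List (ZMod (4*g))) : Prop :=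
  H η (b :: S) ≤ 2*g ∧ (K η (b :: S) = 2*g → good η b) ∧ H η (b :: S) ≤ H η (b :: u) ∧
  (K η (b :: S) ≤ K η (b :: u) ∨ good η (b + (2*(g : ZMod (4*g)) - (K η (b :: S) : ZMod (4*g)))*η))

lemma Ok_one (hg : 2 ≤ g) {η b : ZMod (4*g)} {S : List (ZMod (4*g))} (u : List (ZMod (4*g)))
    (h : H η (b :: S) = 1) : Ok η b S u := by
  have h1 := K_le_H η (b :: S)
  have h2 := K_pos η b u
  have h3 := H_pos η b u
  exact ⟨by omega, by omega, by omega, Or.inl (by omega)⟩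

lemma Ok_step {η z b : ZMod (4*g)} (hη : Sg η) {S u : List (ZMod (4*g))}
    (hu : N (b :: z :: u))
    (h1 : H η (z :: S) ≤ H η (z :: u))
    (h2 : K η (z :: S) ≤ K η (z :: u) ∨
      good η (z + (2*(g : ZMod (4*g)) - (K η (z :: S) : ZMod (4*g)))*η)) :
    Ok η b (z :: S) (z :: u) := by
  have hH := N_H hu hη
  have hK := N_K hu hη
  have hgd := N_good hu hη
  have hu1 := N_H (N_tail hu) hη
  unfold Ok
  by_cases hb : b = z + η
  · subst hb
    rw [H_step, H_step, K_step, K_step] at *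
    refine ⟨by omega, ?_, by omega, ?_⟩
    · intro h
      rcases h2 with h2 | h2
      · exact hgd (by omega)
      · convert h2 using 1
        have : (K η (z :: S) : ZMod (4*g)) + 1 = 2*g := by exact_mod_cast congrArg (Nat.cast (R := ZMod (4*g))) h
        grind
    · rcases h2 with h2 | h2
      · left; omega
      · right; convert h2 using 1; push_cast; ring
  · rw [K_eq_one _ _ _ _ hb, K_eq_one _ _ _ _ hb, H_cons, H_cons, if_neg hb, if_neg hb] at *
    have hg0 : 2 ≤ 2*g := by
      by_contra h
      have : g = 0 := by omega
      have := H_pos η z u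
      omega
    refine ⟨by split_ifs <;> omega, ?_, ?_, Or.inl le_rfl⟩
    · intro h; omega
    · split_ifs with c1 c2
      · omega
      · exfalso; apply c2; exact ⟨c1.1, by omega⟩
      · omega
      · omega

def Dead {g : ℕ} (u S : List (ZMod (4*g))) (b : ZMod (4*g)) : Prop :=
  ∀ w : List (ZMod (4*g)), N (w.reverse ++ b :: u) →
    N (w.reverse ++ b :: S) ∧ opf S (b :: w) = w.reverse ++ b :: S

lemma N_of_Ok {ε : ZMod (4*g)} (hε : Sg ε) {S u : List (ZMod (4*g))} {b : ZMod (4*g)}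
    (hS : N S) (hb : ∀ a ∈ S.head?, b ≠ a + 2*(g : ZMod (4*g)))
    (h1 : Ok ε b S u) (h2 : Ok (-ε) b S u) : N (b :: S) := by
  refine ⟨hb, ?_, hS⟩
  intro η hη
  rcases sg_cases hε hη with rfl | rfl
  · exact ⟨h1.1, h1.2.1⟩
  · exact ⟨h2.1, h2.2.1⟩

lemma dead_aux {ε : ZMod (4*g)} (hε : Sg ε) (w : List (ZMod (4*g))) : ∀ (S u : List (ZMod (4*g))) (b : ZMod (4*g)),
    N S → (∀ a ∈ S.head?, b ≠ a + 2*(g : ZMod (4*g))) → Ok ε b S u → Ok (-ε) b S u →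
    N (w.reverse ++ b :: u) → N (w.reverse ++ b :: S) := by
  induction w with
  | nil =>
    intro S u b hS hb h1 h2 _
    exact N_of_Ok hε hS hb h1 h2
  | cons c w ih =>
    intro S u b hS hb h1 h2 hN
    have hN1 := N_of_Ok hε hS hb h1 h2
    rw [List.reverse_cons, List.append_assoc] at hN ⊢
    have hN2 : N (c :: b :: u) := N_drop hN
    apply ih (b :: S) (b :: u) c hN1
    · simpa using N_red hN2
    · exact Ok_step hε hN2 h1.2.2.1 h1.2.2.2
    · exact Ok_step hε.neg hN2 h2.2.2.1 h2.2.2.2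
    · exact hN

lemma dead_step (hg : 2 ≤ g) {ε : ZMod (4*g)} (hε : Sg ε) {S u : List (ZMod (4*g))} {b : ZMod (4*g)}
    (hS : N S) (hb : ∀ a ∈ S.head?, b ≠ a + 2*(g : ZMod (4*g)))
    (h1 : Ok ε b S u) (h2 : Ok (-ε) b S u) : Dead u S b := by
  intro w hw
  have h := dead_aux hε w S u b hS hb h1 h2 hw
  refine ⟨h, ?_⟩
  have := opf_push hg (b :: w) S (by rw [List.reverse_cons, List.append_assoc]; exact h)
  rw [this]; simp

/-- `S` starts with `s, s+ε, …` (`r` letters) with `H ε = 1` at each of them. -/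
def TR {g : ℕ} (ε : ZMod (4*g)) : ℕ → ZMod (4*g) → List (ZMod (4*g)) → Prop
  | 0, _, _ => True
  | r+1, s, S => ∃ S', S = s :: S' ∧ H ε S = 1 ∧ TR ε r (s + ε) S'

lemma TR_mono {ε : ZMod (4*g)} {r r' : ℕ} {s : ZMod (4*g)} {S} (h : TR ε r s S) (hr : r' ≤ r) :
    TR ε r' s S := by
  induction r' generalizing r s S with
  | zero => trivial
  | succ r' ih =>
    cases r with
    | zero => omega
    | succ r =>
      obtain ⟨S', h1, h2, h3⟩ := h
      exact ⟨S', h1, h2, ih h3 (by omega)⟩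

lemma TR_dn (hg : 2 ≤ g) {ε : ZMod (4*g)} (hε : Sg ε) (k : ℕ) (a : ZMod (4*g)) (Q) :
    TR ε k (a + ε) (dn (-ε) (k+1) a ++ Q) ∧
    (H ε ((a + (k+1)*ε) :: Q) = 1 → TR ε (k+1) (a + ε) (dn (-ε) (k+1) a ++ Q)) := by
  induction k generalizing a with
  | zero =>
    refine ⟨trivial, ?_⟩
    intro h
    simp only [dn, List.cons_append, List.nil_append]
    rw [sub_neg_eq_add]
    exact ⟨Q, rfl, by simpa using h, trivial⟩
  | succ k ih =>
    have h1 : H ε (dn (-ε) (k+1+1) a ++ Q) = 1 := by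
      rw [dn_succ, dn_succ, List.cons_append, List.cons_append]
      have n1 : a - -ε ≠ a - -ε - -ε + ε := by
        intro h
        exact zno hε 2 (by omega) (by omega) (by push_cast; linear_combination -h)
      have n2 : a - -ε ≠ a - -ε - -ε - (2*(g : ZMod (4*g))-2)*ε := by
        intro h
        exact zno hε (2*g-3) (by omega) (by omega) (by push_cast; linear_combination h)
      exact H_eq_one _ _ _ _ n1 (fun h => absurd h n2)
    have e : dn (-ε) (k+1+1) a ++ Q = (a + ε) :: (dn (-ε) (k+1) (a + ε) ++ Q) := by
      rw [dn_succ, sub_neg_eq_add, List.cons_append]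
    obtain ⟨i1, i2⟩ := ih (a + ε)
    refine ⟨⟨_, e, h1, i1⟩, ?_⟩
    intro h
    refine ⟨_, e, h1, i2 ?_⟩
    rw [← h]; congr 2; push_cast; ring

lemma TR_D (hg : 2 ≤ g) {ε : ZMod (4*g)} (hε : Sg ε) (b : ZMod (4*g)) (Q) :
    TR ε (2*g-2) (b + 2*(g : ZMod (4*g)) + ε) (D (-ε) (b + 2*(g : ZMod (4*g))) ++ Q) ∧
    (H ε ((b - ε) :: Q) = 1 →
      TR ε (2*g-1) (b + 2*(g : ZMod (4*g)) + ε) (D (-ε) (b + 2*(g : ZMod (4*g))) ++ Q)) := by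
  have h := TR_dn hg hε (2*g-2) (b + 2*(g : ZMod (4*g))) Q
  unfold D
  rw [show 2*g-2+1 = 2*g-1 by omega] at h
  refine ⟨h.1, fun h2 => h.2 ?_⟩
  have e : b + 2*(g : ZMod (4*g)) + (((2*g-2:ℕ) : ZMod (4*g))+1)*ε = b - ε := by
    rw [c22 hg]; grind [four (g := g), tg hε]
  rw [e]; exact h2

/-- flipping produces long `TR` -/
lemma op_TR (hg : 2 ≤ g) {ε : ZMod (4*g)} (hε : Sg ε) {b : ZMod (4*g)} {P}
    (hN : N (D ε b ++ P)) (hc : (op P b).length < P.length ∨ ¬ good ε b) :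
    TR ε (2*g-2) (b + 2*(g : ZMod (4*g)) + ε) (op (D ε b ++ P) b) ∧
    ((¬ ∃ P', P = (b + 2*(g : ZMod (4*g))) :: P') →
      TR ε (2*g-1) (b + 2*(g : ZMod (4*g)) + ε) (op (D ε b ++ P) b)) := by
  rw [op_D_flip hg hε hc]
  obtain ⟨h1, h2⟩ := TR_D hg hε b (op P b)
  refine ⟨h1, fun h3 => h2 ?_⟩
  have key : ∀ Q, H ε ((b - ε) :: (b + 2*(g : ZMod (4*g)) + ε) :: Q) = 1 := by
    intro Q
    apply H_eq_one
    · intro h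
      exact zno hε (2*g+3) (by omega) (by omega) (by push_cast; linear_combination -h + tg hε)
    · intro h
      exfalso
      exact zno hε 4 (by omega) (by omega) (by push_cast; linear_combination -h + tg hε)
  rcases chain_cases hg hε hN with h | ⟨P', rfl⟩ | h
  · exact absurd h h3
  · rw [op_D_flip hg hε (op_D_cond hg hε hc), D_neg_cons hg, List.cons_append]
    exact key _
  · rw [h]
    apply H_eq_one
    · intro h
      exact zno hε 2 (by omega) (by omega) (by push_cast; linear_combination -h)
    · intro h
      exfalso
      exact zno hε (2*g-3) (by omega) (by omega) (by push_cast; linear_combination h)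

/-- In a `TR` state most letters are dead. -/
lemma TR_dead (hg : 2 ≤ g) {ε : ZMod (4*g)} (hε : Sg ε) {s z b : ZMod (4*g)} {S u}
    (hS : N (s :: S)) (hH : H ε (s :: S) = 1) (hs : s = z + ε + 2*(g : ZMod (4*g)))
    (hu : N (b :: z :: u)) (hb : b ≠ z + ε) (hb2 : b = s + ε → Ok ε b (s :: S) (z :: u)) :
    Dead (z :: u) (s :: S) b := by
  have hred := N_red hu
  apply dead_step hg hε hS
  · simp only [List.head?_cons, Option.mem_some_iff]
    rintro a rfl h
    apply hb; rw [h, hs]; exact two_g_add _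
  · by_cases h : b = s + ε
    · exact hb2 h
    · apply Ok_one hg
      apply H_eq_one _ _ _ _ h
      intro _; omega
  · have n1 : b ≠ s + -ε := by
      intro h; apply hred; rw [h, hs]; ring
    by_cases h : b = z + -ε
    · have h2 := K_eq_one (-ε) b s S n1
      have h1 := H_le_two (-ε) b s S n1
      have h3 : 2 ≤ H (-ε) (b :: z :: u) := by
        rw [h, H_step]; have := H_pos (-ε) z u; omega
      have h4 := K_pos (-ε) b (z :: u)
      exact ⟨by omega, by omega, by omega, Or.inl (by omega)⟩
    · apply Ok_one hg
      apply H_eq_one _ _ _ _ n1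
      intro h'
      exfalso; apply h; grind [four (g := g), tg hε]

end SGP


namespace SGP
variable {g : ℕ}

def B {g : ℕ} (ε y : ZMod (4*g)) (q : ℕ) : ZMod (4*g) :=
  y + ((q : ZMod (4*g)) - (2*(g : ZMod (4*g)) - 1))*ε

def F {g : ℕ} (ε y : ZMod (4*g)) (q σ k : ℕ) : List (ZMod (4*g)) :=
  up ε q (y + ε) ++ (List.replicate σ (up ε (2*g-1) (B ε y q + ε))).flatten ++ up ε k (B ε y q + ε)

lemma F_snoc (ε y : ZMod (4*g)) (q σ k : ℕ) {b : ZMod (4*g)} (hb : b = B ε y q + ((k : ZMod (4*g)) + 1)*ε) :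
    F ε y q σ k ++ [b] = F ε y q σ (k+1) := by
  unfold F
  rw [up_last, List.append_assoc _ (up ε k _)]
  have : b = B ε y q + ε + k * ε := by rw [hb]; ring
  rw [this]

lemma F_zero (ε y : ZMod (4*g)) (q : ℕ) : F ε y q 0 0 = up ε q (y + ε) := by
  simp [F, up]

lemma F_wrap (ε y : ZMod (4*g)) (q σ : ℕ) : F ε y q σ (2*g-1) = F ε y q (σ+1) 0 := by
  unfold F
  rw [List.replicate_succ', List.flatten_append]
  simp [up]

lemma F_rev (ε y : ZMod (4*g)) (q σ k : ℕ) :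
    (F ε y q σ (k+1)).reverse = (B ε y q + ((k : ZMod (4*g)) + 1)*ε) :: (F ε y q σ k).reverse := by
  rw [← F_snoc ε y q σ k rfl]; simp

lemma F_len (ε y : ZMod (4*g)) (q σ k : ℕ) : (F ε y q σ (k+1)).length = (F ε y q σ k).length + 1 := by
  rw [← F_snoc ε y q σ k rfl]; simp

lemma up_rev_cons (ε y : ZMod (4*g)) (q : ℕ) :
    (up ε (q+1) (y+ε)).reverse = (y + ((q : ZMod (4*g)) + 1)*ε) :: (up ε q (y+ε)).reverse := by
  rw [up_last]; simp; ring

lemma up_snoc (ε y : ZMod (4*g)) (q : ℕ) {b : ZMod (4*g)} (hb : b = y + ((q : ZMod (4*g)) + 1)*ε) :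
    up ε q (y+ε) ++ [b] = up ε (q+1) (y+ε) := by
  rw [up_last, hb]; congr 2; ring

inductive State {g : ℕ} (ε y : ZMod (4*g)) (Y : List (ZMod (4*g))) :
    List (ZMod (4*g)) → List (ZMod (4*g)) → Prop
  | L (q : ℕ) (hq : 1 ≤ q) (p S) (hp : p = up ε q (y+ε)) (hS : S = p.reverse ++ Y) : State ε y Y p S
  | E (q r : ℕ) (hq : 1 ≤ q) (hr : 1 ≤ r) (p S) (hp : p = up ε q (y+ε)) (hT : TR ε r (B ε y q) S)
      (hk : 4*g - 1 ≤ r + K ε Y + q) (hi : 2 ≤ H ε Y ∨ 2*g-1 ≤ q)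
      (hl : Y.length + q ≤ S.length + 2*q) : State ε y Y p S
  | M (q σ k : ℕ) (hk1 : 1 ≤ k) (hk2 : k ≤ 2*g-1) (p S S') (hp : p = F ε y q σ k)
      (hS : S = (B ε y q + (k : ZMod (4*g))*ε) :: S') (hH : H ε S = k+1)
      (hi : 2 ≤ H ε Y ∨ 2*g-1 ≤ q)
      (hl : Y.length + p.length ≤ S.length + 2*q) : State ε y Y p S
  | G (q σ : ℕ) (p S) (hp : p = F ε y q σ (2*g-1)) (hT : TR ε (2*g-1) (B ε y q) S)
      (hi : 2 ≤ H ε Y ∨ 2*g-1 ≤ q)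
      (hl : Y.length + p.length ≤ S.length + 2*q) : State ε y Y p S
  | E2 (q σ : ℕ) (p S) (hp : p = F ε y q σ (2*g)) (hT : TR ε 2 (B ε y q + ε) S)
      (hi : 2 ≤ H ε Y ∨ 2*g-1 ≤ q)
      (hl : Y.length + p.length ≤ S.length + 2*q+2) : State ε y Y p S

/-- Top of the `L` state. -/
lemma L_shape (ε y : ZMod (4*g)) (Y1) (q : ℕ) :
    ∃ T, (up ε q (y+ε)).reverse ++ (y :: Y1) = (y + (q : ZMod (4*g))*ε) :: T ∧
      H ε ((y + (q : ZMod (4*g))*ε) :: T) = H ε (y :: Y1) + q ∧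
      K ε ((y + (q : ZMod (4*g))*ε) :: T) = K ε (y :: Y1) + q := by
  induction q with
  | zero => exact ⟨Y1, by simp [up], by simp, by simp⟩
  | succ q ih =>
    obtain ⟨T, h1, h2, h3⟩ := ih
    have e : y + ((q+1 : ℕ) : ZMod (4*g))*ε = y + (q : ZMod (4*g))*ε + ε := by push_cast; ring
    refine ⟨(y + (q : ZMod (4*g))*ε) :: T, ?_, ?_, ?_⟩
    · rw [up_rev_cons, List.cons_append, h1]; push_cast; rfl
    · rw [e, H_step, h2]; omega
    · rw [e, K_step, h3]; omega

lemma L_push (hg : 2 ≤ g) {ε : ZMod (4*g)} (hε : Sg ε) (y : ZMod (4*g)) (Y1) (q : ℕ) {S}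
    (hS : S = (up ε q (y+ε)).reverse ++ (y :: Y1)) (hN : N S) {b : ZMod (4*g)}
    (hb : b = y + ((q : ZMod (4*g)) + 1)*ε) :
    State ε y (y :: Y1) (up ε q (y+ε) ++ [b]) (op S b) := by
  obtain ⟨T, h1, h2, h3⟩ := L_shape ε y Y1 q
  have hb' : b = y + (q : ZMod (4*g))*ε + ε := by rw [hb]; ring
  rw [h1] at hS
  have hlen : S.length = q + (Y1.length + 1) := by
    rw [hS, ← h1]; simp [up_len]
  have hHl := N_H hN hε
  have hKl := N_K hN hε
  have hKH := K_le_H ε S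
  have hHK := H_le_K ε S
  rw [up_snoc ε y q hb]
  by_cases hc : H ε S = 2*g ∨ (K ε S + 1 = 2*g ∧ ¬ good ε b)
  · have hK : 2*g-1 ≤ K ε S := by omega
    obtain ⟨P, hP⟩ := peelD hg ε _ _ (hS ▸ hK)
    rw [← hb', ← hS] at hP
    have hcond : (op P b).length < P.length ∨ ¬ good ε b := by
      rcases hc with hc | hc
      · left; exact (shorter_iff hg hε b P.length P le_rfl (hP ▸ hN)).2 (hP ▸ hc)
      · right; exact hc.2
    obtain ⟨t1, t2⟩ := op_TR hg hε (hP ▸ hN) hcond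
    rw [← hP] at t1 t2
    have eB : b + 2*(g : ZMod (4*g)) + ε = B ε y (q+1) := by
      unfold B; push_cast; grind [four (g := g), tg hε]
    rw [eB] at t1 t2
    have hl := op_len hg b hN
    have hY : (y :: Y1).length = Y1.length + 1 := rfl
    rw [hS] at hHl hKl hKH hHK hK
    by_cases hK2 : K ε S = 2*g
    · rw [hS] at hK2
      exact State.E (q+1) (2*g-2) (by omega) (by omega) _ _ rfl t1 (by omega) (by omega) (by omega)
    · have : ¬ ∃ P', P = (b + 2*(g : ZMod (4*g))) :: P' := by
        rintro ⟨P', rfl⟩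
        apply hK2
        rw [hP, K_D hg]
        have : b - (2*(g : ZMod (4*g))-1)*ε = b + 2*g + ε := by grind [four (g := g), tg hε]
        rw [this, K_step]
        have := K_pos ε (b + 2*(g : ZMod (4*g))) P'
        have h5 : K ε S = K ε ((b + 2*(g : ZMod (4*g))) :: P') + 1 + (2*g-2) := by
          rw [hP, K_D hg]
          rw [‹b - (2*(g : ZMod (4*g))-1)*ε = b + 2*g + ε›, K_step]
        rw [← hS] at hKl
        omega
      rw [hS] at hK2
      exact State.E (q+1) (2*g-1) (by omega) (by omega) _ _ rfl (t2 this) (by omega) (by omega) (by omega)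
  · push Not at hc
    have hN2 : N (b :: S) := by
      rw [hb', hS]
      apply N_push hg hε (hS ▸ hN)
      · rw [← hS]; omega
      · rw [← hS, ← hb']; intro h; exact hc.2 h
    rw [op_append hg hN2]
    refine State.L (q+1) (by omega) _ _ rfl ?_
    rw [up_rev_cons, List.cons_append, h1, ← hb, hS]

/-- wrap-around letter: new run starts. -/
lemma wrap_push (hg : 2 ≤ g) {ε : ZMod (4*g)} (hε : Sg ε) {z : ZMod (4*g)} {T}
    (hN : N (z :: T)) (hH : H ε (z :: T) = 2*g) {b : ZMod (4*g)}
    (hb : b = z - (2*(g : ZMod (4*g)) - 2)*ε) (hr : b ≠ z + 2*(g : ZMod (4*g))) :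
    N (b :: z :: T) ∧ H ε (b :: z :: T) = 2 := by
  have n1 : b ≠ z + ε := by
    intro h
    exact zno hε (2*g-1) (by omega) (by omega) (by push_cast; linear_combination hb - h)
  have n2 : b ≠ z + -ε := by
    intro h
    exact zno hε (2*g-3) (by omega) (by omega) (by push_cast; linear_combination hb - h)
  have h2 : H ε (b :: z :: T) = 2 := by
    rw [H_cons, if_neg n1, if_pos ⟨hb, hH⟩]
  have hK := K_eq_one ε b z T n1
  have hK2 := K_eq_one (-ε) b z T n2
  have hH2 := H_le_two (-ε) b z T n2
  exact ⟨N_mk hε hN hr (by omega) (by omega) (by omega) (by omega), h2⟩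

end SGP


namespace SGP
variable {g : ℕ}

lemma B_next (hg : 2 ≤ g) {ε : ZMod (4*g)} (hε : Sg ε) (y : ZMod (4*g)) (q : ℕ) :
    B ε y (q+1) = B ε y q + ε := by
  unfold B; push_cast; ring

lemma dead_plain (hg : 2 ≤ g) {ε : ZMod (4*g)} (hε : Sg ε) {z b : ZMod (4*g)} {T u}
    (hS : N (z :: T)) (hH : 2 ≤ H ε (z :: T)) (hu : N (b :: z :: u)) (hb : b ≠ z + ε)
    (hb2 : b = z - (2*(g : ZMod (4*g)) - 2)*ε → H ε (z :: T) ≠ 2*g) :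
    Dead (z :: u) (z :: T) b := by
  apply dead_step hg hε hS
  · simpa using N_red hu
  · exact Ok_one hg _ (H_eq_one _ _ _ _ hb hb2)
  · apply Ok_step hε.neg hu
    · rw [H_opp hg hε _ hH]; exact H_pos _ _ _
    · left; rw [K_opp hg hε _ _ hH]; exact K_pos _ _ _

lemma step (hg : 2 ≤ g) {ε : ZMod (4*g)} (hε : Sg ε) {y : ZMod (4*g)} {Y1 p S} {b : ZMod (4*g)}
    (hst : State ε y (y :: Y1) p S) (hN : N S) (hu : N (b :: p.reverse)) :
    State ε y (y :: Y1) (p ++ [b]) (op S b) ∨ Dead p.reverse S b ∨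
      ∃ q, p ++ [b] = up ε q (y+ε) ∧ 4*g-1 ≤ K ε (y :: Y1) + q := by
  cases hst with
  | L q hq _ _ hp hS =>
    obtain ⟨T, h1, h2, h3⟩ := L_shape ε y Y1 q
    by_cases hb : b = y + ((q : ZMod (4*g)) + 1)*ε
    · left
      subst hp
      exact L_push hg hε y Y1 q hS hN hb
    have hlen : S.length = p.length + (y :: Y1).length := by rw [hS]; simp
    have hpl : p.length = q := by rw [hp, up_len]
    obtain ⟨q', rfl⟩ : ∃ q', q = q'+1 := ⟨q-1, by omega⟩
    have hpr := up_rev_cons ε y q'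
    rw [← hp] at hpr
    rw [hp, h1] at hS
    have ez : y + ((q'+1 : ℕ) : ZMod (4*g))*ε = y + ((q' : ZMod (4*g)) + 1)*ε := by push_cast; ring
    rw [ez] at hS h1 h2 h3
    rw [hpr] at hu ⊢
    have hb1 : b ≠ y + ((q' : ZMod (4*g)) + 1)*ε + ε := by
      intro h; apply hb; rw [h]; push_cast; ring
    have hY := H_pos ε y Y1
    rw [hS] at hN
    have hHl := N_H hN hε
    by_cases hw : b = (y + ((q' : ZMod (4*g)) + 1)*ε) - (2*(g : ZMod (4*g)) - 2)*ε ∧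
        H ε ((y + ((q' : ZMod (4*g)) + 1)*ε) :: T) = 2*g
    · left
      obtain ⟨w1, w2⟩ := wrap_push hg hε hN hw.2 hw.1 (N_red hu)
      rw [hS, op_append hg w1]
      rw [hS] at hlen
      have eb : b = B ε y (q'+1) + ((1 : ℕ) : ZMod (4*g))*ε := by
        rw [hw.1]; unfold B; push_cast; ring
      refine State.M (q'+1) 0 1 le_rfl (by omega) _ _ _ ?_ (by rw [← eb]) (by omega) (by omega) ?_
      · rw [hp, ← F_zero]; exact F_snoc _ _ _ _ _ (by rw [eb]; push_cast; ring)
      · simp only [List.length_append, List.length_cons, List.length_nil] at *; omega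
    · right; left
      rw [hS]
      exact dead_plain hg hε hN (by omega) hu hb1 (fun h1 h2 => hw ⟨h1, h2⟩)
  | E q r hq hr _ _ hp hT hk hi hl =>
    obtain ⟨q', rfl⟩ : ∃ q', q = q'+1 := ⟨q-1, by omega⟩
    obtain ⟨r', rfl⟩ : ∃ r', r = r'+1 := ⟨r-1, by omega⟩
    have hpr := up_rev_cons ε y q'
    rw [← hp] at hpr
    obtain ⟨S', hS, hH, hT'⟩ := hT
    have hs : B ε y (q'+1) = (y + ((q' : ZMod (4*g)) + 1)*ε) + ε + 2*(g : ZMod (4*g)) := by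
      unfold B; push_cast; grind [four (g := g), tg hε]
    have hpl : p.length = q'+1 := by rw [hp, up_len]
    have hSl : S.length = S'.length + 1 := by rw [hS]; rfl
    by_cases hb : b = (y + ((q' : ZMod (4*g)) + 1)*ε) + ε
    · have hop : op S b = S' := by
        rw [hS]; apply op_cancel'; rw [hs, hb]
      have hpb : p ++ [b] = up ε (q'+1+1) (y+ε) := by
        rw [hp]; apply up_snoc; rw [hb]; push_cast; ring
      by_cases hr0 : r' = 0
      · right; right
        exact ⟨q'+1+1, hpb, by omega⟩
      · left
        rw [hop]
        refine State.E (q'+1+1) r' (by omega) (by omega) _ _ hpb ?_ (by omega) (by omega) (by omega)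
        rw [B_next hg hε]; exact hT'
    · by_cases hb2 : b = B ε y (q'+1) + ε
      · left
        have hK := K_le_H ε S
        have hN2 : N (b :: S) := by
          rw [hb2, hS]
          apply N_push hg hε (hS ▸ hN)
          · rw [← hS]; omega
          · rw [← hS]; omega
        rw [op_append hg hN2]
        refine State.M (q'+1) 0 1 le_rfl (by omega) _ _ S ?_ (by rw [hb2]; push_cast; ring_nf) ?_ hi ?_
        · rw [hp, ← F_zero]; exact F_snoc _ _ _ _ _ (by rw [hb2]; push_cast; ring)
        · rw [hb2, hS, H_step, ← hS, hH]
        · simp only [List.length_append, List.length_cons, List.length_nil] at *; omega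
      · right; left
        rw [hpr] at hu ⊢
        rw [hS] at hN hH ⊢
        exact TR_dead hg hε hN hH hs hu hb (fun h => absurd h hb2)
  | M q σ k hk1 hk2 _ _ S' hp hS hH hi hl =>
    obtain ⟨k', rfl⟩ : ∃ k', k = k'+1 := ⟨k-1, by omega⟩
    have hpr := F_rev ε y q σ k'
    rw [← hp] at hpr
    have ez : B ε y q + ((k'+1 : ℕ) : ZMod (4*g))*ε = B ε y q + ((k' : ZMod (4*g)) + 1)*ε := by push_cast; ring
    rw [ez] at hS
    have hol := op_len hg b hN
    by_cases hb : b = (B ε y q + ((k' : ZMod (4*g)) + 1)*ε) + ε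
    · left
      have hpb : p ++ [b] = F ε y q σ (k'+1+1) := by
        rw [hp]; apply F_snoc; rw [hb]; push_cast; ring
      have hKH := K_le_H ε S
      have hHK := H_le_K ε S
      have hNS := hS ▸ hN
      by_cases hk : k'+1 = 2*g-1
      · -- shortening
        obtain ⟨P, hP⟩ := peelD hg ε _ _ (show 2*g-1 ≤ K ε ((B ε y q + ((k' : ZMod (4*g)) + 1)*ε) :: S') by
          rw [← hS]; omega)
        rw [← hb, ← hS] at hP
        have hsh : (op P b).length < P.length :=
          (shorter_iff hg hε b P.length P le_rfl (hP ▸ hN)).2 (hP ▸ (by omega))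
        obtain ⟨t1, -⟩ := op_TR hg hε (hP ▸ hN) (Or.inl hsh)
        have hk'c : (k' : ZMod (4*g)) = 2*g - 2 := by
          rw [← c22 hg]; congr 1; omega
        have hlen : (op S b).length + 1 = S.length := by
          rw [hP, op_D_flip hg hε (Or.inl hsh)]
          have := op_len hg b (N_drop (hP ▸ hN) : N P)
          simp only [List.length_append, D_len]; omega
        rw [← hP] at t1
        have eB : b + 2*(g : ZMod (4*g)) + ε = B ε y q + ε := by
          rw [hb, hk'c]; grind [four (g := g), tg hε]
        rw [eB] at t1
        have h2g : k'+1+1 = 2*g := by omega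
        refine State.E2 q σ _ _ (by rw [hpb, h2g]) (TR_mono t1 (by omega)) hi ?_
        simp only [List.length_append, List.length_cons, List.length_nil] at *; omega
      · by_cases hf : K ε S + 1 = 2*g ∧ ¬ good ε b
        · obtain ⟨P, hP⟩ := peelD hg ε _ _ (show 2*g-1 ≤ K ε ((B ε y q + ((k' : ZMod (4*g)) + 1)*ε) :: S') by
            rw [← hS]; omega)
          rw [← hb, ← hS] at hP
          have hsh : ¬ (op P b).length < P.length := by
            rw [shorter_iff hg hε b P.length P le_rfl (hP ▸ hN), ← hP]; omega
          obtain ⟨t1, t2⟩ := op_TR hg hε (hP ▸ hN) (Or.inr hf.2)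
          have hk'2 : k'+1 = 2*g-2 := by omega
          have hk'c : (k' : ZMod (4*g)) + 1 = 2*g - 2 := by
            rw [← c22 hg, ← hk'2]; push_cast; ring
          have hlen : (op S b).length = S.length + 1 := by
            rw [hP, op_D_flip hg hε (Or.inr hf.2)]
            have := op_len hg b (N_drop (hP ▸ hN) : N P)
            simp only [List.length_append, D_len]; omega
          have hnp : ¬ ∃ P', P = (b + 2*(g : ZMod (4*g))) :: P' := by
            rintro ⟨P', rfl⟩
            apply hsh; rw [op_cancel]; simp
          have t2 := t2 hnp
          rw [← hP] at t2
          have eB : b + 2*(g : ZMod (4*g)) + ε = B ε y q := by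
            rw [hb, hk'c]; grind [four (g := g), tg hε]
          rw [eB] at t2
          have h2g : k'+1+1 = 2*g-1 := by omega
          refine State.G q σ _ _ (by rw [hpb, h2g]) t2 hi ?_
          simp only [List.length_append, List.length_cons, List.length_nil] at *; omega
        · push Not at hf
          have hN2 : N (b :: S) := by
            rw [hb, hS]
            apply N_push hg hε hNS
            · rw [← hS]; omega
            · rw [← hS, ← hb]; exact hf
          rw [op_append hg hN2]
          refine State.M q σ (k'+1+1) (by omega) (by omega) _ _ S hpb (by rw [hb]; push_cast; ring_nf) ?_ hi ?_
          · rw [hb, hS, H_step, ← hS, hH]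
          · simp only [List.length_append, List.length_cons, List.length_nil] at *; omega
    · rw [hpr] at hu ⊢
      rw [hS] at hN hH
      have hHl := N_H hN hε
      by_cases hw : b = (B ε y q + ((k' : ZMod (4*g)) + 1)*ε) - (2*(g : ZMod (4*g)) - 2)*ε ∧
          H ε ((B ε y q + ((k' : ZMod (4*g)) + 1)*ε) :: S') = 2*g
      · left
        obtain ⟨w1, w2⟩ := wrap_push hg hε hN hw.2 hw.1 (N_red hu)
        rw [hS, op_append hg w1]
        rw [hS] at hl
        have hk'c : (k' : ZMod (4*g)) = 2*g - 2 := by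
          rw [← c22 hg]; congr 1; omega
        have eb : b = B ε y q + ((1 : ℕ) : ZMod (4*g))*ε := by
          rw [hw.1, hk'c]; push_cast; ring
        have h2g : k'+1 = 2*g-1 := by omega
        refine State.M q (σ+1) 1 le_rfl (by omega) _ _ _ ?_ (by rw [← eb]) (by omega) (by omega) ?_
        · rw [hp, h2g, F_wrap]; exact F_snoc _ _ _ _ _ (by rw [eb]; push_cast; ring)
        · simp only [List.length_append, List.length_cons, List.length_nil] at *; omega
      · right; left
        rw [hS]
        exact dead_plain hg hε hN (by omega) hu hb (fun h1 h2 => hw ⟨h1, h2⟩)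
  | G q σ _ _ hp hT hi hl =>
    obtain ⟨k', hk'⟩ : ∃ k', 2*g-1 = k'+1 := ⟨2*g-2, by omega⟩
    have hk'c : (k' : ZMod (4*g)) = 2*g - 2 := by
      rw [← c22 hg]; congr 1; omega
    have hpr := F_rev ε y q σ k'
    rw [← hk', ← hp] at hpr
    have hT2 := TR_mono hT (show 1 + 1 + 1 ≤ 2*g-1 by omega)
    obtain ⟨S', hS, hH, hT'⟩ := hT2
    have hs : B ε y q = (B ε y q + ((k' : ZMod (4*g)) + 1)*ε) + ε + 2*(g : ZMod (4*g)) := by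
      rw [hk'c]; grind [four (g := g), tg hε]
    have hSl : S.length = S'.length + 1 := by rw [hS]; rfl
    by_cases hb : b = (B ε y q + ((k' : ZMod (4*g)) + 1)*ε) + ε
    · left
      have hop : op S b = S' := by
        rw [hS]; apply op_cancel'; rw [hb]; exact hs
      have hpb : p ++ [b] = F ε y q σ (2*g) := by
        have h2g : 2*g = k'+1+1 := by omega
        rw [hp, hk', h2g]; apply F_snoc; rw [hb]; push_cast; ring
      rw [hop]
      refine State.E2 q σ _ _ hpb hT' hi ?_
      simp only [List.length_append, List.length_cons, List.length_nil] at *; omega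
    · by_cases hb2 : b = B ε y q + ε
      · left
        have hK := K_le_H ε S
        have hN2 : N (b :: S) := by
          rw [hb2, hS]
          apply N_push hg hε (hS ▸ hN)
          · rw [← hS]; omega
          · rw [← hS]; omega
        rw [op_append hg hN2]
        refine State.M q (σ+1) 1 le_rfl (by omega) _ _ S ?_ (by rw [hb2]; push_cast; ring_nf) ?_ hi ?_
        · rw [hp, F_wrap]; exact F_snoc _ _ _ _ _ (by rw [hb2]; push_cast; ring)
        · rw [hb2, hS, H_step, ← hS, hH]
        · simp only [List.length_append, List.length_cons, List.length_nil] at *; omega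
      · right; left
        rw [hpr] at hu ⊢
        rw [hS] at hN hH ⊢
        exact TR_dead hg hε hN hH hs hu hb (fun h => absurd h hb2)
  | E2 q σ _ _ hp hT hi hl =>
    right; left
    obtain ⟨k', hk'⟩ : ∃ k', 2*g = k'+1 := ⟨2*g-1, by omega⟩
    have hk'c : (k' : ZMod (4*g)) = 2*g - 1 := by
      rw [← c21 hg]; congr 1; omega
    have hpr := F_rev ε y q σ k'
    rw [← hk', ← hp] at hpr
    have hKu : 2*g ≤ K ε p.reverse := by
      rw [hp]; unfold F
      rw [List.reverse_append, up_rev, hk', K_dn]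
      have := K_pos ε (B ε y q + ε + ((k'+1 : ℕ) : ZMod (4*g)) * ε - ((k' : ZMod (4*g)) + 1) * ε)
        ((up ε q (y + ε) ++ (List.replicate σ (up ε (k'+1-1) (B ε y q + ε))).flatten).reverse)
      omega
    rw [hpr] at hu hKu ⊢
    have hu' := N_tail hu
    have hKu' := N_K hu' hε
    have hHu := N_H hu' hε
    have hKH := K_le_H ε ((B ε y q + ((k' : ZMod (4*g)) + 1)*ε) :: (F ε y q σ k').reverse)
    have hgood := N_good hu' hε (by omega)
    obtain ⟨S', hS, hH, hT'⟩ := hT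
    have hs : B ε y q + ε = (B ε y q + ((k' : ZMod (4*g)) + 1)*ε) + ε + 2*(g : ZMod (4*g)) := by
      rw [hk'c]; grind [four (g := g), tg hε]
    have hb : b ≠ (B ε y q + ((k' : ZMod (4*g)) + 1)*ε) + ε := by
      intro h
      have := N_H hu hε
      rw [h, H_step] at this; omega
    rw [hS] at hN hH ⊢
    apply TR_dead hg hε hN hH hs hu hb
    intro hb2
    have hKS := K_le_H ε ((B ε y q + ε) :: S')
    have hKp := K_pos ε (B ε y q + ε) S'
    have e1 : H ε (b :: (B ε y q + ε) :: S') = 2 := by rw [hb2, H_step, hH]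
    have e2 : K ε (b :: (B ε y q + ε) :: S') = 2 := by rw [hb2, K_step]; omega
    have e3 : H ε (b :: (B ε y q + ((k' : ZMod (4*g)) + 1)*ε) :: (F ε y q σ k').reverse) = 2 := by
      rw [H_cons, if_neg hb, if_pos]
      refine ⟨?_, by omega⟩
      rw [hb2, hk'c]; ring
    refine ⟨by omega, by omega, by omega, Or.inr ?_⟩
    rw [e2]
    convert hgood using 1
    rw [hb2, hk'c]; push_cast; ring

lemma step0 (hg : 2 ≤ g) {y : ZMod (4*g)} {Y1} {b : ZMod (4*g)}
    (hN : N (y :: Y1)) (hb : b ≠ y + 2*(g : ZMod (4*g))) :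
    (∃ ε, Sg ε ∧ State ε y (y :: Y1) [b] (op (y :: Y1) b)) ∨ Dead [] (y :: Y1) b := by
  have key : ∀ ε : ZMod (4*g), Sg ε → (∃ ε, Sg ε ∧ State ε y (y :: Y1) [b] (op (y :: Y1) b)) ∨
      H ε (b :: y :: Y1) = 1 := by
    intro ε hε
    by_cases h1 : b = y + ε
    · left; refine ⟨ε, hε, ?_⟩
      have := L_push hg hε y Y1 0 (by simp [up]) hN (b := b) (by rw [h1]; simp)
      simpa [up] using this
    · by_cases hw : b = y - (2*(g : ZMod (4*g)) - 2)*ε ∧ H ε (y :: Y1) = 2*g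
      · left; refine ⟨ε, hε, ?_⟩
        obtain ⟨w1, w2⟩ := wrap_push hg hε hN hw.2 hw.1 hb
        rw [op_append hg w1]
        have eb : b = B ε y 0 + ((1 : ℕ) : ZMod (4*g))*ε := by
          rw [hw.1]; unfold B; push_cast; ring
        refine State.M 0 0 1 le_rfl (by omega) _ _ _ ?_ (by rw [← eb]) (by omega) (by omega) ?_
        · rw [← F_snoc ε y 0 0 0 (b := b) (by rw [eb]; push_cast; ring), F_zero]; rfl
        · simp only [List.length_cons, List.length_nil] at *; omega
      · right; exact H_eq_one _ _ _ _ h1 (fun h1 h2 => hw ⟨h1, h2⟩)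
  have s1 : Sg (1 : ZMod (4*g)) := Or.inl rfl
  rcases key 1 s1 with h | h1
  · exact Or.inl h
  rcases key (-1) s1.neg with h | h2
  · exact Or.inl h
  right
  exact dead_step hg s1 hN (by simpa using hb) (Ok_one hg _ h1) (Ok_one hg _ h2)

end SGP


namespace SGP
variable {g : ℕ}

lemma dead_head {u S : List (ZMod (4*g))} {b : ZMod (4*g)} (h : Dead u S b) (w)
    (hN : N (w.reverse ++ b :: u)) : (opf S (b :: w)).head? = (b :: w).getLast? := by
  rw [(h w hN).2]
  have : w.reverse ++ b :: S = (b :: w).reverse ++ S := by simp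
  rw [this, List.head?_append, List.head?_reverse]
  cases h : (b :: w).getLast? with
  | none => simp at h
  | some a => rfl

lemma run (hg : 2 ≤ g) {ε : ZMod (4*g)} (hε : Sg ε) {y : ZMod (4*g)} {Y1} (w : List (ZMod (4*g))) :
    ∀ p S, State ε y (y :: Y1) p S → N S → N (p ++ w).reverse →
      State ε y (y :: Y1) (p ++ w) (opf S w) ∨
      (w ≠ [] ∧ (opf S w).head? = w.getLast?) ∨
      ∃ q rest, p ++ w = up ε q (y+ε) ++ rest ∧ 4*g-1 ≤ K ε (y :: Y1) + q := by
  induction w with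
  | nil => intro p S h _ _; left; simpa [opf] using h
  | cons b w ih =>
    intro p S h hN hu
    have hu0 : N (w.reverse ++ b :: p.reverse) := by simpa using hu
    have hub : N (b :: p.reverse) := N_drop hu0
    rcases step hg hε h hN hub with h1 | h1 | ⟨q, h1, h2⟩
    · rcases ih (p ++ [b]) (op S b) h1 (op_N' hg b hN) (by simpa using hu) with h | ⟨h3, h4⟩ | ⟨q, rest, h3, h4⟩
      · left; rw [opf_cons]; simpa using h
      · right; left
        refine ⟨by simp, ?_⟩
        rw [opf_cons, h4, List.getLast?_cons]
        cases h5 : w.getLast? with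
        | none => simp at h5; exact absurd h5 h3
        | some a => rfl
      · right; right; exact ⟨q, rest, by simpa using h3, h4⟩
    · right; left; exact ⟨by simp, dead_head h1 w hu0⟩
    · right; right; exact ⟨q, w, by rw [← h1]; simp, h2⟩

lemma up_bound (hg : 2 ≤ g) {ε : ZMod (4*g)} (hε : Sg ε) {y : ZMod (4*g)} {q : ℕ} {rest}
    (h : N (up ε q (y+ε) ++ rest).reverse) :
    q ≤ 2*g ∧ (q = 2*g → good ε (y + 2*(g : ZMod (4*g)))) := by
  rw [List.reverse_append] at h
  have h := N_drop h
  cases q with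
  | zero => exact ⟨by omega, by omega⟩
  | succ q =>
    have hK : q + 1 ≤ K ε (up ε (q+1) (y+ε)).reverse := by
      rw [up_rev]
      have := K_dn ε q (y + ε + ((q+1 : ℕ) : ZMod (4*g))*ε) []
      rw [List.append_nil, K_one] at this
      omega
    have hK2 := N_K h hε
    refine ⟨by omega, ?_⟩
    intro hq
    rw [up_rev_cons] at h hK hK2
    have := N_good h hε (by omega)
    have hc : (q : ZMod (4*g)) + 1 = 2*g := by exact_mod_cast congrArg (Nat.cast (R := ZMod (4*g))) hq
    rw [hc, tg hε] at this
    exact this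

lemma q_eq (hg : 2 ≤ g) {ε : ZMod (4*g)} (hε : Sg ε) {q m : ℕ} (hq : q ≤ 2*g) (hm : m < 2*g)
    (h : ((q : ZMod (4*g)) - m)*ε = 0) : q = m := by
  rcases lt_trichotomy q m with h1 | h1 | h1
  · exfalso; exact zno hε (m - q) (by omega) (by omega) (by push_cast; linear_combination -h)
  · exact h1
  · exfalso; exact zno hε (q - m) (by omega) (by omega) (by push_cast; linear_combination h)

lemma sim (hg : 2 ≤ g) {y : ZMod (4*g)} {Y1 U W : List (ZMod (4*g))}
    (hY : N (y :: Y1)) (hU : N U.reverse) (hU0 : U ≠ [])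
    (hUh : U.head? ≠ some (y + 2*(g : ZMod (4*g)))) (hUl : U.getLast? ≠ some y)
    (hop : opf (y :: Y1) U = y :: W)
    (hno : ∀ ε q rest, Sg ε → U = up ε q (y+ε) ++ rest → rest.head? ≠ some (y + ((q : ZMod (4*g))+1)*ε) →
      K ε (y :: Y1) + q = 4*g-1 → q = 2*g-1 ∧ rest = []) :
    (∃ ε t, Sg ε ∧ 1 ≤ t ∧ U = (List.replicate t (up ε (2*g-1) (y+ε))).flatten) ∨
    (∃ ε W'', Sg ε ∧ W = (y+ε) :: W'' ∧ H ε W = 1 ∧ 2 ≤ H ε (y :: Y1) ∧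
      (y :: Y1).length + U.length ≤ W.length + (4*g-1)) := by
  have hhead : (opf (y :: Y1) U).head? ≠ U.getLast? := by
    rw [hop]; exact fun h => hUl h.symm
  obtain ⟨b, w, rfl⟩ := List.exists_cons_of_ne_nil hU0
  rcases step0 hg hY (b := b) (by simpa using hUh) with ⟨ε, hε, h0⟩ | hd
  swap
  · exact absurd (dead_head hd w (by simpa using hU)) hhead
  have hrun := run hg hε w [b] _ h0 (op_N' hg b hY) (by simpa using hU)
  rw [← opf_cons, List.singleton_append] at hrun
  rcases hrun with hs | ⟨h1, h2⟩ | ⟨q, rest, h1, h2⟩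
  · generalize b :: w = U at *
    rw [hop] at hs
    cases hs with
    | L q hq _ _ hp hS =>
      exfalso
      obtain ⟨q', rfl⟩ : ∃ q', q = q'+1 := ⟨q-1, by omega⟩
      apply hUl
      rw [← List.head?_reverse]
      have : (U.reverse ++ y :: Y1).head? = some y := by rw [← hS]; rfl
      rw [hp, up_rev_cons] at this ⊢
      simpa using this
    | E q r hq hr _ _ hp hT hk hi hl =>
      left
      obtain ⟨r', rfl⟩ : ∃ r', r = r'+1 := ⟨r-1, by omega⟩
      obtain ⟨S', hS, hH, hT'⟩ := hT
      obtain ⟨e1, -⟩ := List.cons.inj hS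
      have hb := up_bound hg hε (rest := []) (by rw [List.append_nil, ← hp]; exact hU)
      have : q = 2*g-1 := by
        apply q_eq hg hε hb.1 (by omega)
        rw [c21 hg]; unfold B at e1; linear_combination -e1
      refine ⟨ε, 1, hε, le_rfl, ?_⟩
      rw [hp, this]; simp
    | M q σ k hk1 hk2 _ _ S' hp hS hH hi hl =>
      exfalso
      obtain ⟨k', rfl⟩ : ∃ k', k = k'+1 := ⟨k-1, by omega⟩
      obtain ⟨e1, -⟩ := List.cons.inj hS
      apply hUl
      rw [← List.head?_reverse, hp, F_rev, List.head?_cons]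
      push_cast at e1
      exact congrArg some e1.symm
    | G q σ _ _ hp hT hi hl =>
      left
      obtain ⟨S', hS, hH, hT'⟩ := TR_mono hT (show 1 ≤ 2*g-1 by omega)
      obtain ⟨e1, -⟩ := List.cons.inj hS
      have hb := up_bound hg hε (rest := (List.replicate σ (up ε (2*g-1) (B ε y q + ε))).flatten
        ++ up ε (2*g-1) (B ε y q + ε)) (q := q) (y := y) (by rw [← List.append_assoc]; rw [hp] at hU; exact hU)
      have hq : q = 2*g-1 := by
        apply q_eq hg hε hb.1 (by omega)
        rw [c21 hg]; unfold B at e1; linear_combination -e1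
      refine ⟨ε, σ+2, hε, by omega, ?_⟩
      rw [hp]; unfold F; rw [← e1, hq]
      rw [List.replicate_succ, List.replicate_succ', List.flatten_cons, List.flatten_append]
      simp
    | E2 q σ _ _ hp hT hi hl =>
      right
      obtain ⟨S', hS, hH, S'', hS', hH', -⟩ := hT
      obtain ⟨e1, e2⟩ := List.cons.inj hS
      have hb := up_bound hg hε (rest := (List.replicate σ (up ε (2*g-1) (B ε y q + ε))).flatten
        ++ up ε (2*g) (B ε y q + ε)) (q := q) (y := y) (by rw [← List.append_assoc]; rw [hp] at hU; exact hU)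
      have hq : q = 2*g-2 := by
        apply q_eq hg hε hb.1 (by omega)
        rw [c22 hg]; unfold B at e1; linear_combination -e1
      rw [← e2, ← e1] at hS'
      rw [← e2] at hH'
      refine ⟨ε, S'', hε, hS', hH', by omega, ?_⟩
      simp only [List.length_cons] at *; omega
  · exfalso
    apply hhead; rw [h2, List.getLast?_cons]
    cases h5 : w.getLast? with
    | none => simp at h5; exact absurd h5 h1
    | some a => rfl
  · generalize b :: w = U at *
    left
    have hb := up_bound hg hε (h1 ▸ hU)
    have hK := N_K hY hε
    have hboth : ¬ (K ε (y :: Y1) = 2*g ∧ good ε (y + 2*(g : ZMod (4*g)))) := by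
      rintro ⟨h3, h4⟩
      exact (good_inv hg hε y).1 (N_good hY hε h3) h4
    have hsum : K ε (y :: Y1) + q = 4*g-1 := by
      by_contra hne
      exact hboth ⟨by omega, hb.2 (by omega)⟩
    have hnh : rest.head? ≠ some (y + ((q : ZMod (4*g))+1)*ε) := by
      intro hh
      obtain ⟨rest', rfl⟩ : ∃ rest', rest = (y + ((q : ZMod (4*g))+1)*ε) :: rest' := by
        cases rest with
        | nil => simp at hh
        | cons a r => exact ⟨r, by simpa using hh⟩
      have h3 : U = up ε (q+1) (y+ε) ++ rest' := by
        rw [h1, ← up_snoc ε y q rfl]; simp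
      have hb' := up_bound hg hε (h3 ▸ hU)
      exact hboth ⟨by omega, hb'.2 (by omega)⟩
    obtain ⟨h3, h4⟩ := hno ε q rest hε h1 hnh hsum
    refine ⟨ε, 1, hε, le_rfl, ?_⟩
    rw [h1, h3, h4]; simp

/-- Finishing case (b). -/
lemma fin_b (hg : 2 ≤ g) {ε y : ZMod (4*g)} (hε : Sg ε) {Xt W'' : List (ZMod (4*g))}
    (hN : N (y :: (Xt.map (· + 2*(g : ZMod (4*g))))))
    (hX : N (Xt.reverse ++ [y + 2*(g : ZMod (4*g))]))
    (hW : N ((y+ε) :: W'')) (hH : H ε ((y+ε) :: W'') = 1)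
    (h2 : 2 ≤ H ε (y :: (Xt.map (· + 2*(g : ZMod (4*g)))))) :
    N (Xt.reverse ++ (y+ε) :: W'') := by
  cases Xt with
  | nil => simpa using hW
  | cons x Xt =>
    rw [List.map_cons, H_cons] at h2
    have hx : x = y - ε + 2*(g : ZMod (4*g)) ∨ x = y - 2*ε := by
      split_ifs at h2 with c1 c2
      · left; rw [c1]; grind [four (g := g), tg hε]
      · right; rw [c2.1]; grind [four (g := g), tg hε]
      · omega
    have hX' : N (Xt.reverse ++ x :: [y + 2*(g : ZMod (4*g))]) := by simpa using hX
    have hd : Dead [y + 2*(g : ZMod (4*g))] ((y+ε) :: W'') x := by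
      have m1 : x ≠ y + ε + -ε := by
        intro h
        rcases hx with hx | hx
        · exact zno hε (2*g-1) (by omega) (by omega) (by push_cast; linear_combination h - hx + tg hε)
        · exact zno hε 2 (by omega) (by omega) (by push_cast; linear_combination hx - h)
      apply dead_step hg hε hW
      · simp only [List.head?_cons, Option.mem_some_iff]
        rintro a rfl h
        rcases hx with hx | hx
        · exact zno hε 2 (by omega) (by omega) (by push_cast; linear_combination hx - h)
        · exact zno hε (2*g+3) (by omega) (by omega) (by push_cast; linear_combination hx - h + tg hε)
      · apply Ok_one hg
        apply H_eq_one
        · intro h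
          rcases hx with hx | hx
          · exact zno hε (2*g-3) (by omega) (by omega) (by push_cast; linear_combination h - hx + tg hε)
          · exact zno hε 4 (by omega) (by omega) (by push_cast; linear_combination hx - h)
        · intro _; omega
      · rcases hx with hx | hx
        · have a1 := H_le_two (-ε) x (y+ε) W'' m1
          have a2 := K_eq_one (-ε) x (y+ε) W'' m1
          have a3 : H (-ε) [x, y + 2*(g : ZMod (4*g))] = 2 := by
            have : x = y + 2*(g : ZMod (4*g)) + -ε := by rw [hx]; ring
            rw [this, H_step, H_one]
          have a4 := K_pos (-ε) x [y + 2*(g : ZMod (4*g))]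
          exact ⟨by omega, by omega, by omega, Or.inl (by omega)⟩
        · apply Ok_one hg
          apply H_eq_one _ _ _ _ m1
          intro h
          exfalso
          exact zno hε (2*g+1) (by omega) (by omega) (by push_cast; linear_combination hx - h)
    have := (hd Xt hX').1
    simpa using this

end SGP


namespace SGP
variable {g : ℕ}

lemma rot_up (hg : 2 ≤ g) (ε a : ZMod (4*g)) (n : ℕ) :
    (up ε (4*g) a).rotate n = up ε (4*g) (a + (n : ZMod (4*g))*ε) := by
  induction n generalizing a with
  | zero => simp
  | succ n ih =>
    have h1 : (up ε (4*g) a).rotate 1 = up ε (4*g) (a + ε) := by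
      rw [up_succ' ε (4*g) (4*g-1) a (by omega), List.rotate_cons_succ, List.rotate_zero,
        up_last' ε (4*g) (4*g-1) (a+ε) (by omega)]
      congr 2
      have : ((4*g-1 : ℕ) : ZMod (4*g)) = -1 := by
        rw [Nat.cast_sub (by omega)]; push_cast; rw [four]; ring
      rw [this]; ring
    rw [add_comm n 1, ← List.rotate_rotate, h1, ih]
    congr 1; push_cast; ring

lemma RSet_iff (hg : 2 ≤ g) (W : SG.Word g) :
    W ∈ SG.RSet g ↔ ∃ ε a, Sg ε ∧ W.map phi = up ε (4*g) a := by
  have hinv : ∃ c, (SG.wordInv g (SG.Rword g)).map phi = up (-1) (4*g) c := by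
    have h := st_wordInv_eq (SG.Rword g)
    rw [Rword_phi] at h
    have h2 : (SG.wordInv g (SG.Rword g)).map phi = (st (SG.wordInv g (SG.Rword g))).reverse := by
      simp [st]
    rw [h2, h, up_inv]
    exact ⟨_, rfl⟩
  obtain ⟨c, hc⟩ := hinv
  haveI : NeZero (4*g) := ⟨by omega⟩
  unfold SG.RSet
  simp only [Set.mem_setOf_eq]
  constructor
  · rintro (⟨n, h⟩ | ⟨n, h⟩)
    · refine ⟨1, 0 + (n : ZMod (4*g))*1, Or.inl rfl, ?_⟩
      rw [← h, List.map_rotate, Rword_phi, rot_up hg]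
    · refine ⟨-1, c + (n : ZMod (4*g))*(-1), Or.inr rfl, ?_⟩
      rw [← h, List.map_rotate, hc, rot_up hg]
  · rintro ⟨ε, a, rfl | rfl, h⟩
    · left
      refine ⟨a.val, List.map_injective_iff.2 (phi_inj hg) ?_⟩
      rw [List.map_rotate, Rword_phi, rot_up hg, h, ZMod.natCast_zmod_val]; congr 1; ring
    · right
      refine ⟨(c-a).val, List.map_injective_iff.2 (phi_inj hg) ?_⟩
      rw [List.map_rotate, hc, rot_up hg, h, ZMod.natCast_zmod_val]; congr 1; ring

lemma IsFR_iff (hg : 2 ≤ g) (k : ℕ) (W : SG.Word g) :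
    SG.IsFR g k W ↔ 2 ≤ k ∧ k ≤ 4*g ∧ ∃ ε a, Sg ε ∧ W.map phi = up ε k a := by
  unfold SG.IsFR
  have htake : ∀ (ε a : ZMod (4*g)), k ≤ 4*g → (up ε (4*g) a).take k = up ε k a := by
    intro ε a hk
    rw [up_add' ε (4*g) k (4*g-k) a (by omega), List.take_left' (up_len _ _ _)]
  constructor
  · rintro ⟨h1, h2, V, hV, rfl⟩
    obtain ⟨ε, a, hε, h⟩ := (RSet_iff hg V).1 hV
    exact ⟨h1, h2, ε, a, hε, by rw [List.map_take, h, htake ε a h2]⟩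
  · rintro ⟨h1, h2, ε, a, hε, h⟩
    obtain ⟨V, hV⟩ := List.map_surjective_iff.2 (phi_surj hg) (up ε (4*g) a)
    refine ⟨h1, h2, V, (RSet_iff hg V).2 ⟨ε, a, hε, hV⟩, ?_⟩
    apply List.map_injective_iff.2 (phi_inj hg)
    rw [h, List.map_take, hV, htake ε a h2]

lemma llfr (hg : 2 ≤ g) {ε : ZMod (4*g)} (hε : Sg ε) (V : SG.Word g) (P Q : List (ZMod (4*g))) (c : ZMod (4*g))
    (hV : V.map phi = P ++ up ε (4*g-1) c ++ Q)
    (hP : P.getLast? ≠ some (c - ε)) (hQ : Q.head? ≠ some (c + ((4*g-1 : ℕ) : ZMod (4*g))*ε)) :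
    SG.HasLLFR g (4*g-1) V := by
  obtain ⟨V1, Q', rfl, h1, rfl⟩ := List.map_eq_append_iff.1 hV
  obtain ⟨P', F', rfl, rfl, hF⟩ := List.map_eq_append_iff.1 h1
  refine ⟨P', F', Q', rfl, (IsFR_iff hg _ _).2 ⟨by omega, by omega, ε, c, hε, hF⟩, ?_, ?_⟩
  · intro a ha hfr
    obtain ⟨-, -, η, d, hη, h⟩ := (IsFR_iff hg _ _).1 hfr
    apply hP
    rw [List.getLast?_map, ha]
    rw [List.map_cons, hF, up_succ] at h
    obtain ⟨e1, e2⟩ := List.cons.inj h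
    rw [up_succ' ε _ (4*g-2) c (by omega), up_succ' η _ (4*g-2) (d+η) (by omega)] at e2
    obtain ⟨e3, e4⟩ := List.cons.inj e2
    rw [up_succ' ε _ (4*g-3) (c+ε) (by omega), up_succ' η _ (4*g-3) (d+η+η) (by omega)] at e4
    obtain ⟨e5, -⟩ := List.cons.inj e4
    simp only [Option.map_some]
    congr 1
    linear_combination e1 - 2*e3 + e5
  · intro a ha hfr
    obtain ⟨-, -, η, d, hη, h⟩ := (IsFR_iff hg _ _).1 hfr
    apply hQ
    rw [List.head?_map, ha]
    rw [List.map_append, hF, up_last] at h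
    obtain ⟨e1, e2⟩ := List.append_inj h (by simp [up_len])
    rw [up_succ' ε _ (4*g-2) c (by omega), up_succ' η _ (4*g-2) d (by omega)] at e1
    obtain ⟨e3, e4⟩ := List.cons.inj e1
    rw [up_succ' ε _ (4*g-3) (c+ε) (by omega), up_succ' η _ (4*g-3) (d+η) (by omega)] at e4
    obtain ⟨e5, -⟩ := List.cons.inj e4
    have : η = ε := by linear_combination e3 - e5
    subst this
    simp only [List.map_cons, List.map_nil, List.cons.injEq, and_true] at e2
    simp only [Option.map_some]
    rw [e2, e3]

lemma peelmax (ε : ZMod (4*g)) (S : List (ZMod (4*g))) : ∀ z : ZMod (4*g),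
    ∃ P, z :: S = dn ε (K ε (z :: S)) (z + ε) ++ P ∧
      P.head? ≠ some (z - ((K ε (z :: S) : ℕ) : ZMod (4*g))*ε) := by
  induction S with
  | nil =>
    intro z
    exact ⟨[], by rw [K_one]; simp [dn], by simp⟩
  | cons a S ih =>
    intro z
    by_cases h : z = a + ε
    · obtain ⟨P, h1, h2⟩ := ih a
      refine ⟨P, ?_, ?_⟩
      · rw [h, K_step, dn_succ, List.cons_append, add_sub_cancel_right, ← h1]
      · rw [h, K_step]
        have e : a + ε - ((K ε (a :: S) + 1 : ℕ) : ZMod (4*g))*ε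
            = a - ((K ε (a :: S) : ℕ) : ZMod (4*g))*ε := by push_cast; ring
        rw [e]; exact h2
    · refine ⟨a :: S, ?_, ?_⟩
      · rw [K_eq_one _ _ _ _ h]; simp [dn]
      · rw [K_eq_one _ _ _ _ h]
        intro h2; apply h
        simp only [List.head?_cons, Option.some.injEq] at h2
        rw [h2]; push_cast; ring

lemma fr_append (A C : SG.Word g) : SG.FreelyReduced g (A ++ C) ↔
    SG.FreelyReduced g A ∧ SG.FreelyReduced g C ∧
      ∀ a ∈ A.getLast?, ∀ c ∈ C.head?, c ≠ SG.invLetter g a := by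
  unfold SG.FreelyReduced
  exact List.isChain_append

lemma inv_iff (hg : 2 ≤ g) (a c : SG.Letter g) : c = SG.invLetter g a ↔ phi c = phi a + 2*(g : ZMod (4*g)) := by
  rw [← phi_inv]; exact ⟨fun h => by rw [h], fun h => phi_inj hg h⟩

lemma st_snoc (W : SG.Word g) (a : SG.Letter g) : st (W ++ [a]) = phi a :: st W := by
  rw [st_append]; rfl

lemma irr_fr (hg : 2 ≤ g) (W : SG.Word g) (h : N (st W)) : SG.FreelyReduced g W := by
  induction W using List.reverseRecOn with
  | nil => exact List.isChain_nil
  | append_singleton W a ih =>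
    rw [st_snoc] at h
    rw [fr_append]
    refine ⟨ih (N_tail h), List.isChain_singleton _, ?_⟩
    intro c hc d hd hcd
    simp only [List.head?_cons, Option.mem_some_iff] at hd
    subst hd
    obtain ⟨W', rfl⟩ : ∃ W', W = W' ++ [c] := by
      simp only [Option.mem_def, List.getLast?_eq_some_iff] at hc
      exact hc
    rw [st_snoc] at h
    exact N_red h ((inv_iff hg c a).1 hcd)

lemma rs_exists (X V : SG.Word g)
    (hB : ∀ B : SG.Word g, B ≠ [] → B <:+ V → ¬ B <:+ SG.nf g (SG.eval g (X ++ V))) :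
    ∃ X' A, X = A ++ X' ∧ SG.IsRS g X V X' V := by
  classical
  have hcand : ∀ D₁ D₂, SG.IsRSCand g X V D₁ D₂ → D₂ = V := by
    rintro D₁ D₂ ⟨A, B, C', h1, h2, h3⟩
    by_cases hb : B = []
    · subst hb; simpa using h2.symm
    · exact absurd ⟨A ++ C', h3.symm⟩ (hB B hb ⟨D₂, h2.symm⟩)
  have hex : ∃ n, ∃ D₁, D₁.length = n ∧ SG.IsRSCand g X V D₁ V :=
    ⟨_, X, rfl, [], [], _, by simp, by simp, (by simp : _ = [] ++ SG.nf g (SG.eval g (X ++ V)) ++ [])⟩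
  obtain ⟨X', hl, hX'⟩ := Nat.find_spec hex
  have hX'0 := hX'
  obtain ⟨A, B, C', h1, h2, h3⟩ := hX'0
  refine ⟨X', A, h1, hX', ?_⟩
  intro D₁ D₂ hD
  have hD2 := hcand _ _ hD
  subst hD2
  have hmin := Nat.find_min' hex ⟨D₁, rfl, hD⟩
  rcases Nat.lt_or_ge X'.length D₁.length with h | h
  · right; left; left; exact h
  · left
    obtain ⟨A2, B2, C2, h4, -, -⟩ := hD
    refine ⟨?_, rfl⟩
    exact (List.append_inj' (h1.symm.trans h4) (by omega)).2

end SGP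


namespace SGP
variable {g : ℕ}

lemma seg_phi (hg : 2 ≤ g) (ε y : ZMod (4*g)) (i k : ℕ) :
    (SG.seg g (fun i => psi hg (y + ((i : ZMod (4*g)) - 1)*ε)) i k).map phi
      = up ε k (y + ((i : ZMod (4*g)) - 1)*ε) := by
  unfold SG.seg
  induction k with
  | zero => rfl
  | succ k ih =>
    rw [List.range_succ, List.map_append, List.map_append, ih, up_last]
    simp only [List.map_cons, List.map_nil, phi_psi]
    congr 2; push_cast; ring

lemma hno_of (hg : 2 ≤ g) {x₁ : SG.Letter g} {Xt U : SG.Word g}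
    (hno : ¬ SG.HasLLFR g (4*g-1) (SG.wordInv g (x₁ :: Xt) ++ U ++ (x₁ :: Xt)))
    (hY : N (st (SG.wordInv g (x₁ :: Xt)))) (hU : N (st U))
    (y : ZMod (4*g)) (hy : y = phi x₁ + 2*(g : ZMod (4*g))) (ε : ZMod (4*g)) (q : ℕ) (rest) (hε : Sg ε)
    (h1 : U.map phi = up ε q (y+ε) ++ rest) (h2 : rest.head? ≠ some (y + ((q : ZMod (4*g))+1)*ε))
    (h3 : K ε (y :: st (SG.wordInv g Xt)) + q = 4*g-1) : q = 2*g-1 ∧ rest = [] := by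
  by_contra hcon
  apply hno
  obtain ⟨P, p1, p2⟩ := peelmax ε (st (SG.wordInv g Xt)) y
  have hst := st_wordInv_cons x₁ Xt
  rw [← hy] at hst
  set k := K ε (y :: st (SG.wordInv g Xt)) with hk
  have hkc : ((4*g-1 : ℕ) : ZMod (4*g)) = k + q := by rw [← h3]; push_cast; rfl
  have hb := up_bound hg hε (rest := rest) (q := q) (y := y) (by rw [← h1]; exact hU)
  have hrev : (SG.wordInv g (x₁ :: Xt)).map phi = P.reverse ++ up ε k (y + ε - k*ε) := by
    have e1 : (SG.wordInv g (x₁ :: Xt)).map phi = (st (SG.wordInv g (x₁ :: Xt))).reverse := by simp [st]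
    have e2 := up_rev ε k (y + ε - k*ε)
    rw [sub_add_cancel] at e2
    rw [e1, hst, p1, ← e2, List.reverse_append, List.reverse_reverse]
  apply llfr hg hε _ P.reverse (rest ++ (x₁ :: Xt).map phi) (y + ε - k*ε)
  · rw [List.map_append, List.map_append, hrev, h1, up_add' ε (4*g-1) k q _ h3.symm, sub_add_cancel]
    simp
  · rw [List.getLast?_reverse]
    intro h; apply p2; rw [h]; congr 1; ring
  · rw [hkc]
    have e : y + ε - (k : ZMod (4*g))*ε + ((k : ZMod (4*g)) + q)*ε = y + ((q : ZMod (4*g))+1)*ε := by ring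
    rw [e]
    cases rest with
    | cons a r => simpa using h2
    | nil =>
      simp only [List.nil_append, List.map_cons, List.head?_cons, ne_eq, Option.some.injEq]
      intro h
      apply hcon
      refine ⟨?_, rfl⟩
      apply q_eq hg hε hb.1 (by omega)
      rw [c21 hg]
      have := two_g_add (phi x₁)
      rw [← hy] at this
      grind [four (g := g), tg hε]

end SGP

open SGP


/-- If `X⁻¹UX` is freely reduced with no `(4g−1)`-LLFR and
`nf(X⁻¹U)·X` is not freely reduced, then `rs(X⁻¹,U) = (X′,U)` with `X′` a suffix
of `X⁻¹` and `nf(X⁻¹U) = W x₁⁻¹`; moreover either (a) `X⁻¹` ends with `b₁` and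
`U = (b₂⋯b_{2g})^t`, or (b) `W x₂⋯x_n` is irreducible (hence is the normal form
of `X⁻¹UX`) and `2n + |U| − |W x₂⋯x_n| ≤ 4g + 2`. -/
theorem conjugate_reduction_not_freely_reduced (g : ℕ) (hg : 2 ≤ g)
    (x₁ : SG.Letter g) (Xt U : SG.Word g)
    (hX : SG.IrreducibleWord g (x₁ :: Xt)) (hU : SG.IrreducibleWord g U)
    (hfr : SG.FreelyReduced g (SG.wordInv g (x₁ :: Xt) ++ U ++ (x₁ :: Xt)))
    (hno : ¬ SG.HasLLFR g (4*g-1) (SG.wordInv g (x₁ :: Xt) ++ U ++ (x₁ :: Xt)))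
    (hnfr : ¬ SG.FreelyReduced g
      (SG.nf g (SG.eval g (SG.wordInv g (x₁ :: Xt) ++ U)) ++ (x₁ :: Xt))) :
    (∃ X' A : SG.Word g, SG.wordInv g (x₁ :: Xt) = A ++ X' ∧
        SG.IsRS g (SG.wordInv g (x₁ :: Xt)) U X' U) ∧
    ∃ W : SG.Word g, SG.IrreducibleWord g W ∧
      SG.nf g (SG.eval g (SG.wordInv g (x₁ :: Xt) ++ U)) = W ++ [SG.invLetter g x₁] ∧
      ((∃ b : ℕ → SG.Letter g, SG.RelSeq g b ∧
          (SG.wordInv g (x₁ :: Xt)).getLast? = some (b 1) ∧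
          ∃ t : ℕ, 1 ≤ t ∧ U = SG.wpow g (SG.seg g b 2 (2*g-1)) t) ∨
       (SG.IrreducibleWord g (W ++ Xt) ∧
        SG.nf g (SG.eval g (SG.wordInv g (x₁ :: Xt) ++ U ++ (x₁ :: Xt))) = W ++ Xt ∧
        2*(Xt.length + 1) + U.length - (W ++ Xt).length ≤ 4*g + 2)) := by
  have hY : N (st (SG.wordInv g (x₁ :: Xt))) := irr_inv hg _ hX
  have hUN : N (st U) := (irr_iff hg U).1 hU
  have hXN : N (st (x₁ :: Xt)) := (irr_iff hg _).1 hX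
  obtain ⟨hT, hTe⟩ := nf_spec hg (SG.wordInv g (x₁ :: Xt) ++ U)
  set T := SG.nf g (SG.eval g (SG.wordInv g (x₁ :: Xt) ++ U)) with hTdef
  have hTN : N (st T) := (irr_iff hg T).1 hT
  have hst := st_wordInv_cons x₁ Xt
  have hwl : SG.wordInv g (x₁ :: Xt) = SG.wordInv g Xt ++ [SG.invLetter g x₁] := by
    simp [SG.wordInv]
  have hyy : phi x₁ + 2*(g : ZMod (4*g)) = phi (SG.invLetter g x₁) := (phi_inv x₁).symm
  -- the normal form ends with the inverse of the first letter of `X`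
  have hTl : T.getLast? = some (SG.invLetter g x₁) := by
    by_contra hne
    apply hnfr
    rw [fr_append]
    refine ⟨irr_fr hg T hTN, irr_fr hg _ hXN, ?_⟩
    intro a ha c hc hca
    apply hne
    simp only [List.head?_cons, Option.mem_some_iff] at hc
    subst hc
    rw [Option.mem_def.1 ha]
    congr 1
    rw [hca]; simp [SG.invLetter]
  obtain ⟨W, hW⟩ : ∃ W, T = W ++ [SG.invLetter g x₁] := by
    rwa [List.getLast?_eq_some_iff] at hTl
  have hstT : st T = (phi x₁ + 2*(g : ZMod (4*g))) :: st W := by rw [hW, st_snoc, hyy]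
  have hWN : N (st W) := N_tail (hstT ▸ hTN)
  rw [fr_append, fr_append] at hfr
  obtain ⟨⟨-, -, hf1⟩, -, hf2⟩ := hfr
  have hU0 : U ≠ [] := by
    rintro rfl
    exact hf2 (SG.invLetter g x₁) (by rw [hwl]; simp) x₁ (by simp) (by simp [SG.invLetter])
  have hUl : U.getLast? ≠ some (SG.invLetter g x₁) := by
    intro h
    refine hf2 (SG.invLetter g x₁) ?_ x₁ (by simp) (by simp [SG.invLetter])
    rw [List.getLast?_append, h]; rfl
  have hUh : U.head? ≠ some x₁ := by
    intro h
    exact hf1 (SG.invLetter g x₁) (by rw [hwl]; simp) x₁ h (by simp [SG.invLetter])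
  refine ⟨?_, W, (irr_iff hg W).2 hWN, hW, ?_⟩
  · obtain ⟨X', A, h1, h2⟩ := rs_exists (SG.wordInv g (x₁ :: Xt)) U (by
      rintro B hB ⟨A1, hA1⟩ ⟨A2, hA2⟩
      apply hUl
      rw [← hTdef] at hA2
      rw [← hA2, List.getLast?_append_of_ne_nil _ hB] at hTl
      rw [← hA1, List.getLast?_append_of_ne_nil _ hB, hTl])
    exact ⟨X', A, h1, h2⟩
  · have hop := opf_st hg hY U hTN hTe.symm
    rw [hst, hstT] at hop
    rw [hst] at hY
    have hinv2 : phi x₁ + 2*(g : ZMod (4*g)) + 2*(g : ZMod (4*g)) = phi x₁ := two_g_add _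
    have hs := sim hg hY hUN (by simpa using hU0)
      (by
        rw [hinv2, List.head?_map]
        intro h
        obtain ⟨a, h1, h2⟩ := Option.map_eq_some_iff.1 h
        exact hUh (by rw [h1, phi_inj hg h2]))
      (by
        rw [hyy, List.getLast?_map]
        intro h
        obtain ⟨a, h1, h2⟩ := Option.map_eq_some_iff.1 h
        exact hUl (by rw [h1, phi_inj hg h2]))
      hop
      (fun ε q rest hε h1 h2 h3 => hno_of hg hno (hst ▸ hY) hUN _ rfl ε q rest hε h1 h2 h3)
    rcases hs with ⟨ε, t, hε, ht, hUt⟩ | ⟨ε, W'', hε, hW1, hW2, hH2, hlen⟩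
    · left
      refine ⟨fun i => psi hg (phi x₁ + 2*(g : ZMod (4*g)) + ((i : ZMod (4*g)) - 1)*ε), ⟨?_, ?_⟩, ?_, t, ht, ?_⟩
      · intro i
        apply phi_inj hg
        rw [phi_psi, phi_psi]
        push_cast
        rw [four]; ring
      · rw [RSet_iff hg]
        exact ⟨ε, _, hε, seg_phi hg _ _ _ _⟩
      · rw [hwl, List.getLast?_append]
        simp only [List.getLast?_singleton, Option.some_or]
        congr 1
        apply phi_inj hg
        rw [phi_psi, ← hyy]; push_cast; ring
      · apply List.map_injective_iff.2 (phi_inj hg)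
        rw [hUt]
        unfold SG.wpow
        rw [List.map_flatten, List.map_replicate, seg_phi hg]
        congr 3; push_cast; ring
    · right
      have hNW : SG.IrreducibleWord g (W ++ Xt) := by
        rw [irr_iff hg, st_append, hW1]
        rw [st_wordInv_eq] at hY hH2
        refine fin_b hg hε hY ?_ (hW1 ▸ hWN) (hW1 ▸ hW2) hH2
        rw [hinv2]
        have : st (x₁ :: Xt) = (Xt.map phi).reverse ++ [phi x₁] := by simp [st]
        rw [← this]; exact hXN
      refine ⟨hNW, ?_, ?_⟩
      · apply nf_eq hg hNW
        have e1 : SG.eval g (SG.wordInv g (x₁ :: Xt) ++ U) = SG.eval g W * (SG.evalLetter g x₁)⁻¹ := by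
          rw [← hTe, hW, eval_append]
          simp [SG.eval, evalLetter_inv]
        rw [eval_append (SG.wordInv g (x₁ :: Xt) ++ U), e1, eval_append]
        simp [SG.eval]
      · simp only [List.length_cons, List.length_append, List.length_map, st_len, wordInv_len] at *
        omega
end

section
/- Let U = (b₁⋯b_{2g−1})^t for some b₁⋯b_{4g} ∈ 𝓡 and t ≥ 1, and let X be an irreducible word such that the word X⁻¹UX is freely reduced. If the word X⁻¹U or the word UX contains a (4g−1)-LLFR, then there exists an irreducible word Y such that: (a) the words X⁻¹UX and Y⁻¹UY represent the same element of G; (b) the word Y⁻¹UY is freely reduced; (c) neither the word Y⁻¹U nor the word UY contains a (4g−1)-LLFR. -/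
namespace SG

variable {g : ℕ}

theorem eval_nil : eval g [] = 1 := rfl

theorem eval_append (A B : Word g) : eval g (A ++ B) = eval g A * eval g B := by
  simp [eval]

theorem eval_cons (a : Letter g) (B : Word g) : eval g (a :: B) = evalLetter g a * eval g B := by
  simp [eval]

theorem evalLetter_inv (a : Letter g) : evalLetter g (invLetter g a) = (evalLetter g a)⁻¹ := by
  rcases a with ⟨i, _ | _⟩ <;> simp [evalLetter, invLetter]

theorem invLetter_inv (a : Letter g) : invLetter g (invLetter g a) = a := by
  simp [invLetter]

theorem wordInv_nil : wordInv g [] = [] := rfl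

theorem wordInv_cons (a : Letter g) (W : Word g) :
    wordInv g (a :: W) = wordInv g W ++ [invLetter g a] := by
  simp [wordInv]

theorem wordInv_append (A B : Word g) : wordInv g (A ++ B) = wordInv g B ++ wordInv g A := by
  simp [wordInv]

theorem wordInv_length (A : Word g) : (wordInv g A).length = A.length := by
  simp [wordInv]

theorem wordInv_wordInv (A : Word g) : wordInv g (wordInv g A) = A := by
  have : invLetter g ∘ invLetter g = id := by
    funext a; exact invLetter_inv a
  simp [wordInv, this]

theorem eval_wordInv (A : Word g) : eval g (wordInv g A) = (eval g A)⁻¹ := by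
  induction A with
  | nil => simp [wordInv, eval]
  | cons a A ih =>
    rw [wordInv_cons, eval_append, eval_cons, ih, eval_cons, evalLetter_inv, eval_nil]
    simp

theorem wpow_succ (W : Word g) (t : ℕ) : wpow g W (t+1) = W ++ wpow g W t := by
  simp [wpow, List.replicate_succ]

theorem wpow_succ_right (W : Word g) (t : ℕ) : wpow g W (t+1) = wpow g W t ++ W := by
  simp [wpow, List.replicate_succ']

theorem eval_wpow (W : Word g) (t : ℕ) : eval g (wpow g W t) = eval g W ^ t := by
  induction t with
  | zero => simp [wpow, eval]
  | succ t ih => rw [wpow_succ, eval_append, ih, pow_succ']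

theorem wordInv_wpow (W : Word g) (t : ℕ) : wordInv g (wpow g W t) = wpow g (wordInv g W) t := by
  induction t with
  | zero => simp [wpow, wordInv]
  | succ t ih => rw [wpow_succ, wordInv_append, ih, wpow_succ_right]

/-- The cyclic position of a letter in `R`. -/
def pos (a : Letter g) : ZMod (4*g) := (a.1 : ℕ) + if a.2 then 0 else ((2*g : ℕ) : ZMod (4*g))

theorem two_two : ((2*g : ℕ) : ZMod (4*g)) + ((2*g : ℕ) : ZMod (4*g)) = 0 := by
  rw [← Nat.cast_add, show 2*g+2*g = 4*g by ring]; simp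

theorem pos_inv (a : Letter g) : pos (invLetter g a) = pos a + ((2*g : ℕ) : ZMod (4*g)) := by
  rcases a with ⟨i, _ | _⟩
  · simp only [pos, invLetter, Bool.not_false, if_true]
    rw [if_neg (by simp), add_assoc, two_two]
  · simp [pos, invLetter]

theorem pos_inj {a c : Letter g} (h : pos a = pos c) : a = c := by
  obtain ⟨⟨i, hi⟩, x⟩ := a
  obtain ⟨⟨j, hj⟩, y⟩ := c
  have key : ∀ m n : ℕ, m < 4*g → n < 4*g → (m : ZMod (4*g)) = (n : ZMod (4*g)) → m = n := by
    intro m n hm hn h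
    rw [ZMod.natCast_eq_natCast_iff'] at h
    rwa [Nat.mod_eq_of_lt hm, Nat.mod_eq_of_lt hn] at h
  rcases x with _ | _ <;> rcases y with _ | _ <;> simp only [pos] at h
  · simp only [Bool.false_eq_true, if_false, ← Nat.cast_add] at h
    have := key _ _ (by omega) (by omega) h
    simp; omega
  · simp only [Bool.false_eq_true, if_false, if_true, add_zero, ← Nat.cast_add] at h
    have := key _ _ (by omega) (by omega) h
    omega
  · simp only [Bool.false_eq_true, if_false, if_true, add_zero, ← Nat.cast_add] at h
    have := key _ _ (by omega) (by omega) h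
    omega
  · simp only [if_true, add_zero] at h
    have := key _ _ (by omega) (by omega) h
    simp; omega

theorem Rword_length : (Rword g).length = 4*g := by
  simp [Rword]; omega

theorem Rword_pos (k : ℕ) (h : k < (Rword g).length) : pos ((Rword g)[k]) = (k : ZMod (4*g)) := by
  have h' := h
  rw [Rword_length] at h'
  simp only [Rword, List.getElem_append, List.length_ofFn, List.getElem_ofFn]
  split_ifs with h1
  · simp [pos]
  · simp only [pos, Bool.false_eq_true, if_false, ← Nat.cast_add]
    congr 1; omega

theorem eval_Rword : eval g (Rword g) = 1 := by
  have h : (PresentedGroup.mk ({relator g} : Set (FreeGroup (Fin (2*g))))) (relator g) = 1 :=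
    PresentedGroup.one_of_mem (by simp)
  refine Eq.trans ?_ h
  rw [Rword, eval_append]
  show _ = PresentedGroup.mk _ ((List.ofFn fun i : Fin (2*g) => FreeGroup.of i).prod *
    (List.ofFn fun i : Fin (2*g) => (FreeGroup.of i)⁻¹).prod)
  rw [map_mul]
  congr 1
  · rw [map_list_prod, eval, List.map_ofFn, List.map_ofFn]; rfl
  · rw [map_list_prod, eval, List.map_ofFn, List.map_ofFn]; rfl

theorem eval_rotated {A B : Word g} (h : List.IsRotated A B) (hA : eval g A = 1) :
    eval g B = 1 := by
  obtain ⟨n, hn, rfl⟩ := List.isRotated_iff_mod.1 h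
  rw [List.rotate_eq_drop_append_take hn, eval_append]
  rw [← List.take_append_drop n A, eval_append] at hA
  exact mul_eq_one_comm.1 hA

theorem RSet_length {B : Word g} (h : B ∈ RSet g) : B.length = 4*g := by
  rcases h with h | h
  · rw [← h.perm.length_eq, Rword_length]
  · rw [← h.perm.length_eq, wordInv_length, Rword_length]

theorem RSet_eval {B : Word g} (h : B ∈ RSet g) : eval g B = 1 := by
  rcases h with h | h
  · exact eval_rotated h eval_Rword
  · exact eval_rotated h (by rw [eval_wordInv, eval_Rword, inv_one])

theorem RSet_rot {A B : Word g} (h : A ∈ RSet g) (hr : List.IsRotated A B) : B ∈ RSet g := by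
  rcases h with h | h
  · exact Or.inl (h.trans hr)
  · exact Or.inr (h.trans hr)

theorem RSet_inv {A : Word g} (h : A ∈ RSet g) : wordInv g A ∈ RSet g := by
  have key : ∀ A B : Word g, List.IsRotated A B → List.IsRotated (wordInv g A) (wordInv g B) :=
    fun A B h => (h.map _).reverse
  rcases h with h | h
  · exact Or.inr (key _ _ h)
  · left
    have := key _ _ h
    rwa [wordInv_wordInv] at this

theorem wordInv_pos (W : Word g) (k : ℕ) (h : k < (wordInv g W).length)
    (h' : W.length - 1 - k < W.length) :
    pos ((wordInv g W)[k]) = pos (W[W.length - 1 - k]) + ((2*g : ℕ) : ZMod (4*g)) := by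
  simp only [wordInv, List.getElem_reverse, List.getElem_map, List.length_map]
  rw [pos_inv]

theorem rot_pos {A B : Word g} (hA : A.length = 4*g) {s ε : ZMod (4*g)}
    (h : ∀ k (hk : k < A.length), pos A[k] = s + ε * k) (hr : List.IsRotated A B) :
    ∃ s' : ZMod (4*g), ∀ k (hk : k < B.length), pos B[k] = s' + ε * k := by
  obtain ⟨n, rfl⟩ := hr
  refine ⟨s + ε * n, fun k hk => ?_⟩
  rw [List.getElem_rotate, h]
  rw [hA, ZMod.natCast_mod]
  push_cast; ring

theorem RSet_pos {B : Word g} (h : B ∈ RSet g) :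
    ∃ s ε : ZMod (4*g), (ε = 1 ∨ ε = -1) ∧ ∀ k (hk : k < B.length), pos B[k] = s + ε * k := by
  rcases h with h | h
  · obtain ⟨s, hs⟩ := rot_pos (s := 0) (ε := 1) Rword_length
      (fun k hk => by rw [Rword_pos]; ring) h
    exact ⟨s, 1, Or.inl rfl, hs⟩
  · obtain ⟨s, hs⟩ := rot_pos (A := wordInv g (Rword g)) (s := ((2*g : ℕ) : ZMod (4*g)) - 1)
      (ε := -1) (by rw [wordInv_length, Rword_length])
      (fun k hk => by
        have hk' := hk
        rw [wordInv_length, Rword_length] at hk'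
        rw [wordInv_pos _ _ _ (by rw [Rword_length]; omega), Rword_pos, Rword_length,
          Nat.sub_sub, Nat.cast_sub (by omega)]
        rw [ZMod.natCast_self]
        push_cast; ring) h
    exact ⟨s, -1, Or.inr rfl, hs⟩

theorem irr_le {X Z : Word g} (hX : IrreducibleWord g X) (h : eval g Z = eval g X) :
    X.length ≤ Z.length := by
  rcases hX Z h with rfl | h | h
  · exact le_rfl
  · exact h.le
  · exact h.1.le

theorem exists_irr (Z : Word g) : ∃ Y : Word g, eval g Y = eval g Z ∧ IrreducibleWord g Y := by
  have hwf : WellFounded (letterLt g) := InvImage.wf (rank g) Nat.lt_wfRel.wf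
  have hwf2 := List.Shortlex.wf hwf
  have htri : Std.Trichotomous (letterLt g) := by
    refine ⟨fun a c h1 h2 => ?_⟩
    simp only [letterLt] at h1 h2
    obtain ⟨⟨i, hi⟩, x⟩ := a
    obtain ⟨⟨j, hj⟩, y⟩ := c
    rcases x with _ | _ <;> rcases y with _ | _ <;> simp [rank] at h1 h2 ⊢ <;> omega
  obtain ⟨Y, hY, hmin⟩ := hwf2.has_min {W | eval g W = eval g Z} ⟨Z, rfl⟩
  refine ⟨Y, hY, fun W hW => ?_⟩
  by_cases hne : W = Y
  · exact Or.inl hne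
  · right
    have h1 := hmin W (hW.trans hY)
    by_contra h2
    apply hne
    exact (List.Shortlex.trichotomous (r := letterLt g)).trichotomous W Y h1
      (fun h => h2 (List.shortlex_def.1 h))

theorem irr_chain {X : Word g} (hX : IrreducibleWord g X) : FreelyReduced g X := by
  unfold FreelyReduced
  show List.IsChain _ _
  rw [List.isChain_iff_forall_rel_of_append_cons_cons]
  rintro a c A B rfl hc
  have := irr_le (Z := A ++ B) hX (by
    rw [eval_append, eval_append, eval_cons, eval_cons, hc, evalLetter_inv]; group)
  simp at this

theorem irr_short {A V Q P S : Word g} (hX : IrreducibleWord g (A ++ V ++ Q))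
    (h : eval g (P ++ V ++ S) = 1) : V.length ≤ P.length + S.length := by
  have := irr_le (Z := A ++ (wordInv g P ++ wordInv g S) ++ Q) hX (by
    have : eval g V = (eval g P)⁻¹ * (eval g S)⁻¹ := by
      simp only [eval_append] at h
      rw [mul_assoc] at h
      have := eq_inv_of_mul_eq_one_right h
      rw [eq_mul_inv_iff_mul_eq, this]
    simp only [eval_append, eval_wordInv, this])
  simp [wordInv_length] at this
  omega

theorem wpow_length (W : Word g) (t : ℕ) : (wpow g W t).length = t * W.length := by
  simp [wpow]

theorem wpow_getElem (W : Word g) (t i : ℕ) (h : i < (wpow g W t).length)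
    (h' : i % W.length < W.length) : (wpow g W t)[i] = W[i % W.length] := by
  induction t generalizing i with
  | zero => simp [wpow] at h
  | succ t ih =>
    have h2 : (wpow g W (t+1))[i] = (W ++ wpow g W t)[i]'(by rw [← wpow_succ]; exact h) := by
      simp only [wpow_succ]
    rw [h2, List.getElem_append]
    split_ifs with h3
    · simp only [Nat.mod_eq_of_lt h3]
    · have h4 : (i - W.length) % W.length = i % W.length := by
        rw [← Nat.mod_eq_sub_mod (by omega)]
      rw [ih (i - W.length) (by rw [wpow_succ, List.length_append] at h; omega) (by omega)]
      simp only [h4]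

theorem cast_ne (_hg : 2 ≤ g) (n : ℕ) (h0 : 0 < n) (h1 : n < 4*g) : (n : ZMod (4*g)) ≠ 0 := by
  intro h
  rw [ZMod.natCast_eq_zero_iff] at h
  exact absurd (Nat.le_of_dvd h0 h) (by omega)

theorem run_le (hg : 2 ≤ g) {s ε s' ε' : ZMod (4*g)} (hε : ε = 1 ∨ ε = -1)
    (hε' : ε' = 1 ∨ ε' = -1)
    {W : Word g} (hWl : W.length = 2*g-1) (hW : ∀ k (hk : k < W.length), pos W[k] = s + ε * (k+1))
    {t : ℕ} {P C Q : Word g} (hU : wpow g W t = P ++ C ++ Q)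
    (hC : ∀ k (hk : k < C.length), pos C[k] = s' + ε' * k) : C.length ≤ 2*g-1 := by
  by_contra hlen
  push Not at hlen
  have hget : ∀ k (hk : k < C.length), pos C[k] = s + ε * (((P.length + k) % (2*g-1) : ℕ) + 1) := by
    intro k hk
    have hlt : P.length + k < (wpow g W t).length := by rw [hU]; simp; omega
    have hmod : (P.length + k) % W.length < W.length := Nat.mod_lt _ (by omega)
    have h1 := wpow_getElem W t (P.length + k) hlt hmod
    have h2 : (wpow g W t)[P.length + k] = C[k] := by
      simp only [hU]
      rw [List.getElem_append_left (by simp; omega), List.getElem_append_right (by omega)]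
      simp
    rw [← h2, h1, hW]
    simp only [hWl]
  -- choose the boundary
  set p := P.length with hp
  obtain ⟨k, hk, hkm⟩ : ∃ k, k < 2*g-1 ∧ (p + k) % (2*g-1) = 2*g-2 := by
    refine ⟨2*g-2 - p % (2*g-1), by omega, ?_⟩
    have h1 : p % (2*g-1) < 2*g-1 := Nat.mod_lt _ (by omega)
    rw [Nat.add_mod, Nat.mod_eq_of_lt (a := 2*g-2 - p % (2*g-1)) (by omega),
      Nat.mod_eq_of_lt (by omega)]
    omega
  have hkm2 : (p + (k+1)) % (2*g-1) = 0 := by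
    rw [← Nat.add_assoc, Nat.add_mod, hkm, Nat.mod_eq_of_lt (a := 1) (by omega),
      show 2*g-2+1 = 2*g-1 by omega, Nat.mod_self]
  have e1 := hget k (by omega)
  have e2 := hget (k+1) (by omega)
  rw [hC, hkm] at e1
  rw [hC, hkm2] at e2
  have e3 : ε' = - (ε * ((2*g-2 : ℕ) : ZMod (4*g))) := by
    push_cast at e1 e2 ⊢
    linear_combination e2 - e1
  have n1 := cast_ne hg (2*g-1) (by omega) (by omega)
  have n2 := cast_ne hg (2*g-3) (by omega) (by omega)
  have q1 : ((2*g-1 : ℕ) : ZMod (4*g)) = ((2*g-2 : ℕ) : ZMod (4*g)) + 1 := by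
    rw [show 2*g-1 = 2*g-2+1 by omega]; push_cast; ring
  have q2 : ((2*g-2 : ℕ) : ZMod (4*g)) = ((2*g-3 : ℕ) : ZMod (4*g)) + 1 := by
    rw [show 2*g-2 = 2*g-3+1 by omega]; push_cast; ring
  rw [q1] at n1
  rcases hε with rfl | rfl <;> rcases hε' with rfl | rfl
  · exact n1 (by linear_combination e3)
  · exact n2 (by linear_combination e3 - q2)
  · exact n2 (by linear_combination -e3 - q2)
  · exact n1 (by linear_combination -e3)

theorem core (hg : 2 ≤ g) {s ε : ZMod (4*g)} (hε : ε = 1 ∨ ε = -1)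
    {W : Word g} (hWl : W.length = 2*g-1) (hW : ∀ k (hk : k < W.length), pos W[k] = s + ε * (k+1))
    {t : ℕ} (ht : 1 ≤ t) {X : Word g} (hX : IrreducibleWord g X) {P F Q : Word g}
    (hU : wpow g W t ++ X = P ++ F ++ Q) {a : Letter g} (hF : F ++ [a] ∈ RSet g) :
    ∃ Y : Word g, IrreducibleWord g Y ∧ Y.length < X.length ∧
      eval g X = (eval g W)⁻¹ * eval g Y ∧
      ∀ y ∈ Y.head?, pos y ≠ s + ε ∧ pos y ≠ s - ε := by
  have hFl : F.length = 4*g-1 := by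
    have := RSet_length hF
    simp at this; omega
  have hFe := RSet_eval hF
  obtain ⟨s', ε', hε', hpos⟩ := RSet_pos hF
  rw [List.append_assoc, List.append_eq_append_iff] at hU
  rcases hU with ⟨A, rfl, hXA⟩ | ⟨C, hUC, hFQ⟩
  · -- F inside X
    exfalso
    rw [← List.append_assoc] at hXA
    rw [hXA] at hX
    have := irr_short (P := []) (S := [a]) hX (by simpa using hFe)
    simp at this; omega
  rw [List.append_eq_append_iff] at hFQ
  rcases hFQ with ⟨D, hCD, hQD⟩ | ⟨V, rfl, rfl⟩
  · -- F inside U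
    exfalso
    have := run_le (P := P) (C := F) (Q := D) (s' := s') hg hε hε' hWl hW
      (by rw [hUC, hCD, List.append_assoc]) (fun k hk => by
        rw [← hpos k (by simp; omega), List.getElem_append_left])
    omega
  have hCl : C.length ≤ 2*g-1 :=
    run_le (P := P) (C := C) (Q := []) (s' := s') hg hε hε' hWl hW (by simpa using hUC)
      (fun k hk => by
        rw [← hpos k (by simp; omega), List.getElem_append_left (by simp; omega),
          List.getElem_append_left])
  have hVl : V.length ≤ 2*g := by
    by_contra hcon
    have := irr_short (A := []) (P := C) (S := [a]) (V := V) (Q := Q) (by simpa using hX)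
      hFe
    simp at this hFl
    omega
  have hsum : C.length + V.length = 4*g-1 := by simpa using hFl
  have hCW : C = W := by
    obtain ⟨t, rfl⟩ : ∃ t', t = t' + 1 := ⟨t-1, by omega⟩
    rw [wpow_succ_right] at hUC
    exact ((List.append_inj' hUC (by omega)).2).symm
  subst hCW
  have p0 := hpos 0 (by simp)
  have p1 := hpos 1 (by simp; omega)
  rw [List.getElem_append_left (by simp; omega), List.getElem_append_left (by omega), hW] at p0 p1
  obtain ⟨v, V, rfl⟩ : ∃ v V', V = v :: V' := by
    cases V with
    | nil => simp at hsum; omega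
    | cons v V => exact ⟨v, V, rfl⟩
  have pv := hpos (2*g-1) (by simp; omega)
  rw [List.getElem_append_left (by simp; omega), List.getElem_append_right (by omega)] at pv
  simp only [hWl, Nat.sub_self, List.getElem_cons_zero] at pv
  have pa := hpos (4*g-1) (by simp at hFl ⊢; omega)
  rw [List.getElem_append_right (by omega)] at pa
  simp only [hFl, Nat.sub_self, List.getElem_cons_zero] at pa
  have c4 : ((4*g-1 : ℕ) : ZMod (4*g)) = -1 := by
    rw [Nat.cast_sub (by omega), ZMod.natCast_self]; push_cast; ring
  have c2 : ((2*g-1 : ℕ) : ZMod (4*g)) = ((2*g : ℕ) : ZMod (4*g)) - 1 := by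
    rw [Nat.cast_sub (by omega), Nat.cast_one]
  have hs' : s' = s + ε := by
    push_cast at p0; linear_combination -p0
  have hee : ε' = ε := by
    push_cast at p1; linear_combination -p1 - hs'
  subst hee hs'
  rw [c4] at pa
  rw [c2] at pv
  have hpa : pos a = s := by linear_combination pa
  have h2g : ε' * ((2*g : ℕ) : ZMod (4*g)) = ((2*g : ℕ) : ZMod (4*g)) := by
    rcases hε with rfl | rfl
    · ring
    · linear_combination -(two_two (g := g))
  have hpv : pos v = s + ((2*g : ℕ) : ZMod (4*g)) := by linear_combination pv + h2g
  have hva : v = invLetter g a := pos_inj (by rw [pos_inv, hpa, hpv])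
  -- the element
  have hXe : eval g (v :: V ++ Q) = (eval g C)⁻¹ * eval g (v :: Q) := by
    rw [eval_append, eval_append, eval_cons a, eval_nil, mul_one, mul_assoc] at hFe
    have h1 : eval g (v :: V) = (eval g C)⁻¹ * evalLetter g v := by
      rw [hva, evalLetter_inv, ← hva, eq_inv_mul_iff_mul_eq, eq_inv_iff_mul_eq_one, mul_assoc]
      exact hFe
    rw [eval_append, h1, eval_cons v Q, mul_assoc]
  obtain ⟨Y, hYe, hY⟩ := exists_irr (v :: Q)
  have hXY : eval g (wordInv g C ++ Y) = eval g (v :: V ++ Q) := by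
    rw [eval_append, eval_wordInv, hYe, hXe]
  have l1 := irr_le hY hYe.symm
  have l2 := irr_le hX hXY
  simp only [List.length_append, List.length_cons, wordInv_length] at l1 l2 hsum
  refine ⟨Y, hY, by simp; omega, by rw [hXe, hYe], ?_⟩
  cases Y with
  | nil => simp
  | cons y Y =>
  simp only [List.length_cons] at l1 l2
  intro y' hy'
  have : y' = y := by simpa using hy'.symm
  subst this
  -- last letter and first letter of C
  have hCne : C ≠ [] := by rintro rfl; simp at hWl; omega
  constructor
  · intro hc
    cases C with
    | nil => exact hCne rfl
    | cons c C =>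
    have hcy : c = y' := pos_inj (by
      have := hW 0 (by simp)
      simp at this
      rw [this, hc])
    have := irr_le (Z := wordInv g C ++ Y) hX (by
      rw [← hXY, wordInv_cons, eval_append, eval_append, eval_append, eval_cons, eval_cons,
        eval_nil, evalLetter_inv, hcy]
      group)
    simp [wordInv_length] at this hWl
    omega
  · intro hc
    -- the head of the inverse of C
    obtain ⟨z, Z, hz⟩ : ∃ z Z', wordInv g C = z :: Z' := by
      cases h : wordInv g C with
      | nil =>
        have := wordInv_length C
        rw [h, hWl] at this; simp at this; omega
      | cons z Z => exact ⟨z, Z, rfl⟩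
    have pz : pos z = s - ε' := by
      have h1 := wordInv_pos C 0 (by rw [wordInv_length]; omega) (by omega)
      simp only [hz, List.getElem_cons_zero] at h1
      rw [h1, hW]
      simp only [hWl, Nat.sub_zero]
      rw [show 2*g-1-1 = 2*g-2 by omega, Nat.cast_sub (by omega)]
      push_cast
      have h2 := h2g
      have h3 := two_two (g := g)
      push_cast at h2 h3
      linear_combination h2 + h3
    have hyz : y' = z := pos_inj (by rw [hc, pz])
    subst hyz
    have hne : v ≠ y' := by
      intro h
      rw [h, hc] at hpv
      rcases hε with rfl | rfl
      · apply cast_ne hg (2*g+1) (by omega) (by omega)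
        push_cast at hpv ⊢
        linear_combination -hpv
      · apply cast_ne hg (2*g-1) (by omega) (by omega)
        rw [c2]
        linear_combination -hpv
    rw [hz] at hXY
    have hlt1 : rank g v < rank g y' := by
      rcases hX _ hXY with h | h | ⟨-, h⟩
      · simp at h; exact absurd h.1.symm hne
      · exfalso
        have := wordInv_length C
        rw [hz] at this
        simp at h this
        omega
      · cases h with
        | cons h => exact absurd rfl hne
        | rel h => exact h
    rcases hY _ hYe.symm with h | h | ⟨-, h⟩
    · simp at h; exact hne h.1
    · simp at h; omega
    · cases h with
      | cons h => exact hne rfl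
      | rel h => exact absurd hlt1 (Nat.lt_asymm h)

theorem FR_ext {F : Word g} (hg : 2 ≤ g) (h : IsFR g (4*g-1) F) : ∃ a, F ++ [a] ∈ RSet g := by
  obtain ⟨-, -, B, hB, rfl⟩ := h
  have hl := RSet_length hB
  refine ⟨B[4*g-1]'(by omega), ?_⟩
  rw [List.take_append_getElem, List.take_of_length_le (by omega)]
  exact hB

theorem freely_conj {U Y : Word g} {u w : Letter g} (hU : FreelyReduced g U)
    (hu : U.head? = some u) (hw : U.getLast? = some w) (hY : FreelyReduced g Y)
    (h : ∀ y ∈ Y.head?, y ≠ u ∧ y ≠ invLetter g w) :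
    FreelyReduced g (wordInv g Y ++ U ++ Y) := by
  have hYi : FreelyReduced g (wordInv g Y) := by
    unfold FreelyReduced at hY ⊢
    change List.IsChain _ _ at hY
    show List.IsChain _ _
    unfold wordInv
    rw [List.isChain_reverse, List.isChain_map]
    refine hY.imp ?_
    intro a c hac hca
    rw [invLetter_inv] at hca
    exact hac hca.symm
  unfold FreelyReduced at hU hY hYi ⊢
  change List.IsChain _ _ at hU hY hYi
  show List.IsChain _ _
  rw [List.append_assoc, List.isChain_append]
  refine ⟨hYi, ?_, ?_⟩
  · rw [List.isChain_append]
    refine ⟨hU, hY, ?_⟩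
    intro x hx y hy
    rw [hw] at hx
    have : x = w := by simpa using hx.symm
    subst this
    exact (h y hy).2
  · intro x hx y hy
    cases U with
    | nil => simp at hu
    | cons u' U =>
    cases Y with
    | nil => simp [wordInv] at hx
    | cons z Y =>
    have h1 : u' = u := by simpa using hu
    have h2 : y = u' := by simpa using hy.symm
    have h3 : x = invLetter g z := by simpa [wordInv] using hx.symm
    have h4 := (h z (by simp)).1
    subst h1 h2 h3
    rw [invLetter_inv]
    exact h4.symm

end SG

open SG

/-- For `U = (b₁⋯b_{2g−1})^t` and `X` irreducible with `X⁻¹UX`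
freely reduced: if `X⁻¹U` or `UX` contains a `(4g−1)`-LLFR, then there is an
irreducible `Y` with `X⁻¹UX = Y⁻¹UY` in `G`, `Y⁻¹UY` freely reduced, and neither
`Y⁻¹U` nor `UY` containing a `(4g−1)`-LLFR. -/
theorem special_remove_long_LLFR (g : ℕ) (hg : 2 ≤ g) (b : ℕ → SG.Letter g)
    (hb : SG.RelSeq g b) (t : ℕ) (ht : 1 ≤ t) (X : SG.Word g)
    (hX : SG.IrreducibleWord g X)
    (hfr : SG.FreelyReduced g
      (SG.wordInv g X ++ SG.wpow g (SG.seg g b 1 (2*g-1)) t ++ X))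
    (hLL : SG.HasLLFR g (4*g-1)
        (SG.wordInv g X ++ SG.wpow g (SG.seg g b 1 (2*g-1)) t) ∨
      SG.HasLLFR g (4*g-1) (SG.wpow g (SG.seg g b 1 (2*g-1)) t ++ X)) :
    ∃ Y : SG.Word g, SG.IrreducibleWord g Y ∧
      SG.eval g (SG.wordInv g X ++ SG.wpow g (SG.seg g b 1 (2*g-1)) t ++ X) =
        SG.eval g (SG.wordInv g Y ++ SG.wpow g (SG.seg g b 1 (2*g-1)) t ++ Y) ∧
      SG.FreelyReduced g
        (SG.wordInv g Y ++ SG.wpow g (SG.seg g b 1 (2*g-1)) t ++ Y) ∧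
      ¬ SG.HasLLFR g (4*g-1)
        (SG.wordInv g Y ++ SG.wpow g (SG.seg g b 1 (2*g-1)) t) ∧
      ¬ SG.HasLLFR g (4*g-1) (SG.wpow g (SG.seg g b 1 (2*g-1)) t ++ Y) := by
  have h4 : (seg g b 1 (4*g)).length = 4*g := by simp [seg]
  obtain ⟨s₀, ε, hε, hpos⟩ := RSet_pos hb.2
  set W := seg g b 1 (2*g-1) with hWdef
  have hWl : W.length = 2*g-1 := by simp [W, seg]
  obtain ⟨s, rfl⟩ : ∃ s, s₀ = s + ε := ⟨s₀ - ε, by ring⟩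
  have hW : ∀ k (hk : k < W.length), pos W[k] = s + ε * (k+1) := by
    intro k hk
    rw [hWl] at hk
    have := hpos k (by omega)
    simp only [seg, List.getElem_map, List.getElem_range] at this
    simp only [W, seg, List.getElem_map, List.getElem_range]
    rw [this]; ring
  have hWil : (wordInv g W).length = 2*g-1 := by rw [wordInv_length, hWl]
  have h2g : ε * ((2*g : ℕ) : ZMod (4*g)) = ((2*g : ℕ) : ZMod (4*g)) := by
    rcases hε with rfl | rfl
    · ring
    · linear_combination -(two_two (g := g))
  have hWi : ∀ k (hk : k < (wordInv g W).length), pos (wordInv g W)[k] = s + (-ε) * (k+1) := by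
    intro k hk
    rw [hWil] at hk
    rw [wordInv_pos _ _ _ (by omega), hW]
    have : W.length - 1 - k = 2*g - (k+2) := by omega
    simp only [this]
    rw [Nat.cast_sub (by omega)]
    have h3 := two_two (g := g)
    push_cast at h2g h3 ⊢
    linear_combination h2g + h3
  have hε2 : -ε = 1 ∨ -ε = -1 := by
    rcases hε with rfl | rfl
    · right; rfl
    · left; ring
  obtain ⟨t, rfl⟩ : ∃ t', t = t' + 1 := ⟨t-1, by omega⟩
  have hUfr : FreelyReduced g (wpow g W (t+1)) := by
    refine List.IsChain.infix hfr ⟨wordInv g X, X, rfl⟩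
  have hhead : (wpow g W (t+1)).head? = some (W[0]'(by omega)) := by
    rw [wpow_succ, List.head?_append_of_ne_nil _ (by intro h; rw [h] at hWl; simp at hWl; omega)]
    rw [List.head?_eq_getElem?, List.getElem?_eq_getElem]
  have hlast : (wpow g W (t+1)).getLast? = some (W[2*g-2]'(by omega)) := by
    rw [wpow_succ_right, List.getLast?_append_of_ne_nil _
      (by intro h; rw [h] at hWl; simp at hWl; omega)]
    rw [List.getLast?_eq_getElem?, show W.length - 1 = 2*g-2 by omega, List.getElem?_eq_getElem]
  clear hLL
  induction hn : X.length using Nat.strong_induction_on generalizing X with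
  | _ n ih =>
  subst hn
  -- the reduction step
  have step : ∀ Y : Word g, IrreducibleWord g Y → Y.length < X.length →
      (eval g X = (eval g W)⁻¹ * eval g Y ∨ eval g X = eval g W * eval g Y) →
      (∀ y ∈ Y.head?, pos y ≠ s + ε ∧ pos y ≠ s - ε) →
      ∃ Y : SG.Word g, SG.IrreducibleWord g Y ∧
      SG.eval g (SG.wordInv g X ++ SG.wpow g W (t+1) ++ X) =
        SG.eval g (SG.wordInv g Y ++ SG.wpow g W (t+1) ++ Y) ∧
      SG.FreelyReduced g (SG.wordInv g Y ++ SG.wpow g W (t+1) ++ Y) ∧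
      ¬ SG.HasLLFR g (4*g-1) (SG.wordInv g Y ++ SG.wpow g W (t+1)) ∧
      ¬ SG.HasLLFR g (4*g-1) (SG.wpow g W (t+1) ++ Y) := by
    intro Y hY hlen heq hh
    have hYfr : FreelyReduced g (wordInv g Y ++ wpow g W (t+1) ++ Y) := by
      refine freely_conj hUfr hhead hlast (irr_chain hY) ?_
      intro y hy
      constructor
      · rintro rfl
        apply (hh _ hy).1
        rw [hW]; push_cast; ring
      · rintro rfl
        apply (hh _ hy).2
        rw [pos_inv, hW, Nat.cast_sub (by omega)]
        have h3 := two_two (g := g)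
        push_cast at h2g h3 ⊢
        linear_combination h2g + h3
    have hev : eval g (wordInv g X ++ wpow g W (t+1) ++ X) =
        eval g (wordInv g Y ++ wpow g W (t+1) ++ Y) := by
      simp only [eval_append, eval_wordInv, eval_wpow]
      rcases heq with heq | heq <;> rw [heq] <;> group
    obtain ⟨Y', h1, h2, h3⟩ := ih Y.length hlen Y hY hYfr rfl
    exact ⟨Y', h1, hev.trans h2, h3⟩
  by_cases hR : HasLLFR g (4*g-1) (wpow g W (t+1) ++ X)
  · obtain ⟨P, F, Q, hPFQ, hFR, -, -⟩ := hR
    obtain ⟨a, ha⟩ := FR_ext hg hFR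
    obtain ⟨Y, h1, h2, h3, h5⟩ := core hg hε hWl hW (by omega) hX hPFQ ha
    exact step Y h1 h2 (Or.inl h3) h5
  by_cases hL : HasLLFR g (4*g-1) (wordInv g X ++ wpow g W (t+1))
  · obtain ⟨P, F, Q, hPFQ, hFR, -, -⟩ := hL
    obtain ⟨a, ha⟩ := FR_ext hg hFR
    have hPFQ2 : wpow g (wordInv g W) (t+1) ++ X = wordInv g Q ++ wordInv g F ++ wordInv g P := by
      have := congrArg (wordInv g) hPFQ
      simpa only [wordInv_append, wordInv_wordInv, wordInv_wpow, List.append_assoc] using this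
    have ha2 : wordInv g F ++ [invLetter g a] ∈ RSet g := by
      rw [← wordInv_cons]
      apply RSet_inv
      apply RSet_rot ha
      exact ⟨F.length, by simp⟩
    obtain ⟨Y, h1, h2, h3, h5⟩ := core hg hε2 hWil hWi (by omega) hX hPFQ2 ha2
    refine step Y h1 h2 (Or.inr ?_) ?_
    · rw [h3, eval_wordInv, inv_inv]
    · intro y hy
      have := h5 y hy
      rw [sub_neg_eq_add, ← sub_eq_add_neg] at this
      exact this.symm
  exact ⟨X, hX, rfl, hfr, hL, hR⟩
end
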